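/- Decay slightly away from the vortices: for every Λ₀ > 0 there exist C(Λ₀) > 0, R₀(Λ₀) > 0 and 𝔭₀(Λ₀) > 0 such that, if u satisfies the quasi-minimizer hypotheses with momentum 𝔭 ≥ 𝔭₀(Λ₀) and speed c, and z ∈ ℝ² is a zero of u, then for every y ∈ ℝ² with 2R₀ ≤ |y| ≤ (3/20)𝔭 one has: | |u(z + y)| − 1 | ≤ C(Λ₀)/|y|², | ∇|u|(z + y) | ≤ C(Λ₀)/|y|³, and | ∇u(z + y) | ≤ C(Λ₀)/|y|. -/

import Mathlib

open MeasureTheory Filter Metric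

noncomputable section

/-- First partial derivative (direction `x₁`), identifying `ℝ²` with `ℂ`. -/
def pd1 (u : ℂ → ℂ) (z : ℂ) : ℂ := fderiv ℝ u z 1

/-- Second partial derivative (direction `x₂`). -/
def pd2 (u : ℂ → ℂ) (z : ℂ) : ℂ := fderiv ℝ u z Complex.I

/-- Laplacian `Δu`. -/
def lap (u : ℂ → ℂ) (z : ℂ) : ℂ := fderiv ℝ (pd1 u) z 1 + fderiv ℝ (pd2 u) z Complex.I

/-- `|∇u|²`. -/
def gradSq (u : ℂ → ℂ) (z : ℂ) : ℝ := ‖pd1 u z‖ ^ 2 + ‖pd2 u z‖ ^ 2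

/-- Ginzburg–Landau energy density. -/
def energyDensity (u : ℂ → ℂ) (z : ℂ) : ℝ :=
  (1 / 2) * gradSq u z + (1 / 4) * (1 - ‖u z‖ ^ 2) ^ 2

/-- Ginzburg–Landau energy, valued in `[0,∞]`. -/
def energy (u : ℂ → ℂ) : ENNReal := ∫⁻ z : ℂ, ENNReal.ofReal (energyDensity u z)

/-- `E(u)`, real valued. -/
def Efun (u : ℂ → ℂ) : ℝ := (energy u).toReal

/-- The energy space `ℰ`: (smooth) maps with finite Ginzburg–Landau energy. -/
def memE (u : ℂ → ℂ) : Prop := ContDiff ℝ (⊤ : ℕ∞) u ∧ energy u < ⊤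

/-- Momentum density `Re(i ∂₂u (conj u − 1))`. -/
def momDensity (u : ℂ → ℂ) (z : ℂ) : ℝ :=
  (Complex.I * pd2 u z * ((starRingEnd ℂ) (u z) - 1)).re

/-- Integrability of the momentum density. -/
def momInt (u : ℂ → ℂ) : Prop := Integrable (momDensity u)

/-- The momentum `P₂(u)`. -/
def P2 (u : ℂ → ℂ) : ℝ := (1 / 2) * ∫ z : ℂ, momDensity u z

/-- `(TW_c)(u) = 0`: the travelling wave equation `−ic∂₂u − Δu − (1−|u|²)u = 0`. -/
def TW (c : ℝ) (u : ℂ → ℂ) : Prop :=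
  ∀ z : ℂ, -(Complex.I * (c : ℂ) * pd2 u z) - lap u z - ((1 - ‖u z‖ ^ 2 : ℝ) : ℂ) * u z = 0

/-- `E_min(p)`. -/
def Emin (p : ℝ) : ℝ := sInf (Efun '' {u : ℂ → ℂ | memE u ∧ P2 u = p})

/-- Evenness in `x₁`: `u(−x₁, x₂) = u(x₁, x₂)`. -/
def evenX1 (u : ℂ → ℂ) : Prop := ∀ z : ℂ, u (-((starRingEnd ℂ) z)) = u z

/-- Quasi-minimizer hypotheses (with symmetry), momentum `p` and speed `c`. -/
def QuasiMin (Λ₀ : ℝ) (u : ℂ → ℂ) (p c : ℝ) : Prop :=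
  memE u ∧ evenX1 u ∧ 0 < c ∧ TW c u ∧ momInt u ∧ P2 u = p ∧
  Efun u ≤ 2 * Real.pi * Real.log p + Λ₀

/-- `V1` is the degree-one vortex with (increasing) modulus profile `ρ`. -/
def IsVortex (V1 : ℂ → ℂ) (ρ : ℝ → ℝ) : Prop :=
  ContDiff ℝ (⊤ : ℕ∞) V1 ∧
  (∀ z : ℂ, lap V1 z + V1 z * ((1 - ‖V1 z‖ ^ 2 : ℝ) : ℂ) = 0) ∧
  V1 0 = 0 ∧
  (∀ z : ℂ, z ≠ 0 → V1 z = ((ρ ‖z‖ : ℝ) : ℂ) * (z / (‖z‖ : ℂ))) ∧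
  ρ 0 = 0 ∧ StrictMonoOn ρ (Set.Ici 0) ∧
  (∀ r : ℝ, 0 ≤ r → 0 ≤ ρ r ∧ ρ r < 1) ∧
  Filter.Tendsto ρ Filter.atTop (nhds 1)

namespace GinzburgLandau
open scoped ContDiff Topology

variable {F : Type*} [NormedAddCommGroup F] [NormedSpace ℝ F]

/-- Directional derivative. -/
def dd (e : ℂ) (f : ℂ → F) (z : ℂ) : F := fderiv ℝ f z e

/-- Laplacian of a function on the plane. -/
def Lap (f : ℂ → F) (z : ℂ) : F := dd 1 (dd 1 f) z + dd Complex.I (dd Complex.I f) z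

@[fun_prop]
theorem contDiff_dd {e : ℂ} {f : ℂ → F} (hf : ContDiff ℝ ∞ f) : ContDiff ℝ ∞ (dd e f) := by
  unfold dd
  exact (hf.fderiv_right (m := ∞) (by simp)).clm_apply contDiff_const

@[fun_prop]
theorem continuous_dd {e : ℂ} {f : ℂ → F} (hf : ContDiff ℝ ∞ f) : Continuous (dd e f) :=
  (contDiff_dd hf).continuous

@[fun_prop]
theorem contDiff_Lap {f : ℂ → F} (hf : ContDiff ℝ ∞ f) : ContDiff ℝ ∞ (Lap f) := by
  unfold Lap; fun_prop

theorem differentiable_of_smooth {f : ℂ → F} (hf : ContDiff ℝ ∞ f) : Differentiable ℝ f :=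
  hf.differentiable (by simp)

theorem dd_add {e : ℂ} {f g : ℂ → F} (hf : ContDiff ℝ ∞ f) (hg : ContDiff ℝ ∞ g) :
    dd e (fun z => f z + g z) = fun z => dd e f z + dd e g z := by
  funext z
  simp [dd, fderiv_fun_add (differentiable_of_smooth hf z) (differentiable_of_smooth hg z)]

theorem dd_sub {e : ℂ} {f g : ℂ → F} (hf : ContDiff ℝ ∞ f) (hg : ContDiff ℝ ∞ g) :
    dd e (fun z => f z - g z) = fun z => dd e f z - dd e g z := by
  funext z
  simp [dd, fderiv_fun_sub (differentiable_of_smooth hf z) (differentiable_of_smooth hg z)]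

theorem dd_neg {e : ℂ} {f : ℂ → F} :
    dd e (fun z => - f z) = fun z => - dd e f z := by
  funext z
  simp [dd, fderiv_fun_neg]

theorem dd_const {e : ℂ} {a : F} : dd e (fun _ => a) = fun _ => 0 := by
  funext z
  simp [dd]

theorem dd_mul {e : ℂ} {f g : ℂ → ℝ} (hf : ContDiff ℝ ∞ f) (hg : ContDiff ℝ ∞ g) :
    dd e (fun z => f z * g z) = fun z => dd e f z * g z + f z * dd e g z := by
  funext z
  simp [dd, fderiv_fun_mul (differentiable_of_smooth hf z) (differentiable_of_smooth hg z)]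
  ring

theorem dd_pow {e : ℂ} {f : ℂ → ℝ} (hf : ContDiff ℝ ∞ f) (n : ℕ) :
    dd e (fun z => f z ^ n) = fun z => n * f z ^ (n - 1) * dd e f z := by
  funext z
  simp [dd, fderiv_fun_pow n (differentiable_of_smooth hf z)]

theorem dd_comp {e : ℂ} {φ : ℝ → ℝ} {f : ℂ → ℝ} (hφ : ContDiff ℝ ∞ φ) (hf : ContDiff ℝ ∞ f) :
    dd e (fun z => φ (f z)) = fun z => deriv φ (f z) * dd e f z := by
  funext z
  have h1 : HasDerivAt φ (deriv φ (f z)) (f z) :=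
    ((hφ.differentiable (by simp)) (f z)).hasDerivAt
  have h2 := h1.comp_hasFDerivAt z (differentiable_of_smooth hf z).hasFDerivAt
  have h3 : fderiv ℝ (fun z => φ (f z)) z = deriv φ (f z) • fderiv ℝ f z := h2.fderiv
  simp [dd, h3]

theorem two_le_infty : (2 : WithTop ℕ∞) ≤ ∞ :=
  WithTop.coe_le_coe.2 (le_top : (2 : ℕ∞) ≤ ⊤)

theorem dd_comm {e e' : ℂ} {f : ℂ → ℝ} (hf : ContDiff ℝ ∞ f) :
    dd e (dd e' f) = dd e' (dd e f) := by
  funext z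
  have hs : IsSymmSndFDerivAt ℝ f z :=
    (hf.contDiffAt).isSymmSndFDerivAt (by simpa using two_le_infty)
  have hd : DifferentiableAt ℝ (fderiv ℝ f) z :=
    ((hf.fderiv_right (m := ∞) (by simp)).differentiable (by simp)) z
  have key : ∀ a b : ℂ, dd a (dd b f) z = fderiv ℝ (fderiv ℝ f) z a b := by
    intro a b
    unfold dd
    rw [fderiv_clm_apply hd (differentiableAt_const b)]
    simp
  rw [key, key]
  exact hs.eq e e'

@[simp] theorem dd_one_re : dd 1 Complex.re = fun _ => (1 : ℝ) := by
  funext z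
  have : HasFDerivAt Complex.re Complex.reCLM z := Complex.reCLM.hasFDerivAt
  simp [dd, this.fderiv]

@[simp] theorem dd_one_im : dd 1 Complex.im = fun _ => (0 : ℝ) := by
  funext z
  have : HasFDerivAt Complex.im Complex.imCLM z := Complex.imCLM.hasFDerivAt
  simp [dd, this.fderiv]

@[simp] theorem dd_I_re : dd Complex.I Complex.re = fun _ => (0 : ℝ) := by
  funext z
  have : HasFDerivAt Complex.re Complex.reCLM z := Complex.reCLM.hasFDerivAt
  simp [dd, this.fderiv]

@[simp] theorem dd_I_im : dd Complex.I Complex.im = fun _ => (1 : ℝ) := by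
  funext z
  have : HasFDerivAt Complex.im Complex.imCLM z := Complex.imCLM.hasFDerivAt
  simp [dd, this.fderiv]

@[fun_prop] theorem contDiff_re {n : WithTop ℕ∞} : ContDiff ℝ n Complex.re := Complex.reCLM.contDiff
@[fun_prop] theorem contDiff_im {n : WithTop ℕ∞} : ContDiff ℝ n Complex.im := Complex.imCLM.contDiff

theorem Lap_sq {f : ℂ → ℝ} (hf : ContDiff ℝ ∞ f) (z : ℂ) :
    Lap (fun z => f z ^ 2) z = 2 * f z * Lap f z + 2 * (dd 1 f z ^ 2 + dd Complex.I f z ^ 2) := by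
  unfold Lap
  simp (disch := fun_prop) only [dd_pow, dd_mul, dd_const]
  norm_num
  ring

theorem dd_comp_affine {e x : ℂ} {f : ℂ → F} (A : ℂ →L[ℝ] ℂ) (hf : ContDiff ℝ ∞ f) :
    dd e (fun z => f (x + A z)) = fun z => dd (A e) f (x + A z) := by
  funext z
  have h1 : HasFDerivAt (fun z => x + A z) A z := A.hasFDerivAt.const_add x
  have h2 := (differentiable_of_smooth hf (x + A z)).hasFDerivAt.comp z h1
  have h3 : fderiv ℝ (fun z => f (x + A z)) z = (fderiv ℝ f (x + A z)).comp A := h2.fderiv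
  simp [dd, h3]

theorem dd_neg_dir {e : ℂ} {f : ℂ → F} : dd (-e) f = fun z => - dd e f z := by
  funext z; simp [dd]

theorem contDiff_comp_affine {x : ℂ} {f : ℂ → F} (A : ℂ →L[ℝ] ℂ) (hf : ContDiff ℝ ∞ f) :
    ContDiff ℝ ∞ (fun z => f (x + A z)) :=
  hf.comp (contDiff_const.add A.contDiff)

/-- Second derivative test along a line. -/
theorem dd_dd_nonpos_of_isLocalMax {e x : ℂ} {f : ℂ → ℝ} (hf : ContDiff ℝ ∞ f)
    (hx : IsLocalMax f x) : dd e (dd e f) x ≤ 0 := by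
  by_contra! hpos
  have hline : ∀ {g : ℂ → ℝ}, ContDiff ℝ ∞ g → ∀ t : ℝ,
      HasDerivAt (fun t : ℝ => g (x + t * e)) (dd e g (x + t * e)) t := by
    intro g hg t
    have h1 : HasDerivAt (fun t : ℝ => x + t * e) e t := by
      simpa using ((Complex.ofRealCLM.hasDerivAt (x := t)).mul_const e).const_add x
    exact (differentiable_of_smooth hg (x + t * e)).hasFDerivAt.comp_hasDerivAt t h1
  have hc : Tendsto (fun t : ℝ => x + t * e) (𝓝 0) (𝓝 x) := by
    have : Continuous (fun t : ℝ => x + t * e) := by fun_prop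
    simpa using this.tendsto 0
  have d1 : deriv (fun t : ℝ => f (x + t * e)) = fun t : ℝ => dd e f (x + t * e) :=
    funext fun t => (hline hf t).deriv
  have d2 : deriv (deriv (fun t : ℝ => f (x + t * e))) 0 = dd e (dd e f) x := by
    rw [d1, (hline (contDiff_dd hf) 0).deriv]; simp
  have hmax : IsLocalMax (fun t : ℝ => f (x + t * e)) 0 := by
    have := hc.eventually hx
    simpa [IsLocalMax, IsMaxFilter] using this
  have hmin : IsLocalMin (fun t : ℝ => f (x + t * e)) 0 := by
    refine isLocalMin_of_deriv_deriv_pos (by rw [d2]; exact hpos) hmax.deriv_eq_zero ?_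
    exact (hline hf 0).continuousAt
  have heq : (fun t : ℝ => f (x + t * e)) =ᶠ[𝓝 0] fun _ => f (x + (0 : ℝ) * e) := by
    filter_upwards [hmax, hmin] with t h1 h2
    exact le_antisymm h1 h2
  have := heq.deriv.deriv_eq
  rw [d2] at this
  simp at this
  linarith

theorem Lap_nonpos_of_isLocalMax {x : ℂ} {f : ℂ → ℝ} (hf : ContDiff ℝ ∞ f)
    (hx : IsLocalMax f x) : Lap f x ≤ 0 :=
  add_nonpos (dd_dd_nonpos_of_isLocalMax hf hx) (dd_dd_nonpos_of_isLocalMax hf hx)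

/-- Weak maximum principle. -/
theorem max_principle {K U : Set ℂ} {f : ℂ → ℝ} (hK : IsCompact K) (hU : IsOpen U) (hUK : U ⊆ K)
    (hf : ContDiff ℝ ∞ f) (hb : ∀ x ∈ K, x ∉ U → f x ≤ 0)
    (hi : ∀ x ∈ U, 0 < f x → dd 1 f x = 0 → dd Complex.I f x = 0 → 0 < Lap f x) :
    ∀ x ∈ K, f x ≤ 0 := by
  intro x hxK
  obtain ⟨y, hyK, hy⟩ := hK.exists_isMaxOn ⟨x, hxK⟩ hf.continuous.continuousOn
  refine (hy hxK).trans ?_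
  by_contra! hpos
  have hyU : y ∈ U := by
    by_contra h
    exact absurd (hb y hyK h) (not_le.2 hpos)
  have hloc : IsLocalMax f y := by
    filter_upwards [hU.mem_nhds hyU] with z hz using hy (hUK hz)
  have h0 : fderiv ℝ f y = 0 := hloc.fderiv_eq_zero
  have := hi y hyU hpos (by simp [dd, h0]) (by simp [dd, h0])
  exact absurd (Lap_nonpos_of_isLocalMax hf hloc) (not_le.2 this)

end GinzburgLandau

namespace GinzburgLandau
open scoped ContDiff Topology

theorem Lap_translate {f : ℂ → ℝ} (hf : ContDiff ℝ ∞ f) (x z : ℂ) :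
    Lap (fun z => f (x + z)) z = Lap f (x + z) := by
  have h := fun (e : ℂ) (g : ℂ → ℝ) (hg : ContDiff ℝ ∞ g) =>
    dd_comp_affine (e := e) (x := x) (ContinuousLinearMap.id ℝ ℂ) hg
  simp only [ContinuousLinearMap.id_apply] at h
  unfold Lap
  rw [h 1 f hf, h Complex.I f hf, h 1 _ (contDiff_dd hf), h Complex.I _ (contDiff_dd hf)]

/-- Complex conjugation as a real-linear map. -/
def conjL : ℂ →L[ℝ] ℂ := Complex.conjCLE.toContinuousLinearMap

@[simp] theorem conjL_apply (z : ℂ) : conjL z = (starRingEnd ℂ) z := rfl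

/-- Exchange of the two coordinates. -/
def swapL : ℂ →L[ℝ] ℂ := (ContinuousLinearMap.mul ℝ ℂ Complex.I).comp conjL

@[simp] theorem swapL_apply (z : ℂ) : swapL z = Complex.I * (starRingEnd ℂ) z := rfl

theorem Lap_conj {f : ℂ → ℝ} (hf : ContDiff ℝ ∞ f) (x z : ℂ) :
    Lap (fun z => f (x + conjL z)) z = Lap f (x + conjL z) := by
  unfold Lap
  rw [dd_comp_affine conjL hf, dd_comp_affine conjL hf, dd_comp_affine conjL (contDiff_dd hf),
    dd_comp_affine conjL (contDiff_dd hf)]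
  simp [dd_neg_dir, dd_neg]

theorem Lap_swap {f : ℂ → ℝ} (hf : ContDiff ℝ ∞ f) (x z : ℂ) :
    Lap (fun z => f (x + swapL z)) z = Lap f (x + swapL z) := by
  unfold Lap
  rw [dd_comp_affine swapL hf, dd_comp_affine swapL hf, dd_comp_affine swapL (contDiff_dd hf),
    dd_comp_affine swapL (contDiff_dd hf)]
  simp [add_comm]

theorem hasDerivAt_line {g : ℂ → ℝ} (hg : ContDiff ℝ ∞ g) (x e : ℂ) (t : ℝ) :
    HasDerivAt (fun t : ℝ => g (x + t * e)) (dd e g (x + t * e)) t := by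
  have h1 : HasDerivAt (fun t : ℝ => x + t * e) e t := by
    simpa using ((Complex.ofRealCLM.hasDerivAt (x := t)).mul_const e).const_add x
  exact (differentiable_of_smooth hg (x + t * e)).hasFDerivAt.comp_hasDerivAt t h1

theorem deriv_le_of_le_linear {k : ℝ → ℝ} {k' C d : ℝ} (hd : 0 < d) (hk : HasDerivAt k k' 0)
    (h0 : k 0 = 0) (h : ∀ t ∈ Set.Ioo 0 d, k t ≤ C * t) : k' ≤ C := by
  have h1 := hk.tendsto_slope_zero_right
  refine le_of_tendsto h1 ?_
  filter_upwards [Ioo_mem_nhdsGT hd] with t ht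
  simp only [zero_add, h0, sub_zero, smul_eq_mul]
  rw [inv_mul_le_iff₀ ht.1]
  linarith [h t ht]

theorem norm_le_two_mul {z : ℂ} {d : ℝ} (h1 : |z.re| ≤ d) (h2 : |z.im| ≤ d) : ‖z‖ ≤ 2 * d :=
  (Complex.norm_le_abs_re_add_abs_im z).trans (by linarith)

private theorem dd_I_le {f : ℂ → ℝ} (hf : ContDiff ℝ ∞ f) {x : ℂ} {d M N : ℝ} (hd : 0 < d)
    (hM : ∀ z ∈ closedBall x (2 * d), |f z| ≤ M) (hN : ∀ z ∈ closedBall x (2 * d), |Lap f z| < N) :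
    dd Complex.I f x ≤ 2 * M / d + N * d / 2 := by
  have hM0 : 0 ≤ M := (abs_nonneg _).trans (hM x (mem_closedBall_self (by linarith)))
  have hN0 : 0 ≤ N := ((abs_nonneg _).trans_lt (hN x (mem_closedBall_self (by linarith)))).le
  have hft : ContDiff ℝ ∞ (fun z => f (x + z)) := by fun_prop
  have hfc : ContDiff ℝ ∞ (fun z => f (x + conjL z)) := contDiff_comp_affine conjL hf
  have hin : ∀ z : ℂ, |z.re| ≤ d → |z.im| ≤ d →
      x + z ∈ closedBall x (2 * d) ∧ x + conjL z ∈ closedBall x (2 * d) := by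
    intro z h1 h2
    have := norm_le_two_mul h1 h2
    constructor <;> simpa [mem_closedBall, dist_eq_norm] using this
  set g : ℂ → ℝ := fun z => (1 / 2) * (f (x + z) - f (x + conjL z))
    - ((M / d ^ 2) * (z.re ^ 2 + z.im * (2 * d - z.im)) + (N / 2) * (z.im * (d - z.im))) with hg
  have hgs : ContDiff ℝ ∞ g := by fun_prop
  have hgL : ∀ z, Lap g z = (1 / 2) * (Lap f (x + z) - Lap f (x + conjL z)) + N := by
    intro z
    rw [← Lap_translate hf, ← Lap_conj hf]
    rw [hg]
    unfold Lap
    simp (disch := fun_prop) only [dd_sub, dd_add, dd_mul, dd_pow, dd_const, dd_one_re, dd_one_im,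
      dd_I_re, dd_I_im]
    norm_num
    field_simp
    ring
  have key : ∀ z ∈ (Set.Icc (-d) d ×ℂ Set.Icc 0 d), g z ≤ 0 := by
    refine max_principle (U := Set.Ioo (-d) d ×ℂ Set.Ioo 0 d) (isCompact_Icc.reProdIm isCompact_Icc)
      (isOpen_Ioo.reProdIm isOpen_Ioo) ?_ hgs ?_ ?_
    · intro z hz
      exact ⟨Set.Ioo_subset_Icc_self hz.1, Set.Ioo_subset_Icc_self hz.2⟩
    · rintro z ⟨⟨h1, h2⟩, h3, h4⟩ hzU
      have hz := hin z (abs_le.2 ⟨h1, h2⟩) (abs_le.2 ⟨by linarith, h4⟩)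
      have b1 := abs_le.1 (hM _ hz.1)
      have b2 := abs_le.1 (hM _ hz.2)
      have hle : ∀ a : ℝ, d ^ 2 ≤ a → M ≤ M / d ^ 2 * a := by
        intro a ha
        rw [div_mul_eq_mul_div, le_div_iff₀ (by positivity)]
        exact mul_le_mul_of_nonneg_left ha hM0
      have hnn : 0 ≤ N / 2 * (z.im * (d - z.im)) :=
        mul_nonneg (by linarith) (mul_nonneg h3 (by linarith))
      by_cases h5 : z.im = 0
      · have hc : (starRingEnd ℂ) z = z := Complex.conj_eq_iff_im.2 h5
        simp only [hg, conjL_apply, hc, h5]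
        have : 0 ≤ M / d ^ 2 * z.re ^ 2 := by positivity
        simp; linarith
      · have h3' : 0 < z.im := lt_of_le_of_ne h3 (Ne.symm h5)
        have : d ^ 2 ≤ z.re ^ 2 + z.im * (2 * d - z.im) := by
          by_cases h6 : z.im = d
          · rw [h6]; nlinarith [sq_nonneg z.re]
          · have h4' := lt_of_le_of_ne h4 h6
            have : ¬ (z.re ∈ Set.Ioo (-d) d) := fun h => hzU ⟨h, h3', h4'⟩
            have h7 : z.re ^ 2 = d ^ 2 := by
              rcases eq_or_lt_of_le h1 with h | h
              · rw [show z.re = -d from h.symm]; ring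
              · rcases eq_or_lt_of_le h2 with h' | h'
                · rw [show z.re = d from h']
                · exact absurd ⟨h, h'⟩ this
            nlinarith
        have := hle _ this
        simp only [hg]
        linarith
    · rintro z ⟨⟨h1, h2⟩, h3, h4⟩ - - -
      have hz := hin z (abs_le.2 ⟨h1.le, h2.le⟩) (abs_le.2 ⟨by linarith, h4.le⟩)
      have b1 := abs_lt.1 (hN _ hz.1)
      have b2 := abs_lt.1 (hN _ hz.2)
      rw [hgL]; linarith
  have hk : HasDerivAt (fun t : ℝ => (1 / 2) * (f (x + t * Complex.I) - f (x + t * (-Complex.I))))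
      (dd Complex.I f x) 0 := by
    have := ((hasDerivAt_line hf x Complex.I 0).sub (hasDerivAt_line hf x (-Complex.I) 0)).const_mul
      (1 / 2 : ℝ)
    refine this.congr_deriv ?_
    simp [dd_neg_dir]
    ring
  refine deriv_le_of_le_linear hd hk (by simp) ?_
  intro t ht
  have := key (t * Complex.I) ⟨by simp [hd.le], by simp [ht.1.le, ht.2.le]⟩
  simp only [hg, conjL_apply, map_mul, Complex.conj_ofReal, Complex.conj_I] at this
  have h2 : M / d ^ 2 * (t * (2 * d - t)) + N / 2 * (t * (d - t)) ≤ (2 * M / d + N * d / 2) * t := by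
    have e1 : (2 * M / d + N * d / 2) * t - (M / d ^ 2 * (t * (2 * d - t)) + N / 2 * (t * (d - t)))
      = M / d ^ 2 * t ^ 2 + N / 2 * t ^ 2 := by field_simp; ring
    have : 0 ≤ M / d ^ 2 * t ^ 2 + N / 2 * t ^ 2 := by positivity
    linarith
  simp at this h2 ⊢
  linarith

/-- Interior gradient estimate for the Laplacian. -/
theorem abs_dd_le {f : ℂ → ℝ} (hf : ContDiff ℝ ∞ f) {x : ℂ} {d M N : ℝ} (hd : 0 < d)
    (hM : ∀ z ∈ closedBall x (2 * d), |f z| ≤ M)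
    (hN : ∀ z ∈ closedBall x (2 * d), |Lap f z| ≤ N) :
    |dd 1 f x| ≤ 2 * M / d + N * d / 2 ∧ |dd Complex.I f x| ≤ 2 * M / d + N * d / 2 := by
  have main : ∀ h : ℂ → ℝ, ContDiff ℝ ∞ h → (∀ z ∈ closedBall x (2 * d), |h z| ≤ M) →
      (∀ z ∈ closedBall x (2 * d), |Lap h z| ≤ N) → dd Complex.I h x ≤ 2 * M / d + N * d / 2 := by
    intro h hh h1 h2
    refine le_of_forall_pos_le_add fun ε hε => ?_
    have := dd_I_le hh (N := N + 2 * ε / d) hd h1 fun z hz =>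
      (h2 z hz).trans_lt (lt_add_of_pos_right _ (by positivity))
    refine this.trans (le_of_eq ?_)
    field_simp
    ring
  have main2 : ∀ h : ℂ → ℝ, ContDiff ℝ ∞ h → (∀ z ∈ closedBall x (2 * d), |h z| ≤ M) →
      (∀ z ∈ closedBall x (2 * d), |Lap h z| ≤ N) →
      |dd Complex.I h x| ≤ 2 * M / d + N * d / 2 := by
    intro h hh h1 h2
    refine abs_le.2 ⟨?_, main h hh h1 h2⟩
    have := main (fun z => - h z) hh.neg (by simpa using h1) (by
      intro z hz
      have := h2 z hz
      unfold Lap at this ⊢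
      simp only [dd_neg]
      rwa [← neg_add, abs_neg])
    rw [dd_neg] at this
    linarith
  refine ⟨?_, main2 f hf hM hN⟩
  have hin : ∀ z ∈ closedBall x (2 * d), x + swapL (z - x) ∈ closedBall x (2 * d) := by
    intro z hz
    simpa only [mem_closedBall, dist_eq_norm, add_sub_cancel_left, swapL_apply, norm_mul,
      Complex.norm_I, RCLike.norm_conj, one_mul] using hz
  have e0 : ∀ z, x - swapL x + swapL z = x + swapL (z - x) := by
    intro z; rw [map_sub]; ring
  have := main2 (fun z => f (x - swapL x + swapL z)) (contDiff_comp_affine swapL hf)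
    (fun z hz => by simp only [e0]; exact hM _ (hin z hz))
    (fun z hz => by rw [Lap_swap hf, e0]; exact hN _ (hin z hz))
  rw [dd_comp_affine swapL hf] at this
  simpa only [sub_add_cancel, swapL_apply, Complex.conj_I, mul_neg, Complex.I_mul_I, neg_neg] using
    this

end GinzburgLandau

namespace GinzburgLandau
open scoped ContDiff Topology

/-- Squared distance to `x`, as a polynomial in the coordinates. -/
def nsq (x z : ℂ) : ℝ := (z.re - x.re) ^ 2 + (z.im - x.im) ^ 2

theorem nsq_eq (x z : ℂ) : nsq x z = ‖z - x‖ ^ 2 := by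
  rw [nsq, ← Complex.normSq_eq_norm_sq, Complex.normSq_apply]; simp; ring

@[fun_prop] theorem contDiff_nsq {x : ℂ} {n : WithTop ℕ∞} : ContDiff ℝ n (nsq x) := by
  unfold nsq; fun_prop

theorem nsq_nonneg (x z : ℂ) : 0 ≤ nsq x z := by unfold nsq; positivity

@[simp] theorem nsq_self (x : ℂ) : nsq x x = 0 := by simp [nsq]

theorem dd_one_nsq (x : ℂ) : dd 1 (nsq x) = fun z => 2 * (z.re - x.re) := by
  unfold nsq
  simp (disch := fun_prop) only [dd_add, dd_sub, dd_pow, dd_const, dd_one_re, dd_one_im]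
  norm_num

theorem dd_I_nsq (x : ℂ) : dd Complex.I (nsq x) = fun z => 2 * (z.im - x.im) := by
  unfold nsq
  simp (disch := fun_prop) only [dd_add, dd_sub, dd_pow, dd_const, dd_I_re, dd_I_im]
  norm_num

@[simp] theorem dd_one_nsq' (x z : ℂ) : dd 1 (nsq x) z = 2 * (z.re - x.re) := by rw [dd_one_nsq]
@[simp] theorem dd_I_nsq' (x z : ℂ) : dd Complex.I (nsq x) z = 2 * (z.im - x.im) := by
  rw [dd_I_nsq]

@[simp] theorem Lap_nsq (x z : ℂ) : Lap (nsq x) z = 4 := by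
  unfold Lap
  rw [dd_one_nsq, dd_I_nsq]
  simp (disch := fun_prop) only [dd_sub, dd_mul, dd_const, dd_one_re, dd_I_im]
  norm_num

theorem Lap_add {f g : ℂ → ℝ} (hf : ContDiff ℝ ∞ f) (hg : ContDiff ℝ ∞ g) (z : ℂ) :
    Lap (fun z => f z + g z) z = Lap f z + Lap g z := by
  unfold Lap
  simp (disch := fun_prop) only [dd_add]
  ring

theorem Lap_sub {f g : ℂ → ℝ} (hf : ContDiff ℝ ∞ f) (hg : ContDiff ℝ ∞ g) (z : ℂ) :
    Lap (fun z => f z - g z) z = Lap f z - Lap g z := by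
  unfold Lap
  simp (disch := fun_prop) only [dd_sub]
  ring

@[simp] theorem Lap_const (a : ℝ) (z : ℂ) : Lap (fun _ => a) z = 0 := by
  unfold Lap; simp only [dd_const]; norm_num

theorem Lap_mul {f g : ℂ → ℝ} (hf : ContDiff ℝ ∞ f) (hg : ContDiff ℝ ∞ g) (z : ℂ) :
    Lap (fun z => f z * g z) z = Lap f z * g z
      + 2 * (dd 1 f z * dd 1 g z + dd Complex.I f z * dd Complex.I g z) + f z * Lap g z := by
  unfold Lap
  simp (disch := fun_prop) only [dd_mul, dd_add]
  ring

theorem Lap_const_mul {g : ℂ → ℝ} (a : ℝ) (hg : ContDiff ℝ ∞ g) (z : ℂ) :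
    Lap (fun z => a * g z) z = a * Lap g z := by
  rw [Lap_mul contDiff_const hg]; simp [dd_const]

theorem Lap_neg {f : ℂ → ℝ} (z : ℂ) : Lap (fun z => - f z) z = - Lap f z := by
  unfold Lap
  simp only [dd_neg]
  ring

theorem Lap_dd {e : ℂ} {f : ℂ → ℝ} (hf : ContDiff ℝ ∞ f) (z : ℂ) :
    Lap (dd e f) z = dd e (Lap f) z := by
  have : Lap f = fun z => dd 1 (dd 1 f) z + dd Complex.I (dd Complex.I f) z := rfl
  rw [this]
  simp (disch := fun_prop) only [dd_add]
  rw [dd_comm (e := e) (contDiff_dd hf), dd_comm (e := e) (contDiff_dd hf),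
    dd_comm (e := e) hf, dd_comm (e := e) hf]
  rfl

/-- Barrier estimate for subsolutions of `Δ f = k f - H`. -/
theorem le_of_Lap_ge {f : ℂ → ℝ} (hf : ContDiff ℝ ∞ f) {x : ℂ} {d M k H : ℝ} (hd : 0 < d)
    (hk : 0 < k) (hH : 0 ≤ H) (hM : 0 ≤ M) (hfM : ∀ z ∈ closedBall x d, f z ≤ M)
    (hL : ∀ z ∈ closedBall x d, 0 < f z → k * f z - H ≤ Lap f z) :
    f x ≤ H / k + 4 * M / (k * d ^ 2) := by
  set w : ℂ → ℝ := fun z => f z - ((H / k + 4 * M / (k * d ^ 2)) + (M / d ^ 2) * nsq x z) with hw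
  have hws : ContDiff ℝ ∞ w := by fun_prop
  have hc : 0 ≤ H / k + 4 * M / (k * d ^ 2) := by positivity
  have hwL : ∀ z, Lap w z = Lap f z - 4 * (M / d ^ 2) := by
    intro z
    rw [hw, Lap_sub hf (by fun_prop), Lap_add contDiff_const (by fun_prop),
      Lap_const_mul _ contDiff_nsq, Lap_nsq, Lap_const]
    ring
  have := max_principle (U := ball x d) (isCompact_closedBall x d) isOpen_ball
    ball_subset_closedBall hws ?_ ?_ x (mem_closedBall_self hd.le)
  · simp only [hw, nsq_self] at this
    linarith
  · intro z hz hzb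
    have h1 : ‖z - x‖ = d := by
      rw [mem_closedBall, dist_eq_norm] at hz
      rw [mem_ball, dist_eq_norm] at hzb
      linarith
    have h2 : M / d ^ 2 * nsq x z = M := by
      rw [nsq_eq, h1]; field_simp
    simp only [hw, h2]
    linarith [hfM z hz]
  · intro z hz hpos _ _
    have hz' := ball_subset_closedBall hz
    have h1 : 0 ≤ M / d ^ 2 * nsq x z := mul_nonneg (by positivity) (nsq_nonneg _ _)
    have h2 : H / k + 4 * M / (k * d ^ 2) < f z := by simp only [hw] at hpos; linarith
    have h3 := hL z hz' (hc.trans_lt h2)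
    have h4 : k * (H / k + 4 * M / (k * d ^ 2)) < k * f z := mul_lt_mul_of_pos_left h2 hk
    have h5 : k * (H / k + 4 * M / (k * d ^ 2)) = H + 4 * (M / d ^ 2) := by field_simp
    rw [hwL]
    linarith

/-- Keller–Osserman: entire subsolutions of `Δ w = 2 w²` are nonpositive. -/
theorem nonpos_of_Lap_ge_sq {w : ℂ → ℝ} (hw : ContDiff ℝ ∞ w)
    (hL : ∀ z, 0 < w z → 2 * w z ^ 2 ≤ Lap w z) (x : ℂ) : w x ≤ 0 := by
  have key : ∀ R : ℝ, 0 < R → w x * R ^ 2 ≤ 16 := by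
    intro R hR
    set q : ℂ → ℝ := fun z => R ^ 2 - nsq x z with hq
    have hqs : ContDiff ℝ ∞ q := by fun_prop
    have hq1 : ∀ z, dd 1 q z = - (2 * (z.re - x.re)) := by
      intro z
      rw [hq, dd_sub contDiff_const contDiff_nsq, dd_const, dd_one_nsq]; ring
    have hq2 : ∀ z, dd Complex.I q z = - (2 * (z.im - x.im)) := by
      intro z
      rw [hq, dd_sub contDiff_const contDiff_nsq, dd_const, dd_I_nsq]; ring
    have hqL : ∀ z, Lap q z = -4 := by
      intro z
      rw [hq, Lap_sub contDiff_const contDiff_nsq, Lap_const, Lap_nsq]; ring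
    have hq2s : ContDiff ℝ ∞ (fun z => q z ^ 2) := by fun_prop
    set f : ℂ → ℝ := fun z => w z * q z ^ 2 - 16 * R ^ 2 with hf
    have hfs : ContDiff ℝ ∞ f := by fun_prop
    have := max_principle (U := ball x R) (isCompact_closedBall x R) isOpen_ball
      ball_subset_closedBall hfs ?_ ?_ x (mem_closedBall_self hR.le)
    · simp only [hf, hq, nsq_self, sub_zero] at this
      have h2 : R ^ 2 * (w x * R ^ 2) ≤ R ^ 2 * 16 := by linarith
      exact le_of_mul_le_mul_left h2 (by positivity)
    · intro z hz hzb
      have h1 : ‖z - x‖ = R := by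
        rw [mem_closedBall, dist_eq_norm] at hz
        rw [mem_ball, dist_eq_norm] at hzb
        linarith
      have h2 : q z = 0 := by simp only [hq, nsq_eq, h1, sub_self]
      simp only [hf, h2]
      nlinarith
    · intro z hz hpos h1 h2
      have hr : nsq x z < R ^ 2 := by
        rw [mem_ball, dist_eq_norm] at hz
        rw [nsq_eq]
        exact pow_lt_pow_left₀ hz (norm_nonneg _) (by norm_num)
      have hqpos : 0 < q z := by simp only [hq]; linarith
      have hwpos : 0 < w z := by
        simp only [hf] at hpos
        by_contra! h
        nlinarith [sq_nonneg (q z)]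
      have e1 : ∀ e, dd e f z = q z * (dd e w z * q z + 2 * w z * dd e q z) := by
        intro e
        rw [hf]
        simp (disch := fun_prop) only [dd_sub, dd_mul, dd_pow, dd_const]
        norm_num; ring
      rw [e1] at h1 h2
      have h1' := (mul_eq_zero.1 h1).resolve_left hqpos.ne'
      have h2' := (mul_eq_zero.1 h2).resolve_left hqpos.ne'
      have eL : Lap f z = Lap w z * q z ^ 2 + 4 * q z * (dd 1 w z * dd 1 q z
          + dd Complex.I w z * dd Complex.I q z) + w z * (2 * q z * Lap q z
          + 2 * (dd 1 q z ^ 2 + dd Complex.I q z ^ 2)) := by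
        rw [hf, Lap_sub (by fun_prop) contDiff_const, Lap_mul hw hq2s, Lap_sq hqs, Lap_const]
        simp (disch := fun_prop) only [dd_pow]
        norm_num; ring
      have e3 : Lap f z = Lap w z * q z ^ 2 - 24 * w z * nsq x z - 8 * w z * q z := by
        have g1 : q z * dd 1 w z = - 2 * w z * dd 1 q z := by linarith
        have g2 : q z * dd Complex.I w z = - 2 * w z * dd Complex.I q z := by linarith
        have : 4 * q z * (dd 1 w z * dd 1 q z + dd Complex.I w z * dd Complex.I q z)
          = - 8 * w z * (dd 1 q z ^ 2 + dd Complex.I q z ^ 2) := by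
          linear_combination 4 * dd 1 q z * g1 + 4 * dd Complex.I q z * g2
        rw [eL, this, hqL, hq1, hq2]
        simp only [nsq]
        ring
      rw [e3]
      have h3 : 2 * w z ^ 2 * q z ^ 2 ≤ Lap w z * q z ^ 2 :=
        mul_le_mul_of_nonneg_right (hL z hwpos) (by positivity)
      have h4 : 0 < 2 * w z * (w z * q z ^ 2 - 16 * R ^ 2) := mul_pos (by linarith) hpos
      have h5 : q z = R ^ 2 - nsq x z := rfl
      have h6 : 0 ≤ w z * (R ^ 2 - nsq x z) := mul_nonneg hwpos.le (by linarith)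
      have h7 : - 24 * w z * nsq x z - 8 * w z * q z ≥ - 24 * w z * R ^ 2 := by
        rw [h5]; nlinarith
      have h8 : 0 ≤ w z * R ^ 2 := by positivity
      nlinarith
  by_contra! hpos
  have := key (5 / Real.sqrt (w x)) (by positivity)
  rw [div_pow, Real.sq_sqrt hpos.le] at this
  field_simp at this
  norm_num at this

end GinzburgLandau

namespace GinzburgLandau
open scoped ContDiff Topology

/-- Squared length of the gradient of the pair `(α, β)`. -/
def gsq (α β : ℂ → ℝ) (z : ℂ) : ℝ :=
  dd 1 α z ^ 2 + dd Complex.I α z ^ 2 + dd 1 β z ^ 2 + dd Complex.I β z ^ 2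

/-- The potential `m - α² - β²`. -/
def pot (m : ℝ) (α β : ℂ → ℝ) (z : ℂ) : ℝ := m - (α z ^ 2 + β z ^ 2)

/-- Entire solutions `α + iβ` of `-Δv = (m - |v|²) v`. -/
structure GLSol (m : ℝ) (α β : ℂ → ℝ) : Prop where
  sα : ContDiff ℝ ∞ α
  sβ : ContDiff ℝ ∞ β
  one_le : 1 ≤ m
  le_two : m ≤ 2
  eα : ∀ z, Lap α z = - (pot m α β z * α z)
  eβ : ∀ z, Lap β z = - (pot m α β z * β z)

variable {m : ℝ} {α β : ℂ → ℝ}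

@[fun_prop] theorem contDiff_pot (hα : ContDiff ℝ ∞ α) (hβ : ContDiff ℝ ∞ β) :
    ContDiff ℝ ∞ (pot m α β) := by unfold pot; fun_prop

@[fun_prop] theorem contDiff_gsq (hα : ContDiff ℝ ∞ α) (hβ : ContDiff ℝ ∞ β) :
    ContDiff ℝ ∞ (gsq α β) := by unfold gsq; fun_prop

theorem gsq_nonneg (z : ℂ) : 0 ≤ gsq α β z := by unfold gsq; positivity

theorem dd_pot {e : ℂ} (hα : ContDiff ℝ ∞ α) (hβ : ContDiff ℝ ∞ β) :
    dd e (pot m α β) = fun z => - (2 * (α z * dd e α z + β z * dd e β z)) := by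
  unfold pot
  funext z
  simp (disch := fun_prop) only [dd_sub, dd_add, dd_pow, dd_const]
  norm_num; ring

/-- Both coordinate directions. -/
def IsDir (e : ℂ) : Prop := e = 1 ∨ e = Complex.I

theorem abs_mul_le {a b A B : ℝ} (ha : |a| ≤ A) (hb : |b| ≤ B) : |a * b| ≤ A * B := by
  rw [abs_mul]
  exact mul_le_mul ha hb (abs_nonneg _) ((abs_nonneg _).trans ha)

namespace GLSol

theorem Lap_pot (h : GLSol m α β) (z : ℂ) :
    Lap (pot m α β) z = - (2 * gsq α β z) + 2 * pot m α β z * (α z ^ 2 + β z ^ 2) := by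
  have hα := h.sα
  have hβ := h.sβ
  have : pot m α β = fun z => m - (α z ^ 2 + β z ^ 2) := rfl
  rw [this, Lap_sub contDiff_const (by fun_prop), Lap_add (by fun_prop) (by fun_prop), Lap_sq hα,
    Lap_sq hβ, h.eα, h.eβ, Lap_const]
  simp only [gsq, pot]
  ring

theorem pot_nonneg (h : GLSol m α β) (z : ℂ) : 0 ≤ pot m α β z := by
  have hα := h.sα
  have hβ := h.sβ
  have := nonpos_of_Lap_ge_sq (w := fun z => - pot m α β z) (by fun_prop) (fun z hz => by
    rw [Lap_neg, h.Lap_pot]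
    have h1 := gsq_nonneg (α := α) (β := β) z
    have h2 := h.one_le
    have h3 : α z ^ 2 + β z ^ 2 = m - pot m α β z := by unfold pot; ring
    rw [h3]
    nlinarith) z
  linarith

theorem pot_le (h : GLSol m α β) (z : ℂ) : pot m α β z ≤ 2 := by
  have := h.le_two
  unfold pot; nlinarith [sq_nonneg (α z), sq_nonneg (β z)]

theorem sq_add_sq_le (h : GLSol m α β) (z : ℂ) : α z ^ 2 + β z ^ 2 ≤ 2 := by
  have h1 := h.pot_nonneg z
  have := h.le_two
  unfold pot at h1; linarith

theorem abs_le_two (h : GLSol m α β) (z : ℂ) : |α z| ≤ 2 ∧ |β z| ≤ 2 := by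
  have := h.sq_add_sq_le z
  constructor <;> refine abs_le_of_sq_le_sq (by nlinarith [sq_nonneg (α z), sq_nonneg (β z)])
    (by norm_num)

theorem abs_dd_le (h : GLSol m α β) (z : ℂ) : (|dd 1 α z| ≤ 6 ∧ |dd Complex.I α z| ≤ 6) ∧
    (|dd 1 β z| ≤ 6 ∧ |dd Complex.I β z| ≤ 6) := by
  have hp : ∀ z, |pot m α β z| ≤ 2 := fun z => by
    rw [abs_of_nonneg (h.pot_nonneg z)]; exact h.pot_le z
  have h1 : ∀ z, |Lap α z| ≤ 4 := fun z => by
    rw [h.eα, abs_neg, abs_mul]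
    calc _ ≤ (2 : ℝ) * 2 := mul_le_mul (hp z) (h.abs_le_two z).1 (abs_nonneg _) (by norm_num)
      _ = 4 := by norm_num
  have h2 : ∀ z, |Lap β z| ≤ 4 := fun z => by
    rw [h.eβ, abs_neg, abs_mul]
    calc _ ≤ (2 : ℝ) * 2 := mul_le_mul (hp z) (h.abs_le_two z).2 (abs_nonneg _) (by norm_num)
      _ = 4 := by norm_num
  have g1 := GinzburgLandau.abs_dd_le h.sα (x := z) one_pos (M := 2) (N := 4)
    (fun z _ => (h.abs_le_two z).1) (fun z _ => h1 z)
  have g2 := GinzburgLandau.abs_dd_le h.sβ (x := z) one_pos (M := 2) (N := 4)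
    (fun z _ => (h.abs_le_two z).2) (fun z _ => h2 z)
  norm_num at g1 g2
  exact ⟨g1, g2⟩

theorem abs_dd_le' (h : GLSol m α β) {e : ℂ} (he : IsDir e) (z : ℂ) :
    |dd e α z| ≤ 6 ∧ |dd e β z| ≤ 6 := by
  have := h.abs_dd_le z
  rcases he with rfl | rfl
  · exact ⟨this.1.1, this.2.1⟩
  · exact ⟨this.1.2, this.2.2⟩

theorem Lap_dd (h : GLSol m α β) (e z : ℂ) :
    Lap (dd e α) z = - (dd e (pot m α β) z * α z + pot m α β z * dd e α z) ∧
    Lap (dd e β) z = - (dd e (pot m α β) z * β z + pot m α β z * dd e β z) := by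
  have hα := h.sα
  have hβ := h.sβ
  have e1 : Lap α = fun z => - (pot m α β z * α z) := funext h.eα
  have e2 : Lap β = fun z => - (pot m α β z * β z) := funext h.eβ
  constructor
  · rw [GinzburgLandau.Lap_dd hα, e1, dd_neg, dd_mul (by fun_prop) hα]
  · rw [GinzburgLandau.Lap_dd hβ, e2, dd_neg, dd_mul (by fun_prop) hβ]

theorem abs_dd_dd_le (h : GLSol m α β) {e e' : ℂ} (he : IsDir e) (he' : IsDir e') (z : ℂ) :
    |dd e' (dd e α) z| ≤ 66 ∧ |dd e' (dd e β) z| ≤ 66 := by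
  have hα := h.sα
  have hβ := h.sβ
  have hp : ∀ z, |pot m α β z| ≤ 2 := fun z => by
    rw [abs_of_nonneg (h.pot_nonneg z)]; exact h.pot_le z
  have hdp : ∀ z, |dd e (pot m α β) z| ≤ 48 := fun z => by
    rw [dd_pot hα hβ]
    have h1 := abs_mul_le (h.abs_le_two z).1 (h.abs_dd_le' he z).1
    have h2 := abs_mul_le (h.abs_le_two z).2 (h.abs_dd_le' he z).2
    rw [abs_neg, abs_mul, abs_two]
    have := abs_add_le (α z * dd e α z) (β z * dd e β z)
    linarith
  have h1 : ∀ z, |Lap (dd e α) z| ≤ 108 := fun z => by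
    rw [(h.Lap_dd e z).1, abs_neg]
    have h1 := abs_mul_le (hdp z) (h.abs_le_two z).1
    have h2 := abs_mul_le (hp z) (h.abs_dd_le' he z).1
    have := abs_add_le (dd e (pot m α β) z * α z) (pot m α β z * dd e α z)
    linarith
  have h2 : ∀ z, |Lap (dd e β) z| ≤ 108 := fun z => by
    rw [(h.Lap_dd e z).2, abs_neg]
    have h1 := abs_mul_le (hdp z) (h.abs_le_two z).2
    have h2 := abs_mul_le (hp z) (h.abs_dd_le' he z).2
    have := abs_add_le (dd e (pot m α β) z * β z) (pot m α β z * dd e β z)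
    linarith
  have g1 := GinzburgLandau.abs_dd_le (contDiff_dd (e := e) hα) (x := z) one_pos (M := 6) (N := 108)
    (fun z _ => (h.abs_dd_le' he z).1) (fun z _ => h1 z)
  have g2 := GinzburgLandau.abs_dd_le (contDiff_dd (e := e) hβ) (x := z) one_pos (M := 6) (N := 108)
    (fun z _ => (h.abs_dd_le' he z).2) (fun z _ => h2 z)
  norm_num at g1 g2
  rcases he' with rfl | rfl
  · exact ⟨g1.1, g2.1⟩
  · exact ⟨g1.2, g2.2⟩

end GLSol
end GinzburgLandau

namespace GinzburgLandau
open scoped ContDiff Topology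

theorem contDiff_smoothTransition' : ContDiff ℝ ∞ Real.smoothTransition :=
  Real.smoothTransition.contDiff

theorem contDiff_deriv {f : ℝ → ℝ} (hf : ContDiff ℝ ∞ f) : ContDiff ℝ ∞ (deriv f) :=
  ((contDiff_infty_iff_deriv (𝕜 := ℝ)).1 hf).2

theorem deriv_eq_zero_of_eqOn_const {f : ℝ → ℝ} {s : Set ℝ} {a : ℝ} (hs : IsOpen s)
    (h : ∀ x ∈ s, f x = a) : ∀ x ∈ s, deriv f x = 0 := by
  intro x hx
  have : f =ᶠ[𝓝 x] fun _ => a := by filter_upwards [hs.mem_nhds hx] with y hy using h y hy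
  rw [this.deriv_eq]; simp

theorem deriv_smoothTransition_eq_zero {t : ℝ} (ht : t < 0 ∨ 1 < t) :
    deriv Real.smoothTransition t = 0 := by
  rcases ht with ht | ht
  · exact deriv_eq_zero_of_eqOn_const (s := Set.Iio 0) isOpen_Iio
      (fun x hx => Real.smoothTransition.zero_of_nonpos (le_of_lt hx)) t ht
  · exact deriv_eq_zero_of_eqOn_const (s := Set.Ioi 1) isOpen_Ioi
      (fun x hx => Real.smoothTransition.one_of_one_le (le_of_lt hx)) t ht

theorem deriv_deriv_smoothTransition_eq_zero {t : ℝ} (ht : t < 0 ∨ 1 < t) :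
    deriv (deriv Real.smoothTransition) t = 0 := by
  rcases ht with ht | ht
  · exact deriv_eq_zero_of_eqOn_const (s := Set.Iio 0) isOpen_Iio
      (fun x hx => deriv_smoothTransition_eq_zero (Or.inl hx)) t ht
  · exact deriv_eq_zero_of_eqOn_const (s := Set.Ioi 1) isOpen_Ioi
      (fun x hx => deriv_smoothTransition_eq_zero (Or.inr hx)) t ht

theorem exists_smoothTransition_bound : ∃ C : ℝ, 1 ≤ C ∧ ∀ t,
    |deriv Real.smoothTransition t| ≤ C ∧ |deriv (deriv Real.smoothTransition) t| ≤ C := by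
  have h1 := contDiff_deriv contDiff_smoothTransition'
  have h2 := contDiff_deriv h1
  obtain ⟨C1, hC1⟩ := isCompact_Icc.exists_bound_of_continuousOn (s := Set.Icc (0 : ℝ) 1)
    h1.continuous.continuousOn
  obtain ⟨C2, hC2⟩ := isCompact_Icc.exists_bound_of_continuousOn (s := Set.Icc (0 : ℝ) 1)
    h2.continuous.continuousOn
  refine ⟨max 1 (max C1 C2), le_max_left _ _, fun t => ?_⟩
  by_cases ht : t ∈ Set.Icc (0 : ℝ) 1
  · exact ⟨(hC1 t ht).trans ((le_max_left _ _).trans (le_max_right _ _)),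
      (hC2 t ht).trans ((le_max_right _ _).trans (le_max_right _ _))⟩
  · have : t < 0 ∨ 1 < t := by
      by_contra! h
      exact ht h
    rw [deriv_smoothTransition_eq_zero this, deriv_deriv_smoothTransition_eq_zero this]
    simp

/-- A bound for the first two derivatives of `Real.smoothTransition`. -/
def cutC : ℝ := exists_smoothTransition_bound.choose

theorem one_le_cutC : 1 ≤ cutC := exists_smoothTransition_bound.choose_spec.1

theorem abs_deriv_smoothTransition_le (t : ℝ) : |deriv Real.smoothTransition t| ≤ cutC :=
  (exists_smoothTransition_bound.choose_spec.2 t).1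

theorem abs_deriv_deriv_smoothTransition_le (t : ℝ) :
    |deriv (deriv Real.smoothTransition) t| ≤ cutC :=
  (exists_smoothTransition_bound.choose_spec.2 t).2

theorem integral_mul_dd {χ g : ℂ → ℝ} {e : ℂ} (hχ : ContDiff ℝ ∞ χ) (hc : HasCompactSupport χ)
    (hg : ContDiff ℝ ∞ g) : ∫ z, χ z * dd e g z = - ∫ z, dd e χ z * g z := by
  have hd : HasCompactSupport (dd e χ) := hc.fderiv_apply ℝ e
  refine integral_mul_fderiv_eq_neg_fderiv_mul_of_integrable ?_ ?_ ?_
    (fun x _ => differentiable_of_smooth hχ x) (fun x _ => differentiable_of_smooth hg x)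
  · exact ((continuous_dd hχ).mul hg.continuous).integrable_of_hasCompactSupport hd.mul_right
  · exact (hχ.continuous.mul (continuous_dd hg)).integrable_of_hasCompactSupport hc.mul_right
  · exact (hχ.continuous.mul hg.continuous).integrable_of_hasCompactSupport hc.mul_right

theorem integral_mul_div {χ F G : ℂ → ℝ} (hχ : ContDiff ℝ ∞ χ) (hc : HasCompactSupport χ)
    (hF : ContDiff ℝ ∞ F) (hG : ContDiff ℝ ∞ G) :
    ∫ z, χ z * (dd 1 F z + dd Complex.I G z)
      = - ∫ z, (dd 1 χ z * F z + dd Complex.I χ z * G z) := by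
  have hd : ∀ e, HasCompactSupport (dd e χ) := fun e => hc.fderiv_apply ℝ e
  simp only [mul_add]
  rw [integral_add, integral_add, integral_mul_dd hχ hc hF, integral_mul_dd hχ hc hG]
  · ring
  · exact ((continuous_dd hχ).mul hF.continuous).integrable_of_hasCompactSupport (hd _).mul_right
  · exact ((continuous_dd hχ).mul hG.continuous).integrable_of_hasCompactSupport (hd _).mul_right
  · exact (hχ.continuous.mul (continuous_dd hF)).integrable_of_hasCompactSupport hc.mul_right
  · exact (hχ.continuous.mul (continuous_dd hG)).integrable_of_hasCompactSupport hc.mul_right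

/-- Radial cutoff: `1` on the ball of radius `R`, `0` outside the ball of radius `2R`. -/
def cut (x : ℂ) (R : ℝ) (z : ℂ) : ℝ := Real.smoothTransition (2 - (1 / R ^ 2) * nsq x z)

section cut
variable {x : ℂ} {R : ℝ}

@[fun_prop] theorem contDiff_cut : ContDiff ℝ ∞ (cut x R) := by
  unfold cut
  exact contDiff_smoothTransition'.comp (by fun_prop)

theorem cut_nonneg (z : ℂ) : 0 ≤ cut x R z := Real.smoothTransition.nonneg _
theorem cut_le_one (z : ℂ) : cut x R z ≤ 1 := Real.smoothTransition.le_one _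

theorem cut_eq_one (hR : 0 < R) {z : ℂ} (hz : z ∈ closedBall x R) : cut x R z = 1 := by
  apply Real.smoothTransition.one_of_one_le
  rw [mem_closedBall, dist_eq_norm] at hz
  have h1 : nsq x z ≤ R ^ 2 := by
    rw [nsq_eq]; exact pow_le_pow_left₀ (norm_nonneg _) hz 2
  have h2 : 1 / R ^ 2 * nsq x z ≤ 1 := by
    rw [one_div, inv_mul_le_iff₀ (by positivity)]; linarith
  linarith

theorem cut_arg_neg (hR : 0 < R) {z : ℂ} (hz : z ∉ closedBall x (2 * R)) :
    2 - (1 / R ^ 2) * nsq x z < 0 := by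
  rw [mem_closedBall, dist_eq_norm, not_le] at hz
  have h1 : (2 * R) ^ 2 < nsq x z := by
    rw [nsq_eq]; exact pow_lt_pow_left₀ hz (by linarith) (by norm_num)
  have h2 : 4 < 1 / R ^ 2 * nsq x z := by
    rw [one_div, lt_inv_mul_iff₀ (by positivity)]; linarith
  linarith

theorem cut_eq_zero (hR : 0 < R) {z : ℂ} (hz : z ∉ closedBall x (2 * R)) : cut x R z = 0 :=
  Real.smoothTransition.zero_of_nonpos (cut_arg_neg hR hz).le

theorem hasCompactSupport_cut (hR : 0 < R) : HasCompactSupport (cut x R) :=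
  HasCompactSupport.intro (isCompact_closedBall x (2 * R)) fun _ hz => cut_eq_zero hR hz

theorem dd_cut (e z : ℂ) : dd e (cut x R) z
    = deriv Real.smoothTransition (2 - (1 / R ^ 2) * nsq x z) * (-((1 / R ^ 2) * dd e (nsq x) z)) := by
  unfold cut
  rw [dd_comp contDiff_smoothTransition' (by fun_prop)]
  simp (disch := fun_prop) only [dd_sub, dd_mul, dd_const]
  ring

theorem cut_arg_gt_one (hR : 0 < R) {z : ℂ} (hz : z ∈ ball x R) :
    1 < 2 - (1 / R ^ 2) * nsq x z := by
  rw [mem_ball, dist_eq_norm] at hz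
  have h1 : nsq x z < R ^ 2 := by
    rw [nsq_eq]; exact pow_lt_pow_left₀ hz (norm_nonneg _) (by norm_num)
  have h2 : 1 / R ^ 2 * nsq x z < 1 := by
    rw [one_div, inv_mul_lt_iff₀ (by positivity)]; linarith
  linarith

theorem deriv_cut_arg_eq_zero (hR : 0 < R) {z : ℂ} (hz : z ∉ closedBall x (2 * R) \ ball x R) :
    deriv Real.smoothTransition (2 - (1 / R ^ 2) * nsq x z) = 0 ∧
    deriv (deriv Real.smoothTransition) (2 - (1 / R ^ 2) * nsq x z) = 0 := by
  by_cases h : z ∈ ball x R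
  · exact ⟨deriv_smoothTransition_eq_zero (Or.inr (cut_arg_gt_one hR h)),
      deriv_deriv_smoothTransition_eq_zero (Or.inr (cut_arg_gt_one hR h))⟩
  · have : z ∉ closedBall x (2 * R) := fun h' => hz ⟨h', h⟩
    exact ⟨deriv_smoothTransition_eq_zero (Or.inl (cut_arg_neg hR this)),
      deriv_deriv_smoothTransition_eq_zero (Or.inl (cut_arg_neg hR this))⟩

theorem Lap_cut (z : ℂ) : Lap (cut x R) z
    = deriv (deriv Real.smoothTransition) (2 - (1 / R ^ 2) * nsq x z) * (4 / R ^ 4 * nsq x z)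
      - deriv Real.smoothTransition (2 - (1 / R ^ 2) * nsq x z) * (4 / R ^ 2) := by
  have h1 : ∀ e, dd e (cut x R) = fun z => deriv Real.smoothTransition (2 - (1 / R ^ 2) * nsq x z)
      * (-((1 / R ^ 2) * dd e (nsq x) z)) := fun e => funext (dd_cut e)
  have h2 : ContDiff ℝ ∞ (fun z => deriv Real.smoothTransition (2 - (1 / R ^ 2) * nsq x z)) :=
    (contDiff_deriv contDiff_smoothTransition').comp (by fun_prop)
  have h3 : ∀ e, dd e (fun z => deriv Real.smoothTransition (2 - (1 / R ^ 2) * nsq x z))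
      = fun z => deriv (deriv Real.smoothTransition) (2 - (1 / R ^ 2) * nsq x z) *
        (-((1 / R ^ 2) * dd e (nsq x) z)) := by
    intro e
    rw [dd_comp (contDiff_deriv contDiff_smoothTransition') (by fun_prop)]
    funext z
    simp (disch := fun_prop) only [dd_sub, dd_mul, dd_const]
    ring
  unfold Lap
  rw [h1, h1]
  simp (disch := fun_prop) only [dd_mul h2, dd_neg, h3, dd_mul, dd_const]
  have h4 := Lap_nsq x z
  unfold Lap at h4
  have h5 : dd Complex.I (dd Complex.I (nsq x)) z = 4 - dd 1 (dd 1 (nsq x)) z := by linarith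
  rw [h5, dd_one_nsq' , dd_I_nsq']
  simp only [nsq]
  ring

end cut

end GinzburgLandau

namespace GinzburgLandau
open scoped ContDiff Topology

variable {m : ℝ} {α β : ℂ → ℝ}

/-- Energy density of the pair, up to normalisation. -/
def ed (m : ℝ) (α β : ℂ → ℝ) (z : ℂ) : ℝ := gsq α β z + pot m α β z ^ 2

@[fun_prop] theorem contDiff_ed (hα : ContDiff ℝ ∞ α) (hβ : ContDiff ℝ ∞ β) :
    ContDiff ℝ ∞ (ed m α β) := by unfold ed; fun_prop

theorem ed_nonneg (z : ℂ) : 0 ≤ ed m α β z := add_nonneg (gsq_nonneg z) (sq_nonneg _)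

theorem gsq_le_ed (z : ℂ) : gsq α β z ≤ ed m α β z := by
  unfold ed; nlinarith [sq_nonneg (pot m α β z)]

theorem pot_sq_le_ed (z : ℂ) : pot m α β z ^ 2 ≤ ed m α β z := by
  unfold ed; linarith [gsq_nonneg (α := α) (β := β) z]

/-- Stress tensor. -/
def T11 (m : ℝ) (α β : ℂ → ℝ) (z : ℂ) : ℝ :=
  (1 / 2) * (dd Complex.I α z ^ 2 + dd Complex.I β z ^ 2 - (dd 1 α z ^ 2 + dd 1 β z ^ 2))
    + (1 / 4) * pot m α β z ^ 2

/-- Stress tensor. -/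
def T12 (α β : ℂ → ℝ) (z : ℂ) : ℝ := - (dd 1 α z * dd Complex.I α z + dd 1 β z * dd Complex.I β z)

/-- Stress tensor. -/
def T22 (m : ℝ) (α β : ℂ → ℝ) (z : ℂ) : ℝ :=
  (1 / 2) * (dd 1 α z ^ 2 + dd 1 β z ^ 2 - (dd Complex.I α z ^ 2 + dd Complex.I β z ^ 2))
    + (1 / 4) * pot m α β z ^ 2

@[fun_prop] theorem contDiff_T11 (hα : ContDiff ℝ ∞ α) (hβ : ContDiff ℝ ∞ β) :
    ContDiff ℝ ∞ (T11 m α β) := by unfold T11; fun_prop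
@[fun_prop] theorem contDiff_T12 (hα : ContDiff ℝ ∞ α) (hβ : ContDiff ℝ ∞ β) :
    ContDiff ℝ ∞ (T12 α β) := by unfold T12; fun_prop
@[fun_prop] theorem contDiff_T22 (hα : ContDiff ℝ ∞ α) (hβ : ContDiff ℝ ∞ β) :
    ContDiff ℝ ∞ (T22 m α β) := by unfold T22; fun_prop

theorem div_T_one (hα : ContDiff ℝ ∞ α) (hβ : ContDiff ℝ ∞ β) (z : ℂ) :
    dd 1 (T11 m α β) z + dd Complex.I (T12 α β) z
      = - (Lap α z + pot m α β z * α z) * dd 1 α z - (Lap β z + pot m α β z * β z) * dd 1 β z := by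
  have e1 : dd 1 (dd Complex.I α) = dd Complex.I (dd 1 α) := dd_comm hα
  have e2 : dd 1 (dd Complex.I β) = dd Complex.I (dd 1 β) := dd_comm hβ
  unfold T11 T12 Lap
  simp (disch := fun_prop) only [dd_sub, dd_add, dd_pow, dd_const, dd_mul, dd_neg, dd_pot, e1, e2]
  norm_num
  ring

theorem div_T_two (hα : ContDiff ℝ ∞ α) (hβ : ContDiff ℝ ∞ β) (z : ℂ) :
    dd 1 (T12 α β) z + dd Complex.I (T22 m α β) z
      = - (Lap α z + pot m α β z * α z) * dd Complex.I α z
        - (Lap β z + pot m α β z * β z) * dd Complex.I β z := by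
  have e1 : dd 1 (dd Complex.I α) = dd Complex.I (dd 1 α) := dd_comm hα
  have e2 : dd 1 (dd Complex.I β) = dd Complex.I (dd 1 β) := dd_comm hβ
  unfold T22 T12 Lap
  simp (disch := fun_prop) only [dd_sub, dd_add, dd_pow, dd_const, dd_mul, dd_neg, dd_pot, e1, e2]
  norm_num
  ring

theorem abs_T_le (z : ℂ) : |T11 m α β z| ≤ ed m α β z ∧ |T12 α β z| ≤ ed m α β z ∧
    |T22 m α β z| ≤ ed m α β z := by
  unfold T11 T12 T22 ed gsq
  have h := sq_nonneg (pot m α β z)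
  refine ⟨abs_le.2 ⟨?_, ?_⟩, abs_le.2 ⟨?_, ?_⟩, abs_le.2 ⟨?_, ?_⟩⟩ <;>
  nlinarith [sq_nonneg (dd 1 α z), sq_nonneg (dd 1 β z), sq_nonneg (dd Complex.I α z),
    sq_nonneg (dd Complex.I β z), sq_nonneg (dd 1 α z + dd Complex.I α z),
    sq_nonneg (dd 1 α z - dd Complex.I α z), sq_nonneg (dd 1 β z + dd Complex.I β z),
    sq_nonneg (dd 1 β z - dd Complex.I β z)]

theorem T11_add_T22 (z : ℂ) : T11 m α β z + T22 m α β z = (1 / 2) * pot m α β z ^ 2 := by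
  unfold T11 T22; ring

theorem integrableOn_closedBall {f : ℂ → ℝ} (hf : Continuous f) (x : ℂ) (R : ℝ) :
    IntegrableOn f (closedBall x R) :=
  hf.continuousOn.integrableOn_compact (isCompact_closedBall x R)

theorem measurableSet_annulus (x : ℂ) (r R : ℝ) : MeasurableSet (closedBall x R \ ball x r) :=
  measurableSet_closedBall.diff measurableSet_ball

theorem integrableOn_annulus {f : ℂ → ℝ} (hf : Continuous f) (x : ℂ) (r R : ℝ) :
    IntegrableOn f (closedBall x R \ ball x r) :=
  (integrableOn_closedBall hf x R).mono_set Set.sdiff_subset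

theorem le_integral_cut {f : ℂ → ℝ} (hf : Continuous f) (h0 : ∀ z, 0 ≤ f z) {x : ℂ} {R : ℝ}
    (hR : 0 < R) : ∫ z in closedBall x R, f z ≤ ∫ z, cut x R z * f z := by
  have hi : Integrable (fun z => cut x R z * f z) :=
    (contDiff_cut.continuous.mul hf).integrable_of_hasCompactSupport
      (hasCompactSupport_cut hR).mul_right
  calc ∫ z in closedBall x R, f z = ∫ z in closedBall x R, cut x R z * f z :=
        setIntegral_congr_fun measurableSet_closedBall fun z hz => by
          simp only [cut_eq_one hR hz, one_mul]
    _ ≤ _ := setIntegral_le_integral hi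
        (Eventually.of_forall fun z => mul_nonneg (cut_nonneg z) (h0 z))

theorem integral_le_setIntegral {f g : ℂ → ℝ} {s : Set ℂ} (hs : MeasurableSet s)
    (hf : Integrable f) (hg : IntegrableOn g s) (h1 : ∀ z ∈ s, f z ≤ g z)
    (h2 : ∀ z, z ∉ s → f z ≤ 0) : ∫ z, f z ≤ ∫ z in s, g z := by
  rw [← integral_indicator hs]
  refine integral_mono hf (hg.integrable_indicator hs) fun z => ?_
  by_cases h : z ∈ s
  · simpa [h] using h1 z h
  · simpa [h] using h2 z h

namespace GLSol

/-- Local Pohozaev inequality. -/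
theorem pohozaev (h : GLSol m α β) (x : ℂ) {R : ℝ} (hR : 0 < R) :
    ∫ z in closedBall x R, pot m α β z ^ 2
      ≤ 32 * cutC * ∫ z in closedBall x (2 * R) \ ball x R, ed m α β z := by
  have hα := h.sα
  have hβ := h.sβ
  set F : ℂ → ℝ := fun z => (z.re - x.re) * T11 m α β z + (z.im - x.im) * T12 α β z with hF
  set G : ℂ → ℝ := fun z => (z.re - x.re) * T12 α β z + (z.im - x.im) * T22 m α β z with hG
  have hFs : ContDiff ℝ ∞ F := by fun_prop
  have hGs : ContDiff ℝ ∞ G := by fun_prop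
  have hdiv : ∀ z, dd 1 F z + dd Complex.I G z = (1 / 2) * pot m α β z ^ 2 := by
    intro z
    have d1 := div_T_one (m := m) hα hβ z
    have d2 := div_T_two (m := m) hα hβ z
    rw [h.eα, h.eβ] at d1 d2
    rw [hF, hG, ← T11_add_T22]
    simp (disch := fun_prop) only [dd_add, dd_sub, dd_mul, dd_const, dd_one_re, dd_I_im, dd_one_im,
      dd_I_re]
    linear_combination (z.re - x.re) * d1 + (z.im - x.im) * d2
  have hint := integral_mul_div (contDiff_cut (x := x) (R := R)) (hasCompactSupport_cut hR) hFs hGs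
  have hcs : ∀ e, HasCompactSupport (dd e (cut x R)) :=
    fun e => (hasCompactSupport_cut hR).fderiv_apply ℝ e
  have hpt : ∀ z ∈ closedBall x (2 * R) \ ball x R,
      -(dd 1 (cut x R) z * F z + dd Complex.I (cut x R) z * G z) ≤ 16 * cutC * ed m α β z := by
    rintro z ⟨hz, -⟩
    rw [dd_cut, dd_cut, dd_one_nsq', dd_I_nsq']
    set s := deriv Real.smoothTransition (2 - (1 / R ^ 2) * nsq x z)
    have hs : |s| ≤ cutC := abs_deriv_smoothTransition_le _
    have hn : nsq x z ≤ 4 * R ^ 2 := by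
      rw [mem_closedBall, dist_eq_norm] at hz
      rw [nsq_eq]
      calc _ ≤ (2 * R) ^ 2 := pow_le_pow_left₀ (norm_nonneg _) hz 2
        _ = _ := by ring
    set p := z.re - x.re
    set q := z.im - x.im
    have hn' : nsq x z = p ^ 2 + q ^ 2 := rfl
    obtain ⟨t1, t2, t3⟩ := abs_T_le (m := m) (α := α) (β := β) z
    have he := ed_nonneg (m := m) (α := α) (β := β) z
    have hQ : |p ^ 2 * T11 m α β z + 2 * (p * q) * T12 α β z + q ^ 2 * T22 m α β z|
        ≤ 2 * nsq x z * ed m α β z := by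
      have a1 : |p ^ 2 * T11 m α β z| ≤ p ^ 2 * ed m α β z := by
        rw [abs_mul, abs_of_nonneg (sq_nonneg p)]
        exact mul_le_mul_of_nonneg_left t1 (sq_nonneg p)
      have a3 : |q ^ 2 * T22 m α β z| ≤ q ^ 2 * ed m α β z := by
        rw [abs_mul, abs_of_nonneg (sq_nonneg q)]
        exact mul_le_mul_of_nonneg_left t3 (sq_nonneg q)
      have a2 : |2 * (p * q) * T12 α β z| ≤ (p ^ 2 + q ^ 2) * ed m α β z := by
        refine abs_mul_le ?_ t2
        exact abs_le.2 ⟨by nlinarith [sq_nonneg (p + q)], by nlinarith [sq_nonneg (p - q)]⟩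
      have := abs_add_three (p ^ 2 * T11 m α β z) (2 * (p * q) * T12 α β z) (q ^ 2 * T22 m α β z)
      rw [hn']
      linarith
    have e1 : -(s * -(1 / R ^ 2 * (2 * p)) * F z + s * -(1 / R ^ 2 * (2 * q)) * G z)
        = (2 / R ^ 2) * (s * (p ^ 2 * T11 m α β z + 2 * (p * q) * T12 α β z
          + q ^ 2 * T22 m α β z)) := by
      simp only [hF, hG]; ring
    rw [e1]
    have h3 := (le_abs_self _).trans (abs_mul_le hs hQ)
    have hc := one_le_cutC
    calc _ ≤ (2 / R ^ 2) * (cutC * (2 * (4 * R ^ 2) * ed m α β z)) := by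
          refine mul_le_mul_of_nonneg_left (h3.trans ?_) (by positivity)
          gcongr
      _ = 16 * cutC * ed m α β z := by field_simp; ring
  have hzero : ∀ z, z ∉ closedBall x (2 * R) \ ball x R →
      -(dd 1 (cut x R) z * F z + dd Complex.I (cut x R) z * G z) ≤ 0 := by
    intro z hz
    rw [dd_cut, dd_cut, (deriv_cut_arg_eq_zero hR hz).1]
    simp
  have hI : Integrable (fun z => -(dd 1 (cut x R) z * F z + dd Complex.I (cut x R) z * G z)) := by
    refine (Integrable.add ?_ ?_).neg
    · exact ((continuous_dd contDiff_cut).mul hFs.continuous).integrable_of_hasCompactSupport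
        (hcs _).mul_right
    · exact ((continuous_dd contDiff_cut).mul hGs.continuous).integrable_of_hasCompactSupport
        (hcs _).mul_right
  have hed : Continuous (ed m α β) := (contDiff_ed hα hβ).continuous
  have h4 := integral_le_setIntegral (measurableSet_annulus x R (2 * R)) hI
    ((integrableOn_annulus hed x R (2 * R)).const_mul (16 * cutC)) hpt hzero
  rw [integral_neg, ← hint, integral_const_mul] at h4
  simp only [hdiv] at h4
  have h5 := le_integral_cut (f := fun z => (1 / 2) * pot m α β z ^ 2) (x := x)
    (by have := (contDiff_pot (m := m) hα hβ).continuous; fun_prop)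
    (fun z => by positivity) hR
  rw [integral_const_mul] at h5
  linarith

end GLSol
end GinzburgLandau

namespace GinzburgLandau
open scoped ContDiff Topology

variable {m : ℝ} {α β : ℂ → ℝ}

theorem fderiv_apply_eq {f : ℂ → ℝ} (z w : ℂ) :
    fderiv ℝ f z w = w.re * dd 1 f z + w.im * dd Complex.I f z := by
  have hw : w = w.re • (1 : ℂ) + w.im • Complex.I := by
    apply Complex.ext <;> simp
  conv_lhs => rw [hw, map_add, map_smul, map_smul]
  rfl

theorem norm_fderiv_le_of_dd_le {f : ℂ → ℝ} {z : ℂ} {B : ℝ} (h1 : |dd 1 f z| ≤ B)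
    (h2 : |dd Complex.I f z| ≤ B) : ‖fderiv ℝ f z‖ ≤ 2 * B := by
  have hB : 0 ≤ B := (abs_nonneg _).trans h1
  refine ContinuousLinearMap.opNorm_le_bound _ (by positivity) fun w => ?_
  rw [fderiv_apply_eq, Real.norm_eq_abs]
  have a1 := abs_mul_le (Complex.abs_re_le_norm w) h1
  have a2 := abs_mul_le (Complex.abs_im_le_norm w) h2
  have := abs_add_le (w.re * dd 1 f z) (w.im * dd Complex.I f z)
  linarith

theorem abs_sub_le_of_dd_le {f : ℂ → ℝ} (hf : ContDiff ℝ ∞ f) {x : ℂ} {r B : ℝ}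
    (h1 : ∀ z ∈ closedBall x r, |dd 1 f z| ≤ B) (h2 : ∀ z ∈ closedBall x r, |dd Complex.I f z| ≤ B)
    {z w : ℂ} (hz : z ∈ closedBall x r) (hw : w ∈ closedBall x r) :
    |f z - f w| ≤ 2 * B * ‖z - w‖ := by
  have := (convex_closedBall x r).norm_image_sub_le_of_norm_fderiv_le (𝕜 := ℝ) (f := f) (C := 2 * B)
    (fun y _ => differentiable_of_smooth hf y)
    (fun y hy => norm_fderiv_le_of_dd_le (h1 y hy) (h2 y hy)) hw hz
  simpa using this

theorem volume_real_closedBall (x : ℂ) {r : ℝ} (hr : 0 ≤ r) :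
    volume.real (closedBall x r) = Real.pi * r ^ 2 := by
  rw [measureReal_def, Complex.volume_closedBall]
  simp [ENNReal.toReal_ofReal hr, mul_comm]

theorem mul_volume_le_setIntegral {f : ℂ → ℝ} (hf : Continuous f) {x : ℂ} {r c : ℝ} (hr : 0 ≤ r)
    (h : ∀ z ∈ closedBall x r, c ≤ f z) : c * (Real.pi * r ^ 2) ≤ ∫ z in closedBall x r, f z := by
  calc c * (Real.pi * r ^ 2) = ∫ _ in closedBall x r, c := by
        rw [setIntegral_const, volume_real_closedBall x hr, smul_eq_mul, mul_comm]
    _ ≤ _ := setIntegral_mono_on (integrableOn_const (measure_closedBall_lt_top.ne))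
        (integrableOn_closedBall hf x r) measurableSet_closedBall h

theorem setIntegral_mono_ball {f : ℂ → ℝ} (hf : Continuous f) (h0 : ∀ z, 0 ≤ f z) {x : ℂ} {R : ℝ}
    {s : Set ℂ} (hs : s ⊆ closedBall x R) :
    ∫ z in s, f z ≤ ∫ z in closedBall x R, f z :=
  setIntegral_mono_set (integrableOn_closedBall hf x R) (Eventually.of_forall h0)
    (LE.le.eventuallyLE hs)

theorem integral_mul_Lap {χ g : ℂ → ℝ} (hχ : ContDiff ℝ ∞ χ) (hc : HasCompactSupport χ)
    (hg : ContDiff ℝ ∞ g) : ∫ z, χ z * Lap g z = ∫ z, Lap χ z * g z := by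
  have hd : ∀ e, HasCompactSupport (dd e χ) := fun e => hc.fderiv_apply ℝ e
  have hdd : ∀ e, HasCompactSupport (dd e (dd e χ)) := fun e => (hd e).fderiv_apply ℝ e
  have h1 : ∀ e, ∫ z, χ z * dd e (dd e g) z = ∫ z, dd e (dd e χ) z * g z := by
    intro e
    rw [integral_mul_dd hχ hc (contDiff_dd hg), integral_mul_dd (contDiff_dd hχ) (hd e) hg, neg_neg]
  unfold Lap
  simp only [mul_add, add_mul]
  rw [integral_add, integral_add, h1, h1]
  · exact (Continuous.mul (by fun_prop) hg.continuous).integrable_of_hasCompactSupport (hdd _).mul_right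
  · exact (Continuous.mul (by fun_prop) hg.continuous).integrable_of_hasCompactSupport (hdd _).mul_right
  · exact (hχ.continuous.mul (by fun_prop)).integrable_of_hasCompactSupport hc.mul_right
  · exact (hχ.continuous.mul (by fun_prop)).integrable_of_hasCompactSupport hc.mul_right

theorem abs_Lap_cut_le {x : ℂ} {R : ℝ} (hR : 0 < R) (z : ℂ) :
    |Lap (cut x R) z| ≤ 20 * cutC / R ^ 2 := by
  have hc := one_le_cutC
  rw [Lap_cut]
  by_cases hz : z ∈ closedBall x (2 * R) \ ball x R
  · have hn : nsq x z ≤ 4 * R ^ 2 := by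
      have := hz.1
      rw [mem_closedBall, dist_eq_norm] at this
      rw [nsq_eq]
      calc _ ≤ (2 * R) ^ 2 := pow_le_pow_left₀ (norm_nonneg _) this 2
        _ = _ := by ring
    set t := 2 - (1 / R ^ 2) * nsq x z
    have h1 : |4 / R ^ 4 * nsq x z| ≤ 16 / R ^ 2 := by
      rw [abs_of_nonneg (mul_nonneg (by positivity) (nsq_nonneg _ _))]
      calc _ ≤ 4 / R ^ 4 * (4 * R ^ 2) := by gcongr
        _ = _ := by field_simp; norm_num
    have h2 : |4 / R ^ 2| ≤ 4 / R ^ 2 := (abs_of_nonneg (by positivity)).le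
    have a1 := abs_mul_le (abs_deriv_deriv_smoothTransition_le t) h1
    have a2 := abs_mul_le (abs_deriv_smoothTransition_le t) h2
    have := abs_sub (deriv (deriv Real.smoothTransition) t * (4 / R ^ 4 * nsq x z))
      (deriv Real.smoothTransition t * (4 / R ^ 2))
    calc _ ≤ cutC * (16 / R ^ 2) + cutC * (4 / R ^ 2) := by linarith
      _ = _ := by ring
  · rw [(deriv_cut_arg_eq_zero hR hz).1, (deriv_cut_arg_eq_zero hR hz).2]
    simp; positivity

namespace GLSol

theorem abs_dd_pot_le (h : GLSol m α β) {e : ℂ} (he : IsDir e) (z : ℂ) :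
    |dd e (pot m α β) z| ≤ 48 := by
  rw [dd_pot h.sα h.sβ]
  have h1 := abs_mul_le (h.abs_le_two z).1 (h.abs_dd_le' he z).1
  have h2 := abs_mul_le (h.abs_le_two z).2 (h.abs_dd_le' he z).2
  rw [abs_neg, abs_mul, abs_two]
  have := abs_add_le (α z * dd e α z) (β z * dd e β z)
  linarith

/-- A zero-ish point carries a definite amount of potential energy. -/
theorem le_integral_pot_sq (h : GLSol m α β) {x : ℂ} (hx : α x ^ 2 + β x ^ 2 ≤ 1 / 4) :
    (1 / 4) * (Real.pi * (1 / 400) ^ 2) ≤ ∫ z in closedBall x 1, pot m α β z ^ 2 := by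
  have hα := h.sα
  have hβ := h.sβ
  have hcont := (contDiff_pot (m := m) hα hβ).continuous
  have h1 : (1 / 4) * (Real.pi * (1 / 400) ^ 2)
      ≤ ∫ z in closedBall x (1 / 400), pot m α β z ^ 2 := by
    refine mul_volume_le_setIntegral (by fun_prop) (by norm_num) fun z hz => ?_
    have := abs_le.1 (abs_sub_le_of_dd_le (contDiff_pot (m := m) hα hβ) (x := x) (r := 1 / 400)
      (fun z _ => h.abs_dd_pot_le (Or.inl rfl) z) (fun z _ => h.abs_dd_pot_le (Or.inr rfl) z) hz
      (mem_closedBall_self (by norm_num)))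
    have h2 : 3 / 4 ≤ pot m α β x := by unfold pot; linarith [h.one_le]
    rw [mem_closedBall, dist_eq_norm] at hz
    have : 1 / 2 ≤ pot m α β z := by linarith [this.1]
    nlinarith
  exact h1.trans (setIntegral_mono_ball (by fun_prop) (fun z => sq_nonneg _)
    (closedBall_subset_closedBall (by norm_num)))

theorem integral_gsq_le (h : GLSol m α β) {x : ℂ} {ε : ℝ} (hε : 0 < ε)
    (hV : ∫ z in closedBall x 1, pot m α β z ^ 2 ≤ ε ^ 2) :
    ∫ z in closedBall x (1 / 2), gsq α β z ≤ 200 * cutC * ε := by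
  have hα := h.sα
  have hβ := h.sβ
  have hc := one_le_cutC
  have hcont := (contDiff_pot (m := m) hα hβ).continuous
  have hgcont := (contDiff_gsq hα hβ).continuous
  have h1 := le_integral_cut (f := gsq α β) (x := x) hgcont (fun z => gsq_nonneg z)
    (one_half_pos (α := ℝ))
  have hcs := hasCompactSupport_cut (x := x) (one_half_pos (α := ℝ))
  have e1 : ∀ z, cut x (1 / 2) z * gsq α β z = cut x (1 / 2) z * (pot m α β z * (α z ^ 2 + β z ^ 2))
      - (1 / 2) * (cut x (1 / 2) z * Lap (pot m α β) z) := by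
    intro z; rw [h.Lap_pot]; ring
  have h2 : ∫ z, cut x (1 / 2) z * gsq α β z
      = ∫ z, (cut x (1 / 2) z * (α z ^ 2 + β z ^ 2) - (1 / 2) * Lap (cut x (1 / 2)) z)
        * pot m α β z := by
    have i1 : Integrable (fun z => cut x (1 / 2) z * (pot m α β z * (α z ^ 2 + β z ^ 2))) :=
      Continuous.integrable_of_hasCompactSupport (by fun_prop) hcs.mul_right
    have i2 : Integrable (fun z => (1 / 2) * (cut x (1 / 2) z * Lap (pot m α β) z)) :=
      (Continuous.integrable_of_hasCompactSupport (by fun_prop) hcs.mul_right).const_mul _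
    have hL : HasCompactSupport (Lap (cut x (1 / 2))) :=
      HasCompactSupport.add ((hcs.fderiv_apply ℝ 1).fderiv_apply ℝ 1)
        ((hcs.fderiv_apply ℝ Complex.I).fderiv_apply ℝ Complex.I)
    have i3 : Integrable (fun z => (1 / 2) * (Lap (cut x (1 / 2)) z * pot m α β z)) :=
      (Continuous.integrable_of_hasCompactSupport (by fun_prop) hL.mul_right).const_mul _
    simp only [e1]
    rw [integral_sub i1 i2, integral_const_mul, integral_mul_Lap contDiff_cut hcs
      (contDiff_pot hα hβ), ← integral_const_mul, ← integral_sub i1 i3]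
    congr 1; funext z; ring
  have h3 : ∫ z, cut x (1 / 2) z * gsq α β z ≤ ∫ z in closedBall x 1,
      (82 * cutC) * ((1 / 2) * ε + (1 / (2 * ε)) * pot m α β z ^ 2) := by
    rw [h2]
    refine integral_le_setIntegral measurableSet_closedBall ?_
      (integrableOn_closedBall (by fun_prop) x 1) ?_ ?_
    · refine Continuous.integrable_of_hasCompactSupport (by fun_prop) (HasCompactSupport.mul_right ?_)
      refine HasCompactSupport.intro (isCompact_closedBall x (2 * (1 / 2))) fun z hz => ?_
      have : z ∉ closedBall x (2 * (1 / 2)) \ ball x (1 / 2) := fun h => hz h.1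
      rw [cut_eq_zero one_half_pos hz, Lap_cut, (deriv_cut_arg_eq_zero one_half_pos this).1,
        (deriv_cut_arg_eq_zero one_half_pos this).2]
      ring
    · intro z _
      have b1 : cut x (1 / 2) z * (α z ^ 2 + β z ^ 2) ≤ 1 * 2 :=
        mul_le_mul (cut_le_one z) (h.sq_add_sq_le z) (by positivity) (by norm_num)
      have b2 := (abs_le.1 (abs_Lap_cut_le (x := x) (one_half_pos (α := ℝ)) z)).1
      norm_num at b2
      have b3 : cut x (1 / 2) z * (α z ^ 2 + β z ^ 2) - (1 / 2) * Lap (cut x (1 / 2)) z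
          ≤ 82 * cutC := by linarith
      have b4 := h.pot_nonneg z
      have b5 : pot m α β z ≤ (1 / 2) * ε + (1 / (2 * ε)) * pot m α β z ^ 2 := by
        have : (1 / 2) * ε + (1 / (2 * ε)) * pot m α β z ^ 2 - pot m α β z
          = (1 / (2 * ε)) * (ε - pot m α β z) ^ 2 := by field_simp; ring
        have : 0 ≤ (1 / (2 * ε)) * (ε - pot m α β z) ^ 2 := by positivity
        linarith
      exact mul_le_mul b3 b5 b4 (by linarith)
    · intro z hz
      have hz' : z ∉ closedBall x (2 * (1 / 2)) := by simpa using hz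
      have : z ∉ closedBall x (2 * (1 / 2)) \ ball x (1 / 2) := fun h => hz' h.1
      rw [cut_eq_zero one_half_pos hz', Lap_cut, (deriv_cut_arg_eq_zero one_half_pos this).1,
        (deriv_cut_arg_eq_zero one_half_pos this).2]
      simp
  have h4 : ∫ z in closedBall x 1, (82 * cutC) * ((1 / 2) * ε + (1 / (2 * ε)) * pot m α β z ^ 2)
      = (82 * cutC) * ((1 / 2) * ε * Real.pi
        + (1 / (2 * ε)) * ∫ z in closedBall x 1, pot m α β z ^ 2) := by
    rw [integral_const_mul, integral_add (integrableOn_closedBall (by fun_prop) x 1)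
      (integrableOn_closedBall (by fun_prop) x 1), setIntegral_const,
      volume_real_closedBall x zero_le_one, smul_eq_mul, integral_const_mul]
    ring
  have h5 : (1 / (2 * ε)) * ∫ z in closedBall x 1, pot m α β z ^ 2 ≤ (1 / (2 * ε)) * ε ^ 2 :=
    mul_le_mul_of_nonneg_left hV (by positivity)
  have h6 : (1 / (2 * ε)) * ε ^ 2 = ε / 2 := by field_simp
  have h7 : (1 / 2) * ε * Real.pi ≤ (1 / 2) * ε * 3.15 :=
    mul_le_mul_of_nonneg_left Real.pi_lt_d2.le (by positivity)
  calc _ ≤ (82 * cutC) * ((1 / 2) * ε * Real.pi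
        + (1 / (2 * ε)) * ∫ z in closedBall x 1, pot m α β z ^ 2) := h1.trans (h3.trans h4.le)
    _ ≤ (82 * cutC) * ((1 / 2) * ε * 3.15 + ε / 2) := by
        refine mul_le_mul_of_nonneg_left (by linarith) (by linarith)
    _ ≤ 200 * cutC * ε := by nlinarith [mul_pos (by linarith : 0 < cutC) hε]

end GLSol
end GinzburgLandau

namespace GinzburgLandau
open scoped ContDiff Topology

variable {m : ℝ} {α β : ℂ → ℝ}

theorem sum_annuli_le {f : ℂ → ℝ} (hf : Continuous f) (h0 : ∀ z, 0 ≤ f z) (x : ℂ) {r : ℝ}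
    (hr : 0 < r) (k : ℕ) :
    ∑ i ∈ Finset.range k, ∫ z in closedBall x (2 * (r * 4 ^ i)) \ ball x (r * 4 ^ i), f z
      ≤ ∫ z in closedBall x (r * 4 ^ k) \ ball x r, f z := by
  rw [← integral_biUnion_finset]
  · refine setIntegral_mono_set (integrableOn_annulus hf x _ _) (Eventually.of_forall h0)
      (LE.le.eventuallyLE ?_)
    intro z hz
    simp only [Set.mem_iUnion, Finset.mem_range] at hz
    obtain ⟨i, hi, hz1, hz2⟩ := hz
    rw [mem_closedBall] at hz1
    rw [mem_ball, not_lt] at hz2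
    have h1 : (4 : ℝ) ^ (i + 1) ≤ 4 ^ k := pow_le_pow_right₀ (by norm_num) hi
    have h2 : (1 : ℝ) ≤ 4 ^ i := one_le_pow₀ (by norm_num)
    refine ⟨mem_closedBall.2 (hz1.trans ?_), fun h => ?_⟩
    · rw [pow_succ] at h1
      nlinarith
    · rw [mem_ball] at h
      nlinarith
  · exact fun i _ => measurableSet_annulus _ _ _
  · have key : ∀ i j : ℕ, i < j → Disjoint
        (closedBall x (2 * (r * 4 ^ i)) \ ball x (r * 4 ^ i))
        (closedBall x (2 * (r * 4 ^ j)) \ ball x (r * 4 ^ j)) := by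
      intro i j hij
      rw [Set.disjoint_left]
      rintro z ⟨hz1, -⟩ ⟨-, hz2⟩
      apply hz2
      have h1 : (4 : ℝ) ^ (i + 1) ≤ 4 ^ j := pow_le_pow_right₀ (by norm_num) hij
      have h2 : (0 : ℝ) < 4 ^ i := by positivity
      rw [mem_closedBall] at hz1
      rw [mem_ball]
      rw [pow_succ] at h1
      have : r * (4 ^ i * 4) ≤ r * 4 ^ j := mul_le_mul_of_nonneg_left h1 hr.le
      have : 0 < r * 4 ^ i := by positivity
      linarith
    intro i _ j _ hij
    rcases lt_or_gt_of_ne hij with h | h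
    · exact key i j h
    · exact (key j i h).symm
  · exact fun i _ => integrableOn_annulus hf x _ _

theorem exists_small_annulus {f : ℂ → ℝ} (hf : Continuous f) (h0 : ∀ z, 0 ≤ f z) (x : ℂ) {r C : ℝ}
    (hr : 0 < r) {k : ℕ} (hk : 0 < k)
    (hC : ∫ z in closedBall x (r * 4 ^ k) \ ball x r, f z ≤ C) :
    ∃ i < k, ∫ z in closedBall x (2 * (r * 4 ^ i)) \ ball x (r * 4 ^ i), f z ≤ C / k := by
  by_contra! h
  have h1 := (sum_annuli_le hf h0 x hr k).trans hC
  have h2 : ∑ i ∈ Finset.range k, C / k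
      < ∑ i ∈ Finset.range k, ∫ z in closedBall x (2 * (r * 4 ^ i)) \ ball x (r * 4 ^ i), f z :=
    Finset.sum_lt_sum_of_nonempty (Finset.nonempty_range_iff.2 hk.ne')
      fun i hi => h i (Finset.mem_range.1 hi)
  rw [Finset.sum_const, Finset.card_range, nsmul_eq_mul] at h2
  have : (k : ℝ) * (C / k) = C := by field_simp
  linarith

namespace GLSol

theorem abs_dd_pow_four_le (h : GLSol m α β) {x : ℂ} {ε : ℝ} (hε : 0 < ε)
    (hV : ∫ z in closedBall x 1, pot m α β z ^ 2 ≤ ε ^ 2) {e : ℂ} (he : IsDir e) :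
    |dd e α x| ^ 4 ≤ 10 ^ 8 * cutC * ε ∧ |dd e β x| ^ 4 ≤ 10 ^ 8 * cutC * ε := by
  have hα := h.sα
  have hβ := h.sβ
  have hg := h.integral_gsq_le hε hV
  have hgcont := (contDiff_gsq hα hβ).continuous
  have main : ∀ f : ℂ → ℝ, ContDiff ℝ ∞ f → (∀ z, f z ^ 2 ≤ gsq α β z) → (∀ z, |f z| ≤ 6) →
      (∀ z, |dd 1 f z| ≤ 66) → (∀ z, |dd Complex.I f z| ≤ 66) →
      |f x| ^ 4 ≤ 10 ^ 8 * cutC * ε := by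
    intro f hf h1 h2 h3 h4
    have hr0 : 0 ≤ |f x| / 264 := by positivity
    have hr1 : |f x| / 264 ≤ 1 / 2 := by linarith [h2 x]
    have h5 : (|f x| / 2) ^ 2 * (Real.pi * (|f x| / 264) ^ 2)
        ≤ ∫ z in closedBall x (|f x| / 264), gsq α β z := by
      refine mul_volume_le_setIntegral hgcont hr0 fun z hz => le_trans ?_ (h1 z)
      have := abs_sub_le_of_dd_le hf (fun z _ => h3 z) (fun z _ => h4 z) hz
        (mem_closedBall_self hr0)
      rw [mem_closedBall, dist_eq_norm] at hz
      have h6 := abs_sub_abs_le_abs_sub (f x) (f z)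
      rw [abs_sub_comm] at h6
      rw [← sq_abs (f z)]
      exact pow_le_pow_left₀ (by positivity) (by linarith) 2
    have h6 := h5.trans ((setIntegral_mono_ball hgcont (fun z => gsq_nonneg z)
      (closedBall_subset_closedBall hr1)).trans hg)
    have h7 : 3 * |f x| ^ 4 / (4 * 264 ^ 2) ≤ 200 * cutC * ε := by
      refine le_trans ?_ h6
      have : (|f x| / 2) ^ 2 * (Real.pi * (|f x| / 264) ^ 2) = Real.pi * |f x| ^ 4 / (4 * 264 ^ 2) := by
        ring
      rw [this]
      gcongr
      exact Real.pi_gt_three.le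
    have hc : 0 ≤ cutC * ε := mul_nonneg (zero_le_one.trans one_le_cutC) hε.le
    rw [div_le_iff₀ (by norm_num)] at h7
    nlinarith
  have hb := fun z => h.abs_dd_dd_le he (Or.inl rfl) z
  have hb' := fun z => h.abs_dd_dd_le he (Or.inr rfl) z
  constructor
  · refine main (dd e α) (contDiff_dd hα) ?_ (fun z => (h.abs_dd_le' he z).1)
      (fun z => (hb z).1) (fun z => (hb' z).1)
    intro z
    unfold gsq
    rcases he with rfl | rfl <;>
    nlinarith [sq_nonneg (dd 1 α z), sq_nonneg (dd 1 β z), sq_nonneg (dd Complex.I α z),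
      sq_nonneg (dd Complex.I β z)]
  · refine main (dd e β) (contDiff_dd hβ) ?_ (fun z => (h.abs_dd_le' he z).2)
      (fun z => (hb z).2) (fun z => (hb' z).2)
    intro z
    unfold gsq
    rcases he with rfl | rfl <;>
    nlinarith [sq_nonneg (dd 1 α z), sq_nonneg (dd 1 β z), sq_nonneg (dd Complex.I α z),
      sq_nonneg (dd Complex.I β z)]

end GLSol

/-- Bounded energy on a large ball forces a small gradient at the centre. -/
theorem exists_radius_small_gradient (C κ : ℝ) (hC : 0 < C) (hκ : 0 < κ) :
    ∃ R : ℝ, 1 ≤ R ∧ ∀ (m : ℝ) (α β : ℂ → ℝ), GLSol m α β → ∀ x : ℂ,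
      ∫ z in closedBall x R, ed m α β z ≤ C →
      ∀ e, IsDir e → |dd e α x| ≤ κ ∧ |dd e β x| ≤ κ := by
  have hcut : 0 < cutC := zero_lt_one.trans_le one_le_cutC
  set ε : ℝ := κ ^ 4 / (10 ^ 8 * cutC) with hεdef
  have hε : 0 < ε := by positivity
  obtain ⟨k, hk⟩ := exists_nat_gt (32 * cutC * C / ε ^ 2)
  have hk0 : (0 : ℝ) < k := lt_of_le_of_lt (by positivity) hk
  have hkpos : 0 < k := by exact_mod_cast hk0
  refine ⟨4 ^ k, one_le_pow₀ (by norm_num), ?_⟩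
  intro m α β h x hE e he
  have hed := (contDiff_ed (m := m) h.sα h.sβ).continuous
  obtain ⟨i, hi, hA⟩ := exists_small_annulus hed (fun z => ed_nonneg z) x one_pos hkpos
    (C := C) ((setIntegral_mono_ball hed (fun z => ed_nonneg z)
      (by rw [one_mul]; exact Set.sdiff_subset)).trans hE)
  rw [one_mul] at hA
  have hp : ∫ z in closedBall x 1, pot m α β z ^ 2 ≤ ε ^ 2 := by
    have h1 : (1 : ℝ) ≤ 4 ^ i := one_le_pow₀ (by norm_num)
    have hpc := (contDiff_pot (m := m) h.sα h.sβ).continuous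
    calc ∫ z in closedBall x 1, pot m α β z ^ 2 ≤ ∫ z in closedBall x (4 ^ i), pot m α β z ^ 2 :=
          setIntegral_mono_ball (by fun_prop) (fun z => sq_nonneg _)
            (closedBall_subset_closedBall h1)
      _ ≤ 32 * cutC * (C / k) := (h.pohozaev x (by positivity)).trans (by gcongr)
      _ ≤ ε ^ 2 := by
          rw [div_lt_iff₀ (by positivity)] at hk
          rw [← mul_div_assoc, div_le_iff₀ hk0]
          linarith
  have h2 := h.abs_dd_pow_four_le hε hp he
  have h3 : 10 ^ 8 * cutC * ε = κ ^ 4 := by rw [hεdef]; field_simp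
  rw [h3] at h2
  exact ⟨le_of_pow_le_pow_left₀ (by norm_num) hκ.le h2.1,
    le_of_pow_le_pow_left₀ (by norm_num) hκ.le h2.2⟩

end GinzburgLandau

namespace GinzburgLandau
open scoped ContDiff Topology

/-- The point with polar coordinates `(r, θ)` around `x`. -/
def pol (x : ℂ) (r θ : ℝ) : ℂ := x + (r : ℂ) * Complex.exp (θ * Complex.I)

@[simp] theorem pol_re (x : ℂ) (r θ : ℝ) : (pol x r θ).re = x.re + r * Real.cos θ := by
  simp [pol, Complex.exp_re, Complex.exp_im]

@[simp] theorem pol_im (x : ℂ) (r θ : ℝ) : (pol x r θ).im = x.im + r * Real.sin θ := by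
  simp [pol, Complex.exp_re, Complex.exp_im]

theorem norm_pol_sub (x : ℂ) (r θ : ℝ) : ‖pol x r θ - x‖ = |r| := by
  simp [pol, Complex.norm_exp_ofReal_mul_I]

@[simp] theorem nsq_pol (x : ℂ) (r θ : ℝ) : nsq x (pol x r θ) = r ^ 2 := by
  rw [nsq_eq, norm_pol_sub, sq_abs]

theorem continuous_pol (x : ℂ) : Continuous fun p : ℝ × ℝ => pol x p.1 p.2 := by
  unfold pol; fun_prop

theorem continuous_pol_right (x : ℂ) (r : ℝ) : Continuous fun θ : ℝ => pol x r θ := by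
  unfold pol; fun_prop

theorem exists_pol (x z : ℂ) : ∃ θ ∈ Set.Icc (-Real.pi) Real.pi, z = pol x ‖z - x‖ θ :=
  ⟨(z - x).arg, ⟨(Complex.neg_pi_lt_arg _).le, Complex.arg_le_pi _⟩, by
    rw [pol, Complex.norm_mul_exp_arg_mul_I]; ring⟩

theorem pol_pi (x : ℂ) (r : ℝ) : pol x r Real.pi = pol x r (-Real.pi) := by
  simp [pol, Complex.exp_neg]

theorem hasDerivAt_pol (x : ℂ) (r θ : ℝ) : HasDerivAt (fun θ : ℝ => pol x r θ)
    (((-(r * Real.sin θ) : ℝ) : ℂ) + ((r * Real.cos θ : ℝ) : ℂ) * Complex.I) θ := by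
  have h1 : HasDerivAt (fun θ : ℝ => (θ : ℂ) * Complex.I) Complex.I θ := by
    simpa using (Complex.ofRealCLM.hasDerivAt (x := θ)).mul_const Complex.I
  have h2 := (h1.cexp.const_mul (r : ℂ)).const_add x
  refine h2.congr_deriv ?_
  rw [Complex.exp_mul_I, ← Complex.ofReal_cos, ← Complex.ofReal_sin]
  apply Complex.ext <;> simp [-Complex.ofReal_cos, -Complex.ofReal_sin]

theorem integral_eq_polar {g : ℂ → ℝ} (hg : Continuous g) (x : ℂ) {K : ℝ} (hK : 0 ≤ K)
    (h0 : ∀ z, K < ‖z - x‖ → g z = 0) :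
    ∫ z, g z = ∫ r in (0 : ℝ)..K, r * ∫ θ in (-Real.pi)..Real.pi, g (pol x r θ) := by
  have h1 : ∫ z, g z = ∫ z, g (x + z) := (integral_add_left_eq_self g x).symm
  rw [h1, ← Complex.integral_comp_polarCoord_symm (fun z => g (x + z)), polarCoord_target]
  have h2 : ∀ p : ℝ × ℝ, p.1 • g (x + Complex.polarCoord.symm p) = p.1 * g (pol x p.1 p.2) := by
    intro p
    have : x + Complex.polarCoord.symm p = pol x p.1 p.2 := by
      rw [Complex.polarCoord_symm_apply, pol, Complex.exp_mul_I]
      push_cast; ring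
    rw [this, smul_eq_mul]
  simp_rw [h2]
  have hcont : Continuous fun p : ℝ × ℝ => p.1 * g (pol x p.1 p.2) :=
    continuous_fst.mul (hg.comp (continuous_pol x))
  have h3 : ∫ p in Set.Ioi (0 : ℝ) ×ˢ Set.Ioo (-Real.pi) Real.pi, p.1 * g (pol x p.1 p.2)
      = ∫ p in Set.Ioc (0 : ℝ) K ×ˢ Set.Ioc (-Real.pi) Real.pi, p.1 * g (pol x p.1 p.2) := by
    rw [Measure.volume_eq_prod, ← Measure.prod_restrict, ← Measure.prod_restrict,
      ← Measure.restrict_congr_set (Ioo_ae_eq_Ioc (μ := volume) (a := -Real.pi) (b := Real.pi)),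
      Measure.prod_restrict, Measure.prod_restrict]
    refine setIntegral_eq_of_subset_of_forall_sdiff_eq_zero
      ((measurableSet_Ioi (a := (0 : ℝ))).prod
      (measurableSet_Ioo (a := -Real.pi) (b := Real.pi)))
      (Set.prod_mono Set.Ioc_subset_Ioi_self le_rfl) ?_
    rintro ⟨r, θ⟩ ⟨⟨hr, hθ⟩, hp⟩
    have hr' : K < r := by
      by_contra! hle
      exact hp ⟨⟨hr, hle⟩, hθ⟩
    rw [h0 _ (by rw [norm_pol_sub]; exact hr'.trans_le (le_abs_self r)), mul_zero]
  rw [h3, Measure.volume_eq_prod, setIntegral_prod]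
  · rw [intervalIntegral.integral_of_le hK]
    refine setIntegral_congr_fun measurableSet_Ioc fun r _ => ?_
    simp only
    rw [integral_const_mul, intervalIntegral.integral_of_le (by linarith [Real.pi_pos])]
  · rw [← Measure.volume_eq_prod]
    exact (hcont.continuousOn.integrableOn_compact
      ((isCompact_Icc (a := (0 : ℝ)) (b := K)).prod
        (isCompact_Icc (a := -Real.pi) (b := Real.pi)))).mono_set
      (Set.prod_mono Set.Ioc_subset_Icc_self Set.Ioc_subset_Icc_self)

theorem continuous_circle_integral {g : ℝ → ℝ → ℝ} (hg : Continuous fun p : ℝ × ℝ => g p.1 p.2) :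
    Continuous fun r : ℝ => ∫ θ in (-Real.pi)..Real.pi, g r θ :=
  intervalIntegral.continuous_parametric_intervalIntegral_of_continuous hg continuous_const

/-- A radius on which the circular integral is controlled by the integral over the ball. -/
theorem exists_good_radius {g : ℂ → ℝ} (hg : Continuous g) (h0 : ∀ z, 0 ≤ g z) (x : ℂ) {R C : ℝ}
    (hR : 0 < R) (hC : 0 < C) (h : ∫ z in closedBall x (2 * R), g z ≤ C) :
    ∃ r ∈ Set.Icc (R / 2) R, r ^ 2 * ∫ θ in (-Real.pi)..Real.pi, g (pol x r θ) ≤ 4 * C := by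
  by_contra! hcon
  have h1 : ∫ z, cut x R z * g z ≤ C := by
    refine le_trans (integral_le_setIntegral measurableSet_closedBall
      ((contDiff_cut.continuous.mul hg).integrable_of_hasCompactSupport
        (hasCompactSupport_cut hR).mul_right) (integrableOn_closedBall hg x (2 * R))
      (fun z _ => mul_le_of_le_one_left (h0 z) (cut_le_one z)) (fun z hz => ?_)) h
    rw [cut_eq_zero hR hz, zero_mul]
  rw [integral_eq_polar (g := fun z => cut x R z * g z) (contDiff_cut.continuous.mul hg) x (K := 2 * R) (by linarith)
    (fun z hz => by
      rw [cut_eq_zero hR (by rw [mem_closedBall, dist_eq_norm]; exact not_le.2 hz), zero_mul])] at h1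
  have hcF : Continuous fun r : ℝ => r * ∫ θ in (-Real.pi)..Real.pi,
      cut x R (pol x r θ) * g (pol x r θ) :=
    continuous_id.mul (continuous_circle_integral (g := fun r θ => cut x R (pol x r θ) * g (pol x r θ))
      ((contDiff_cut.continuous.mul hg).comp (continuous_pol x)))
  have hpos : ∀ r, 0 ≤ r → 0 ≤ r * ∫ θ in (-Real.pi)..Real.pi,
      cut x R (pol x r θ) * g (pol x r θ) := fun r hr =>
    mul_nonneg hr (intervalIntegral.integral_nonneg (by linarith [Real.pi_pos])
      fun θ _ => mul_nonneg (cut_nonneg _) (h0 _))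
  have h2 : ∫ _ in (R / 2)..R, 4 * C / R ≤ ∫ r in (R / 2)..R, r * ∫ θ in (-Real.pi)..Real.pi,
      cut x R (pol x r θ) * g (pol x r θ) := by
    refine intervalIntegral.integral_mono_on (by linarith) (by simp) (hcF.intervalIntegrable _ _) ?_
    intro r hr
    have hr0 : 0 < r := by linarith [hr.1]
    have h3 := hcon r hr
    have h4 : ∫ θ in (-Real.pi)..Real.pi, cut x R (pol x r θ) * g (pol x r θ)
        = ∫ θ in (-Real.pi)..Real.pi, g (pol x r θ) := by
      congr 1; funext θ
      rw [cut_eq_one hR (by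
        rw [mem_closedBall, dist_eq_norm, norm_pol_sub, abs_of_pos hr0]; exact hr.2), one_mul]
    rw [h4, div_le_iff₀ hR]
    have h5 : 0 ≤ r * ∫ θ in (-Real.pi)..Real.pi, g (pol x r θ) := by
      have := hpos r hr0.le; rwa [h4] at this
    nlinarith [hr.2]
  have h6 : ∫ r in (R / 2)..R, r * ∫ θ in (-Real.pi)..Real.pi,
      cut x R (pol x r θ) * g (pol x r θ) ≤ C := by
    refine le_trans (intervalIntegral.integral_mono_interval (c := 0) (d := 2 * R) (by linarith)
      (by linarith) (by linarith) ?_ (hcF.intervalIntegrable _ _)) h1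
    rw [Filter.EventuallyLE, ae_restrict_iff' measurableSet_Ioc]
    exact Eventually.of_forall fun r hr => hpos r hr.1.le
  rw [intervalIntegral.integral_const, smul_eq_mul] at h2
  have : (R - R / 2) * (4 * C / R) = 2 * C := by field_simp; ring
  linarith

/-- Oscillation on a circle. -/
theorem abs_sub_le_of_circle {f : ℂ → ℝ} (hf : ContDiff ℝ ∞ f) {x : ℂ} {r C : ℝ}
    (h : r ^ 2 * ∫ θ in (-Real.pi)..Real.pi, (dd 1 f (pol x r θ) ^ 2 + dd Complex.I f (pol x r θ) ^ 2) ≤ C)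
    {z w : ℂ} (hz : ‖z - x‖ = r) (hw : ‖w - x‖ = r) : |f z - f w| ≤ 2 * Real.pi + C := by
  have hpi := Real.pi_pos
  set D : ℝ → ℝ := fun θ => -(r * Real.sin θ) * dd 1 f (pol x r θ)
    + r * Real.cos θ * dd Complex.I f (pol x r θ) with hD
  set G : ℝ → ℝ := fun θ => dd 1 f (pol x r θ) ^ 2 + dd Complex.I f (pol x r θ) ^ 2 with hG
  have hder : ∀ θ, HasDerivAt (fun θ => f (pol x r θ)) (D θ) θ := by
    intro θ
    have := (differentiable_of_smooth hf (pol x r θ)).hasFDerivAt.comp_hasDerivAt θ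
      (hasDerivAt_pol x r θ)
    refine this.congr_deriv ?_
    rw [fderiv_apply_eq, hD]
    simp only [Complex.add_re, Complex.add_im, Complex.ofReal_re, Complex.ofReal_im,
      Complex.re_ofReal_mul, Complex.im_ofReal_mul, Complex.I_re, Complex.I_im]
    ring
  have c1 : Continuous fun θ => dd 1 f (pol x r θ) := (continuous_dd hf).comp (continuous_pol_right x r)
  have c2 : Continuous fun θ => dd Complex.I f (pol x r θ) :=
    (continuous_dd hf).comp (continuous_pol_right x r)
  have cD : Continuous D := by rw [hD]; fun_prop
  have cG : Continuous G := by rw [hG]; fun_prop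
  have hle : ∀ θ, |D θ| ≤ 1 + r ^ 2 * G θ := by
    intro θ
    have h1 : D θ ^ 2 ≤ r ^ 2 * G θ := by
      have hsc := Real.sin_sq_add_cos_sq θ
      simp only [hD, hG]
      nlinarith [sq_nonneg (r * (Real.cos θ * dd 1 f (pol x r θ) + Real.sin θ * dd Complex.I f (pol x r θ)))]
    nlinarith [sq_abs (D θ), sq_nonneg (|D θ| - 1), abs_nonneg (D θ)]
  obtain ⟨a, ha, hza⟩ := exists_pol x z
  obtain ⟨b, hb, hwb⟩ := exists_pol x w
  rw [hz] at hza
  rw [hw] at hwb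
  have key : ∀ a b : ℝ, a ∈ Set.Icc (-Real.pi) Real.pi → b ∈ Set.Icc (-Real.pi) Real.pi → a ≤ b →
      |f (pol x r b) - f (pol x r a)| ≤ 2 * Real.pi + C := by
    intro a b ha hb hab
    rw [← intervalIntegral.integral_eq_sub_of_hasDerivAt (fun θ _ => hder θ)
      (cD.intervalIntegrable _ _)]
    have hc2 : Continuous fun θ => 1 + r ^ 2 * G θ := by fun_prop
    calc |∫ θ in a..b, D θ| ≤ ∫ θ in a..b, |D θ| :=
          intervalIntegral.abs_integral_le_integral_abs hab
      _ ≤ ∫ θ in a..b, (1 + r ^ 2 * G θ) :=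
          intervalIntegral.integral_mono_on hab (cD.abs.intervalIntegrable _ _)
            (hc2.intervalIntegrable _ _) fun θ _ => hle θ
      _ ≤ ∫ θ in (-Real.pi)..Real.pi, (1 + r ^ 2 * G θ) := by
          refine intervalIntegral.integral_mono_interval ha.1 hab hb.2 ?_ (hc2.intervalIntegrable _ _)
          exact Eventually.of_forall fun θ => (abs_nonneg _).trans (hle θ)
      _ ≤ 2 * Real.pi + C := by
          rw [intervalIntegral.integral_add (by simp) ((cG.const_mul _).intervalIntegrable _ _)
            , intervalIntegral.integral_const_mul]
          simp
          linarith
  rw [hza, hwb]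
  rcases le_total a b with hab | hab
  · rw [abs_sub_comm]; exact key a b ha hb hab
  · exact key b a hb ha hab

end GinzburgLandau

namespace GinzburgLandau
open scoped ContDiff Topology
variable {m : ℝ} {α β : ℂ → ℝ}

/-- A smooth step: `0` for `t ≤ 1/16` and `1` for `t ≥ 1/8`. -/
def stepF (t : ℝ) : ℝ := Real.smoothTransition (16 * t - 1)

/-- A smooth modification of `1/t`. -/
def invF (t : ℝ) : ℝ := stepF t / t

@[fun_prop] theorem contDiff_stepF : ContDiff ℝ ∞ stepF := by
  unfold stepF
  exact contDiff_smoothTransition'.comp (by fun_prop)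

theorem stepF_eq_zero {t : ℝ} (ht : t ≤ 1 / 16) : stepF t = 0 :=
  Real.smoothTransition.zero_of_nonpos (by linarith)

theorem stepF_eq_one {t : ℝ} (ht : 1 / 8 ≤ t) : stepF t = 1 :=
  Real.smoothTransition.one_of_one_le (by linarith)

theorem stepF_nonneg (t : ℝ) : 0 ≤ stepF t := Real.smoothTransition.nonneg _
theorem stepF_le_one (t : ℝ) : stepF t ≤ 1 := Real.smoothTransition.le_one _

theorem deriv_stepF_eq_zero {t : ℝ} (ht : 1 / 8 < t) : deriv stepF t = 0 :=
  deriv_eq_zero_of_eqOn_const (s := Set.Ioi (1 / 8)) isOpen_Ioi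
    (fun _ hx => stepF_eq_one (le_of_lt hx)) t ht

theorem deriv_stepF (t : ℝ) : deriv stepF t = 16 * deriv Real.smoothTransition (16 * t - 1) := by
  have h1 : HasDerivAt Real.smoothTransition (deriv Real.smoothTransition (16 * t - 1)) (16 * t - 1) :=
    ((contDiff_smoothTransition'.differentiable (by simp)) _).hasDerivAt
  have h2 : HasDerivAt (fun t : ℝ => 16 * t - 1) 16 t := by
    simpa using ((hasDerivAt_id t).const_mul 16).sub_const 1
  have := (h1.comp t h2).deriv
  rw [show stepF = Real.smoothTransition ∘ fun t => 16 * t - 1 from rfl, this]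
  ring

theorem abs_deriv_stepF_le (t : ℝ) : |deriv stepF t| ≤ 16 * cutC := by
  rw [deriv_stepF, abs_mul, abs_of_pos (by norm_num : (0 : ℝ) < 16)]
  exact mul_le_mul_of_nonneg_left (abs_deriv_smoothTransition_le _) (by norm_num)

theorem mul_invF (t : ℝ) : t * invF t = stepF t := by
  unfold invF
  by_cases ht : t = 0
  · rw [ht, stepF_eq_zero (by norm_num)]; simp
  · field_simp

@[fun_prop] theorem contDiff_invF : ContDiff ℝ ∞ invF := by
  rw [contDiff_iff_contDiffAt]
  intro t
  by_cases ht : t < 1 / 16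
  · have : invF =ᶠ[𝓝 t] fun _ => 0 := by
      filter_upwards [Iio_mem_nhds ht] with s hs
      rw [invF, stepF_eq_zero (le_of_lt hs), zero_div]
    exact contDiffAt_const.congr_of_eventuallyEq this
  · exact contDiff_stepF.contDiffAt.div contDiffAt_id (by rintro rfl; norm_num at ht)

theorem deriv_stepF_eq (t : ℝ) : deriv stepF t = invF t + t * deriv invF t := by
  have h1 : HasDerivAt invF (deriv invF t) t := ((contDiff_invF.differentiable (by simp)) t).hasDerivAt
  have h2 := ((hasDerivAt_id t).mul h1).deriv
  have h3 : (id * invF) = stepF := funext fun t => mul_invF t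
  rw [h3] at h2
  simpa using h2

/-- Modified current. -/
def jt (α β : ℂ → ℝ) (e z : ℂ) : ℝ :=
  invF (α z ^ 2 + β z ^ 2) * (α z * dd e β z - β z * dd e α z)

theorem contDiff_comp_normSq {f : ℝ → ℝ} (hf : ContDiff ℝ ∞ f) (hα : ContDiff ℝ ∞ α)
    (hβ : ContDiff ℝ ∞ β) : ContDiff ℝ ∞ fun z => f (α z ^ 2 + β z ^ 2) :=
  hf.comp (by fun_prop)

@[fun_prop] theorem contDiff_jt {e : ℂ} (hα : ContDiff ℝ ∞ α) (hβ : ContDiff ℝ ∞ β) :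
    ContDiff ℝ ∞ (jt α β e) := by
  unfold jt
  exact (contDiff_comp_normSq contDiff_invF hα hβ).mul (by fun_prop)

theorem curl_jt (hα : ContDiff ℝ ∞ α) (hβ : ContDiff ℝ ∞ β) (e e' z : ℂ) :
    dd e (jt α β e') z - dd e' (jt α β e) z
      = 2 * deriv stepF (α z ^ 2 + β z ^ 2) * (dd e α z * dd e' β z - dd e' α z * dd e β z) := by
  have h1 : ∀ e, dd e (fun z => α z ^ 2 + β z ^ 2)
      = fun z => 2 * (α z * dd e α z + β z * dd e β z) := fun e => by
    simp (disch := fun_prop) only [dd_add, dd_pow]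
    funext z; norm_num; ring
  have h2 : ∀ a b, dd a (jt α β b) = fun z =>
      deriv invF (α z ^ 2 + β z ^ 2) * (2 * (α z * dd a α z + β z * dd a β z))
        * (α z * dd b β z - β z * dd b α z)
      + invF (α z ^ 2 + β z ^ 2) * (dd a α z * dd b β z + α z * dd a (dd b β) z
        - (dd a β z * dd b α z + β z * dd a (dd b α) z)) := fun a b => by
    have hc := contDiff_comp_normSq contDiff_invF hα hβ
    have : jt α β b = fun z => (fun z => invF (α z ^ 2 + β z ^ 2)) z
      * (α z * dd b β z - β z * dd b α z) := rfl
    rw [this, dd_mul hc (by fun_prop), dd_comp (f := fun z => α z ^ 2 + β z ^ 2) contDiff_invF (by fun_prop), h1]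
    simp (disch := fun_prop) only [dd_sub, dd_mul]
  rw [h2, h2, deriv_stepF_eq, dd_comm (e := e) (e' := e') hα, dd_comm (e := e) (e' := e') hβ]
  ring

theorem jt_eq {e z : ℂ} (hz : 1 / 8 ≤ α z ^ 2 + β z ^ 2) :
    (α z ^ 2 + β z ^ 2) * jt α β e z = α z * dd e β z - β z * dd e α z := by
  rw [jt, ← mul_assoc, mul_invF, stepF_eq_one hz, one_mul]

/-- Local primitive of the modified current away from zeros. -/
theorem exists_phase (hα : ContDiff ℝ ∞ α) (hβ : ContDiff ℝ ∞ β) {x : ℂ} {R : ℝ} (hR : 0 < R)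
    (hb : ∀ z ∈ ball x (3 * R), 1 / 4 ≤ α z ^ 2 + β z ^ 2) :
    ∃ φ : ℂ → ℝ, ContDiff ℝ ∞ φ ∧ ∀ z ∈ ball x R, ∀ e, dd e φ z = jt α β e z := by
  set η : ℂ → ℂ →L[ℝ] ℝ := fun z => invF (α z ^ 2 + β z ^ 2) • (α z • fderiv ℝ β z - β z • fderiv ℝ α z)
    with hη
  have hηs : ContDiff ℝ ∞ η := by
    have h1 : ContDiff ℝ ∞ (fderiv ℝ α) := hα.fderiv_right (m := ∞) (by simp)
    have h2 : ContDiff ℝ ∞ (fderiv ℝ β) := hβ.fderiv_right (m := ∞) (by simp)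
    exact (contDiff_comp_normSq contDiff_invF hα hβ).smul ((hα.smul h2).sub (hβ.smul h1))
  have hηe : ∀ e, (fun z => η z e) = jt α β e := fun e => by
    funext z; simp [hη, jt, dd]
  have hηd : ∀ a e e', fderiv ℝ η a e e' = dd e (jt α β e') a := fun a e e' => by
    rw [← hηe, dd]
    have := ((hηs.differentiable (by simp)) a).hasFDerivAt.clm_apply (hasFDerivAt_const e' a)
    rw [this.fderiv]; simp
  obtain ⟨φ₀, hφ₀⟩ := (convex_ball x (3 * R)).exists_forall_hasFDerivAt_of_fderiv_symmetric
    isOpen_ball (show DifferentiableOn ℝ η (ball x (3 * R)) from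
      (hηs.differentiable (by simp)).differentiableOn) (fun a ha e e' => by
      have h1 := curl_jt hα hβ e e' a
      rw [deriv_stepF_eq_zero (lt_of_lt_of_le (by norm_num) (hb a ha))] at h1
      rw [hηd, hηd]; linarith)
  have hφs : ContDiffOn ℝ ∞ φ₀ (ball x (3 * R)) := by
    rw [contDiffOn_infty_iff_fderiv_of_isOpen isOpen_ball]
    exact ⟨fun z hz => (hφ₀ z hz).differentiableAt.differentiableWithinAt,
      hηs.contDiffOn.congr fun z hz => (hφ₀ z hz).fderiv⟩
  refine ⟨fun z => cut x R z * φ₀ z, ?_, ?_⟩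
  · rw [contDiff_iff_contDiffAt]
    intro z
    by_cases hz : z ∈ ball x (3 * R)
    · exact contDiff_cut.contDiffAt.mul (hφs.contDiffAt (isOpen_ball.mem_nhds hz))
    · have hz' : z ∈ (closedBall x (2 * R))ᶜ := fun h => hz (closedBall_subset_ball (by linarith) h)
      have : (fun z => cut x R z * φ₀ z) =ᶠ[𝓝 z] fun _ => 0 := by
        filter_upwards [isClosed_closedBall.isOpen_compl.mem_nhds hz'] with w hw
        rw [cut_eq_zero hR hw, zero_mul]
      exact contDiffAt_const.congr_of_eventuallyEq this
  · intro z hz e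
    have : (fun z => cut x R z * φ₀ z) =ᶠ[𝓝 z] φ₀ := by
      filter_upwards [isOpen_ball.mem_nhds hz] with w hw
      rw [cut_eq_one hR (ball_subset_closedBall hw), one_mul]
    rw [dd, this.fderiv_eq, (hφ₀ z (ball_subset_ball (by linarith) hz)).fderiv, ← hηe]

/-- Maximum principle for solutions of elliptic equations with bounded drift. -/
theorem abs_sub_le_of_drift {f : ℂ → ℝ} (hf : ContDiff ℝ ∞ f) {x : ℂ} {r Ω b : ℝ} (hr : 0 < r)
    (hL : ∀ z ∈ ball x r, |Lap f z| ≤ b * (|dd 1 f z| + |dd Complex.I f z|))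
    (hΩ : ∀ z w, ‖z - x‖ = r → ‖w - x‖ = r → |f z - f w| ≤ Ω) :
    ∀ z ∈ closedBall x r, |f z - f (x + r)| ≤ Ω := by
  have main : ∀ g : ℂ → ℝ, ContDiff ℝ ∞ g →
      (∀ z ∈ ball x r, |Lap g z| ≤ b * (|dd 1 g z| + |dd Complex.I g z|)) →
      (∀ z w, ‖z - x‖ = r → ‖w - x‖ = r → |g z - g w| ≤ Ω) →
      ∀ z ∈ closedBall x r, g z - g (x + r) ≤ Ω := by
    intro g hg hLg hΩg z hz
    set c : ℝ := |b| + 1 with hc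
    have hc1 : |b| < c := by rw [hc]; linarith
    have hc0 : 0 < c := lt_of_le_of_lt (abs_nonneg _) hc1
    set E : ℂ → ℝ := fun z => Real.exp (c * z.re) with hE
    have hEs : ContDiff ℝ ∞ E := by rw [hE]; fun_prop
    have hE1 : dd 1 E = fun z => c * E z := by
      rw [hE, dd_comp (f := fun z : ℂ => c * z.re) Real.contDiff_exp (by fun_prop)]
      simp (disch := fun_prop) only [dd_mul, dd_const, dd_one_re, Real.deriv_exp]
      funext z; ring
    have hE2 : dd Complex.I E = fun z => 0 := by
      rw [hE, dd_comp (f := fun z : ℂ => c * z.re) Real.contDiff_exp (by fun_prop)]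
      simp (disch := fun_prop) only [dd_mul, dd_const, dd_I_re, Real.deriv_exp]
      funext z; ring
    set K : ℝ := Real.exp (c * (x.re + r)) with hK
    have hKE : ∀ z ∈ closedBall x r, E z ≤ K := by
      intro z hz
      rw [mem_closedBall, dist_eq_norm] at hz
      have := (Complex.abs_re_le_norm (z - x)).trans hz
      rw [Complex.sub_re] at this
      exact Real.exp_le_exp.2 (by nlinarith [le_abs_self (z.re - x.re)])
    refine le_of_forall_pos_le_add fun ε hε => ?_
    set δ : ℝ := ε / K with hδ
    have hK0 : 0 < K := Real.exp_pos _
    have hδ0 : 0 < δ := by positivity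
    have := max_principle (K := closedBall x r) (U := ball x r)
      (f := fun z => g z + δ * E z - (g (x + r) + Ω + ε))
      (isCompact_closedBall x r) isOpen_ball ball_subset_closedBall (by fun_prop) ?_ ?_ z hz
    · have h1 : 0 < E z := Real.exp_pos _
      have h2 : 0 < δ * E z := by positivity
      linarith
    · intro w hw hwU
      have hwn : ‖w - x‖ = r := by
        rw [mem_closedBall, dist_eq_norm] at hw
        rw [mem_ball, dist_eq_norm, not_lt] at hwU
        exact le_antisymm hw hwU
      have h1 := (le_abs_self _).trans (hΩg w (x + r) hwn (by simp [abs_of_pos hr]))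
      have h2 : δ * E w ≤ ε := by
        rw [hδ, div_mul_eq_mul_div, div_le_iff₀ hK0]
        exact mul_le_mul_of_nonneg_left (hKE w hw) hε.le
      linarith
    · intro w hw _ h1 h2
      have e1 : ∀ e, dd e (fun z => g z + δ * E z - (g (x + r) + Ω + ε))
          = fun z => dd e g z + δ * dd e E z := fun e => by
        simp (disch := fun_prop) only [dd_sub, dd_add, dd_mul, dd_const]
        funext z; ring
      rw [e1, hE1] at h1
      rw [e1, hE2] at h2
      rw [Lap_sub (by fun_prop) contDiff_const, Lap_add hg (by fun_prop), Lap_const_mul δ hEs, Lap_const]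
      have h3 : Lap E w = c ^ 2 * E w := by
        unfold Lap
        rw [hE1, hE2]
        simp (disch := fun_prop) only [dd_mul, dd_const, hE1]
        ring
      have h4 : 0 < E w := Real.exp_pos _
      simp only [mul_zero, add_zero] at h1 h2
      have h5 : dd 1 g w = - (δ * (c * E w)) := by linarith
      have h6 := hLg w hw
      rw [h5, h2, abs_neg, abs_zero, add_zero,
        abs_of_pos (a := δ * (c * E w)) (by positivity)] at h6
      have h7 := (abs_le.1 h6).1
      rw [h3]
      have h8 : b < c := (le_abs_self b).trans_lt hc1
      have h9 : 0 < δ * (c * E w) := by positivity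
      nlinarith [mul_pos h9 (sub_pos.2 h8)]
  intro z hz
  rw [abs_le]
  have hneg : ∀ e, dd e (fun z => - f z) = fun z => - dd e f z := fun e => dd_neg
  have h2 := main (fun z => - f z) (by fun_prop) (fun z hz => by
    rw [Lap_neg, hneg, hneg, abs_neg, abs_neg, abs_neg]; exact hL z hz)
    (fun z w hz hw => by
      have := hΩ z w hz hw
      rw [← abs_neg]; convert this using 2; ring) z hz
  exact ⟨by linarith, main f hf hL hΩ z hz⟩

end GinzburgLandau

namespace GinzburgLandau
open scoped ContDiff Topology
variable {m : ℝ} {α β : ℂ → ℝ}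

namespace GLSol

theorem Lap_phase (h : GLSol m α β) {φ : ℂ → ℝ} (hφ : ContDiff ℝ ∞ φ) {x : ℂ} {R : ℝ}
    (hb : ∀ z ∈ ball x R, 1 / 4 ≤ α z ^ 2 + β z ^ 2)
    (hj : ∀ z ∈ ball x R, ∀ e, dd e φ z = jt α β e z) {z : ℂ} (hz : z ∈ ball x R) :
    (α z ^ 2 + β z ^ 2) * Lap φ z
      = dd 1 (pot m α β) z * dd 1 φ z + dd Complex.I (pot m α β) z * dd Complex.I φ z := by
  have hα := h.sα
  have hβ := h.sβ
  have key : ∀ e, dd e (fun z => (m - pot m α β z) * dd e φ z) z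
      = dd e (fun z => α z * dd e β z - β z * dd e α z) z := by
    intro e
    have : (fun z => (m - pot m α β z) * dd e φ z) =ᶠ[𝓝 z]
        (fun z => α z * dd e β z - β z * dd e α z) := by
      filter_upwards [isOpen_ball.mem_nhds hz] with w hw
      rw [hj w hw, ← jt_eq (by linarith [hb w hw]), pot]; ring
    rw [dd, this.fderiv_eq, dd]
  have h1 := key 1
  have h2 := key Complex.I
  have e1 := h.eα z
  have e2 := h.eβ z
  simp (disch := fun_prop) only [dd_sub, dd_mul, dd_const] at h1 h2
  unfold Lap at *
  unfold pot at h1 h2 ⊢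
  have : α z * (dd 1 (dd 1 β) z + dd Complex.I (dd Complex.I β) z)
      = β z * (dd 1 (dd 1 α) z + dd Complex.I (dd Complex.I α) z) := by rw [e1, e2]; ring
  linarith

theorem sq_dd_phase_le {φ : ℂ → ℝ} {z : ℂ} (hb : 1 / 4 ≤ α z ^ 2 + β z ^ 2)
    (hj : ∀ e, dd e φ z = jt α β e z) (e : ℂ) :
    dd e φ z ^ 2 ≤ 4 * (dd e α z ^ 2 + dd e β z ^ 2) := by
  have h1 := jt_eq (α := α) (β := β) (e := e) (z := z) (by linarith)
  rw [← hj] at h1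
  set N := α z ^ 2 + β z ^ 2
  have h2 : (N * dd e φ z) ^ 2 ≤ N * (dd e α z ^ 2 + dd e β z ^ 2) := by
    rw [h1]
    have := sq_nonneg (α z * dd e α z + β z * dd e β z)
    simp only [N]; nlinarith
  have h3 : N * dd e φ z ^ 2 ≤ dd e α z ^ 2 + dd e β z ^ 2 := by
    have hN : 0 < N := by linarith
    refine le_of_mul_le_mul_left ?_ hN
    linarith
  nlinarith [sq_nonneg (dd e φ z)]

theorem gsq_le_phase (h : GLSol m α β) {φ : ℂ → ℝ} {z : ℂ} (hb : 1 / 4 ≤ α z ^ 2 + β z ^ 2)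
    (hj : ∀ e, dd e φ z = jt α β e z) :
    gsq α β z ≤ dd 1 (pot m α β) z ^ 2 + dd Complex.I (pot m α β) z ^ 2
      + 2 * (dd 1 φ z ^ 2 + dd Complex.I φ z ^ 2) := by
  have hα := h.sα
  have hβ := h.sβ
  have key : ∀ e, dd e α z ^ 2 + dd e β z ^ 2 ≤ dd e (pot m α β) z ^ 2 + 2 * dd e φ z ^ 2 := by
    intro e
    have h1 := jt_eq (α := α) (β := β) (e := e) (z := z) (by linarith)
    rw [← hj] at h1
    have h2 : dd e (pot m α β) z = - (2 * (α z * dd e α z + β z * dd e β z)) := by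
      rw [dd_pot hα hβ]
    have hN2 := h.sq_add_sq_le z
    set N := α z ^ 2 + β z ^ 2 with hN
    have h3 : N * (dd e α z ^ 2 + dd e β z ^ 2)
        = dd e (pot m α β) z ^ 2 / 4 + (N * dd e φ z) ^ 2 := by
      rw [h1, h2, hN]; ring
    have hN0 : 0 < N := by linarith
    refine le_of_mul_le_mul_left ?_ hN0
    rw [h3]
    nlinarith [sq_nonneg (dd e φ z), sq_nonneg (dd e (pot m α β) z),
      mul_nonneg hN0.le (sq_nonneg (dd e φ z)),
      mul_nonneg (sub_nonneg.2 hb) (sq_nonneg (dd e (pot m α β) z)),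
      mul_nonneg (mul_nonneg hN0.le (sub_nonneg.2 hN2)) (sq_nonneg (dd e φ z))]
  have h1 := key 1
  have h2 := key Complex.I
  unfold gsq
  linarith

theorem exists_phase_osc (h : GLSol m α β) {x : ℂ} {R C : ℝ} (hR : 0 < R) (hC : 0 < C)
    (hb : ∀ z ∈ ball x (9 * R), 1 / 4 ≤ α z ^ 2 + β z ^ 2)
    (hE : ∫ z in closedBall x (9 * R), ed m α β z ≤ C) :
    ∃ φ : ℂ → ℝ, ContDiff ℝ ∞ φ ∧ (∀ z ∈ ball x (3 * R), ∀ e, dd e φ z = jt α β e z) ∧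
      ∀ z ∈ closedBall x (R / 2), |φ z| ≤ 7 + 16 * C := by
  have hα := h.sα
  have hβ := h.sβ
  obtain ⟨φ, hφ, hj⟩ := exists_phase hα hβ (x := x) (R := 3 * R) (by linarith)
    (fun z hz => hb z (by convert hz using 2; ring))
  have hs : ∀ z ∈ ball x (3 * R), 1 / 4 ≤ α z ^ 2 + β z ^ 2 := fun z hz =>
    hb z (ball_subset_ball (by linarith) hz)
  have hed := (contDiff_ed (m := m) hα hβ).continuous
  set g : ℂ → ℝ := fun z => dd 1 φ z ^ 2 + dd Complex.I φ z ^ 2 with hg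
  have hgs : ContDiff ℝ ∞ g := by rw [hg]; fun_prop
  have hgi : ∫ z in closedBall x (2 * R), g z ≤ 4 * C := by
    calc ∫ z in closedBall x (2 * R), g z ≤ ∫ z in closedBall x (2 * R), 4 * ed m α β z := by
          refine setIntegral_mono_on (integrableOn_closedBall hgs.continuous _ _)
            (integrableOn_closedBall (by fun_prop) _ _) measurableSet_closedBall fun z hz => ?_
          have hz' : z ∈ ball x (3 * R) := closedBall_subset_ball (by linarith) hz
          have h1 := sq_dd_phase_le (hs z hz') (hj z hz') 1
          have h2 := sq_dd_phase_le (hs z hz') (hj z hz') Complex.I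
          have h3 := gsq_le_ed (m := m) (α := α) (β := β) z
          unfold gsq at h3
          simp only [hg]; linarith
      _ = 4 * ∫ z in closedBall x (2 * R), ed m α β z := integral_const_mul _ _
      _ ≤ 4 * C := by
          gcongr
          exact (setIntegral_mono_ball hed (fun z => ed_nonneg z)
            (closedBall_subset_closedBall (by linarith))).trans hE
  obtain ⟨r, hr, hgr⟩ := exists_good_radius hgs.continuous
    (fun z => by simp only [hg]; positivity) x hR (by linarith : 0 < 4 * C) hgi
  have hr0 : 0 < r := by linarith [hr.1]
  have hosc : ∀ z w, ‖z - x‖ = r → ‖w - x‖ = r → |φ z - φ w| ≤ 7 + 16 * C := fun z w hz hw => by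
    have := abs_sub_le_of_circle hφ hgr hz hw
    have := Real.pi_lt_d2
    linarith
  have hL : ∀ z ∈ ball x r, |Lap φ z| ≤ 192 * (|dd 1 φ z| + |dd Complex.I φ z|) := by
    intro z hz
    have hz' : z ∈ ball x (3 * R) := ball_subset_ball (by linarith [hr.2]) hz
    have h1 := h.Lap_phase hφ hs hj hz'
    have h2 := hs z hz'
    set N := α z ^ 2 + β z ^ 2
    have h3 : |N * Lap φ z| ≤ 48 * |dd 1 φ z| + 48 * |dd Complex.I φ z| := by
      rw [h1]
      exact (abs_add_le _ _).trans (add_le_add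
        (abs_mul_le (h.abs_dd_pot_le (Or.inl rfl) z) le_rfl)
        (abs_mul_le (h.abs_dd_pot_le (Or.inr rfl) z) le_rfl))
    rw [abs_mul, abs_of_pos (by linarith : 0 < N)] at h3
    nlinarith [abs_nonneg (Lap φ z)]
  have hfin := abs_sub_le_of_drift hφ hr0 hL hosc
  refine ⟨fun z => φ z - φ (x + r), by fun_prop, ?_, ?_⟩
  · intro z hz e
    simp (disch := fun_prop) only [dd_sub, dd_const]
    rw [sub_zero, hj z hz]
  · intro z hz
    exact hfin z (closedBall_subset_closedBall hr.1 hz)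

/-- Quantitative gradient estimate at an interior maximum of the scaled gradient. -/
theorem scaled_gradient_step (h : GLSol m α β) {φ : ℂ → ℝ} (hφ : ContDiff ℝ ∞ φ) {y : ℂ}
    {d M κ Ω : ℝ} (hb : ∀ z ∈ ball y d, 1 / 4 ≤ α z ^ 2 + β z ^ 2)
    (hj : ∀ z ∈ ball y d, ∀ e, dd e φ z = jt α β e z)
    (hΩ : ∀ z ∈ closedBall y (d / 2), |φ z| ≤ Ω) (hM : 1 ≤ M) (hMΩ : 256 * Ω ≤ M) (hΩ1 : 1 ≤ Ω)
    (hκ : 0 < κ) (hκ1 : κ * (10 ^ 7 * Ω) ≤ 1) (hd : M ≤ 2 * κ * d)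
    (hg : ∀ z ∈ closedBall y (d / 2), gsq α β z ≤ 4 * (M / d) ^ 2)
    (hgy : gsq α β y = (M / d) ^ 2) : False := by
  have hα := h.sα
  have hβ := h.sβ
  have hκ2 : κ ≤ 1 / 10 ^ 7 := by
    rw [le_div_iff₀ (by norm_num)]; nlinarith
  have hd8 : 16 ≤ d := by
    by_contra! hc
    nlinarith
  have hd0 : 0 < d := by linarith
  set q : ℝ := M / d with hq
  have hq0 : 0 < q := by positivity
  have hqd : q * d = M := by rw [hq]; field_simp
  have hdq : 1 / d ≤ q := by rw [hq]; gcongr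
  have hqκ : q ≤ 2 * κ := by rw [hq, div_le_iff₀ hd0]; exact hd
  have hbc : ∀ z ∈ closedBall y (d / 2), 1 / 4 ≤ α z ^ 2 + β z ^ 2 := fun z hz =>
    hb z (closedBall_subset_ball (by linarith) hz)
  have hpot : ∀ z ∈ closedBall y (d / 4), pot m α β z ≤ 272 * q ^ 2 := by
    intro z hz
    have hsub : closedBall z (d / 4) ⊆ closedBall y (d / 2) := by
      refine closedBall_subset_closedBall' ?_
      rw [mem_closedBall] at hz; linarith
    have := le_of_Lap_ge (f := pot m α β) (x := z) (d := d / 4) (k := 1 / 2) (H := 8 * q ^ 2) (M := 2)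
      (by fun_prop) (by linarith) (by norm_num) (by positivity) (by norm_num)
      (fun w _ => h.pot_le w) (fun w hw _ => by
        rw [h.Lap_pot]
        nlinarith [hg w (hsub hw), hbc w (hsub hw), h.pot_nonneg w])
    have h2 : 4 * 2 / (1 / 2 * (d / 4) ^ 2) = 256 * (1 / d) ^ 2 := by field_simp; norm_num
    rw [h2] at this
    have h3 : (1 / d) ^ 2 ≤ q ^ 2 := pow_le_pow_left₀ (by positivity) hdq 2
    linarith
  have hdpot : ∀ z ∈ closedBall y (d / 8), |dd 1 (pot m α β) z| ≤ 1400 * q ^ 2 ∧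
      |dd Complex.I (pot m α β) z| ≤ 1400 * q ^ 2 := by
    intro z hz
    have hsub : closedBall z (2 * (1 / 2)) ⊆ closedBall y (d / 4) := by
      refine closedBall_subset_closedBall' ?_
      rw [mem_closedBall] at hz; linarith
    have hsub2 : closedBall y (d / 4) ⊆ closedBall y (d / 2) :=
      closedBall_subset_closedBall (by linarith)
    have := GinzburgLandau.abs_dd_le (f := pot m α β) (x := z) (d := 1 / 2) (M := 272 * q ^ 2)
      (N := 1096 * q ^ 2) (by fun_prop) (by norm_num)
      (fun w hw => by rw [abs_of_nonneg (h.pot_nonneg w)]; exact hpot w (hsub hw))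
      (fun w hw => by
        have h1 := hpot w (hsub hw)
        have h2 := hg w (hsub2 (hsub hw))
        have h3 := gsq_nonneg (α := α) (β := β) w
        have h4 := h.pot_nonneg w
        have h5 := h.sq_add_sq_le w
        have h6 : pot m α β w * (α w ^ 2 + β w ^ 2) ≤ 272 * q ^ 2 * 2 :=
          mul_le_mul h1 h5 (by positivity) (by positivity)
        have h7 : 0 ≤ pot m α β w * (α w ^ 2 + β w ^ 2) := mul_nonneg h4 (by positivity)
        rw [h.Lap_pot, abs_le]
        constructor <;> nlinarith)
    have h8 : 2 * (272 * q ^ 2) / (1 / 2) + 1096 * q ^ 2 * (1 / 2) / 2 ≤ 1400 * q ^ 2 := by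
      nlinarith [sq_nonneg q]
    exact ⟨this.1.trans h8, this.2.trans h8⟩
  have hdφ : ∀ z ∈ closedBall y (d / 2), |dd 1 φ z| ≤ 4 * q ∧ |dd Complex.I φ z| ≤ 4 * q := by
    intro z hz
    have hz' : z ∈ ball y d := closedBall_subset_ball (by linarith) hz
    have h1 := sq_dd_phase_le (hb z hz') (hj z hz') 1
    have h2 := sq_dd_phase_le (hb z hz') (hj z hz') Complex.I
    have h3 := hg z hz
    unfold gsq at h3
    constructor <;> refine abs_le_of_sq_le_sq ?_ (by linarith) <;>
      nlinarith [sq_nonneg (dd 1 α z), sq_nonneg (dd 1 β z), sq_nonneg (dd Complex.I α z),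
        sq_nonneg (dd Complex.I β z)]
  have hLφ : ∀ z ∈ closedBall y (d / 8), |Lap φ z| ≤ 44800 * q ^ 3 := by
    intro z hz
    have hz2 : z ∈ closedBall y (d / 2) := closedBall_subset_closedBall (by linarith) hz
    have hz' : z ∈ ball y d := closedBall_subset_ball (by linarith) hz
    have h1 := h.Lap_phase hφ hb hj hz'
    have h2 := hb z hz'
    set N := α z ^ 2 + β z ^ 2
    have h3 : |N * Lap φ z| ≤ 1400 * q ^ 2 * (4 * q) + 1400 * q ^ 2 * (4 * q) := by
      rw [h1]
      exact (abs_add_le _ _).trans (add_le_add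
        (abs_mul_le (hdpot z hz).1 (hdφ z hz2).1) (abs_mul_le (hdpot z hz).2 (hdφ z hz2).2))
    rw [abs_mul, abs_of_pos (by linarith : 0 < N)] at h3
    nlinarith [abs_nonneg (Lap φ z)]
  have hM0 : 0 < M := by linarith
  set ε : ℝ := 16 * Ω / M with hε
  have hε0 : 0 < ε := by positivity
  have hε1 : ε ≤ 1 / 16 := by rw [hε, div_le_iff₀ hM0]; linarith
  have hfin := GinzburgLandau.abs_dd_le (f := φ) (x := y) (d := ε * d) (M := Ω) (N := 44800 * q ^ 3) hφ
    (by positivity)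
    (fun w hw => hΩ w (closedBall_subset_closedBall (by nlinarith) hw))
    (fun w hw => hLφ w (closedBall_subset_closedBall (by nlinarith) hw))
  have hb1 : 2 * Ω / (ε * d) + 44800 * q ^ 3 * (ε * d) / 2 ≤ q / 4 := by
    have e1 : 2 * Ω / (ε * d) = q / 8 := by
      rw [hε, ← hqd]; field_simp; norm_num
    have e2 : ε * d * q = 16 * Ω := by rw [hε, ← hqd]; field_simp
    have e3 : 44800 * q ^ 3 * (ε * d) / 2 = 22400 * 16 * Ω * q ^ 2 := by
      calc _ = 22400 * q ^ 2 * (ε * d * q) := by ring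
        _ = _ := by rw [e2]; ring
    rw [e1, e3]
    have : Ω * q ≤ 2 * (1 / 10 ^ 7) := by
      have : Ω * q ≤ Ω * (2 * κ) := mul_le_mul_of_nonneg_left hqκ (by linarith)
      linarith
    nlinarith
  have hy1 : y ∈ ball y d := mem_ball_self hd0
  have hy2 : y ∈ closedBall y (d / 8) := mem_closedBall_self (by linarith)
  have hmain := h.gsq_le_phase (hb y hy1) (hj y hy1)
  have s1 := pow_le_pow_left₀ (abs_nonneg _) (hfin.1.trans hb1) 2
  have s2 := pow_le_pow_left₀ (abs_nonneg _) (hfin.2.trans hb1) 2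
  have s3 := pow_le_pow_left₀ (abs_nonneg _) (hdpot y hy2).1 2
  have s4 := pow_le_pow_left₀ (abs_nonneg _) (hdpot y hy2).2 2
  rw [sq_abs] at s1 s2 s3 s4
  rw [hgy] at hmain
  have hq2 : q ^ 2 ≤ (2 / 10 ^ 7) ^ 2 := pow_le_pow_left₀ hq0.le (by linarith) 2
  have hq3 : 0 < q ^ 2 := by positivity
  nlinarith

end GLSol

/-- Scale-invariant gradient bound away from zeros. -/
theorem exists_gradient_bound (C₀ : ℝ) (hC₀ : 0 < C₀) :
    ∃ R₁ C : ℝ, 1 ≤ R₁ ∧ 0 < C ∧ ∀ (m : ℝ) (α β : ℂ → ℝ), GLSol m α β → ∀ (x : ℂ) (R : ℝ), R₁ ≤ R →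
      (∀ z ∈ ball x (9 * R), 1 / 4 ≤ α z ^ 2 + β z ^ 2) →
      ∫ z in closedBall x (9 * R), ed m α β z ≤ C₀ →
      ∀ y ∈ closedBall x (R / 4), gsq α β y ≤ C / R ^ 2 := by
  set Ω : ℝ := 7 + 16 * C₀ with hΩ
  have hΩ1 : 1 ≤ Ω := by rw [hΩ]; linarith
  set κ : ℝ := 1 / (10 ^ 7 * Ω) with hκ
  have hκ0 : 0 < κ := by positivity
  obtain ⟨R₅, hR₅, h5⟩ := exists_radius_small_gradient C₀ κ hC₀ hκ0
  refine ⟨R₅, 16 * (256 * Ω) ^ 2, hR₅, by positivity, ?_⟩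
  intro m α β h x R hR hb hE y hy
  have hα := h.sα
  have hβ := h.sβ
  have hR0 : 0 < R := by linarith
  have hed := (contDiff_ed (m := m) hα hβ).continuous
  obtain ⟨φ, hφ, hj, hosc⟩ := h.exists_phase_osc hR0 hC₀ hb hE
  set L : ℝ := R / 2 with hL
  set W : ℂ → ℝ := fun y => (L - ‖y - x‖) ^ 2 * gsq α β y with hW
  have hgc := (contDiff_gsq hα hβ).continuous
  have hWc : Continuous W := by rw [hW]; fun_prop
  obtain ⟨y₀, hy₀, hmax⟩ := (isCompact_closedBall x L).exists_isMaxOn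
    ⟨x, mem_closedBall_self (by linarith)⟩ hWc.continuousOn
  have hsmall : ∀ z ∈ closedBall x L, gsq α β z ≤ 4 * κ ^ 2 := by
    intro z hz
    have hsub : closedBall z R₅ ⊆ closedBall x (9 * R) := by
      refine closedBall_subset_closedBall' ?_
      rw [mem_closedBall] at hz; linarith
    have hi := (setIntegral_mono_ball hed (fun z => ed_nonneg z) hsub).trans hE
    have h1 := h5 m α β h z hi 1 (Or.inl rfl)
    have h2 := h5 m α β h z hi Complex.I (Or.inr rfl)
    have s1 := pow_le_pow_left₀ (abs_nonneg _) h1.1 2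
    have s2 := pow_le_pow_left₀ (abs_nonneg _) h1.2 2
    have s3 := pow_le_pow_left₀ (abs_nonneg _) h2.1 2
    have s4 := pow_le_pow_left₀ (abs_nonneg _) h2.2 2
    rw [sq_abs] at s1 s2 s3 s4
    unfold gsq; linarith
  have hWle : W y₀ ≤ (256 * Ω) ^ 2 := by
    by_contra! hcon
    set M : ℝ := Real.sqrt (W y₀) with hM
    have hWM : M ^ 2 = W y₀ := Real.sq_sqrt (by nlinarith [sq_nonneg (256 * Ω)])
    have hMΩ : 256 * Ω ≤ M := Real.le_sqrt_of_sq_le hcon.le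
    set d : ℝ := L - ‖y₀ - x‖ with hd
    have hd0' : 0 ≤ d := by
      rw [mem_closedBall, dist_eq_norm] at hy₀; linarith
    have hWd : W y₀ = d ^ 2 * gsq α β y₀ := rfl
    have hM1 : 1 ≤ M := by linarith
    have hd0 : 0 < d := by
      rcases hd0'.lt_or_eq with hlt | heq
      · exact hlt
      · rw [hWd, ← heq] at hWM; nlinarith
    have hMd : M ≤ 2 * κ * d := by
      refine le_of_sq_le_sq ?_ (by positivity)
      rw [hWM, hWd]
      nlinarith [hsmall y₀ hy₀, sq_nonneg d]
    have hballL : closedBall y₀ d ⊆ closedBall x L := by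
      refine closedBall_subset_closedBall' ?_
      rw [dist_eq_norm, hd]; linarith
    refine h.scaled_gradient_step hφ (y := y₀) (d := d) (M := M) (κ := κ) (Ω := Ω) ?_ ?_ ?_ hM1 hMΩ hΩ1
      hκ0 (by rw [hκ]; field_simp; exact le_rfl) hMd ?_ ?_
    · intro z hz
      have := hballL (ball_subset_closedBall hz)
      exact hb z (closedBall_subset_ball (by linarith) this)
    · intro z hz
      have := hballL (ball_subset_closedBall hz)
      exact hj z (closedBall_subset_ball (by linarith) this)
    · intro z hz
      exact hosc z (hballL (closedBall_subset_closedBall (by linarith) hz))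
    · intro z hz
      have h1 := hmax (hballL (closedBall_subset_closedBall (by linarith) hz))
      simp only [Set.mem_ofPred_eq] at h1
      rw [← hWM] at h1
      have h2 : d / 2 ≤ L - ‖z - x‖ := by
        rw [mem_closedBall, dist_eq_norm] at hz
        have : ‖z - x‖ ≤ ‖z - y₀‖ + ‖y₀ - x‖ := by
          simpa using norm_add_le (z - y₀) (y₀ - x)
        linarith
      have h3 : (d / 2) ^ 2 * gsq α β z ≤ M ^ 2 :=
        (mul_le_mul_of_nonneg_right (pow_le_pow_left₀ (by linarith) h2 2) (gsq_nonneg z)).trans h1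
      rw [div_pow, mul_div_assoc', le_div_iff₀ (by positivity)]
      linarith
    · rw [div_pow, hWM, hWd]; field_simp
  have h1 := hmax (closedBall_subset_closedBall (show R / 4 ≤ L by linarith) hy)
  simp only [Set.mem_ofPred_eq] at h1
  have h2 : R / 4 ≤ L - ‖y - x‖ := by
    rw [mem_closedBall, dist_eq_norm] at hy; linarith
  have h3 : (R / 4) ^ 2 * gsq α β y ≤ (256 * Ω) ^ 2 :=
    (mul_le_mul_of_nonneg_right (pow_le_pow_left₀ (by linarith) h2 2) (gsq_nonneg y)).trans
      (h1.trans hWle)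
  rw [le_div_iff₀ (by positivity)]
  linarith

end GinzburgLandau

namespace GinzburgLandau

open scoped ContDiff Topology

variable {m : ℝ} {α β : ℂ → ℝ}

theorem abs_dd_le_of_gsq_le {G : ℝ} (hG : 0 ≤ G) {z : ℂ} (h : gsq α β z ≤ G ^ 2) {e : ℂ}
    (he : IsDir e) : |dd e α z| ≤ G ∧ |dd e β z| ≤ G := by
  unfold gsq at h
  rcases he with rfl | rfl <;> constructor <;> refine abs_le_of_sq_le_sq ?_ hG <;>
    nlinarith [sq_nonneg (dd 1 α z), sq_nonneg (dd 1 β z), sq_nonneg (dd Complex.I α z),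
        sq_nonneg (dd Complex.I β z)]

theorem dd_gsq (hα : ContDiff ℝ ∞ α) (hβ : ContDiff ℝ ∞ β) (e z : ℂ) :
    dd e (gsq α β) z = 2 * (dd 1 α z * dd e (dd 1 α) z + dd Complex.I α z * dd e (dd Complex.I α) z +
      dd 1 β z * dd e (dd 1 β) z + dd Complex.I β z * dd e (dd Complex.I β) z) := by
  unfold gsq
  simp (disch := fun_prop) only [dd_add, dd_pow]
  norm_num; ring

/-- Squared norm of the Hessian. -/
def hsq (α β : ℂ → ℝ) (z : ℂ) : ℝ :=
  (dd 1 (dd 1 α) z ^ 2 + dd Complex.I (dd 1 α) z ^ 2 + dd 1 (dd Complex.I α) z ^ 2 +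
    dd Complex.I (dd Complex.I α) z ^ 2) +
  (dd 1 (dd 1 β) z ^ 2 + dd Complex.I (dd 1 β) z ^ 2 + dd 1 (dd Complex.I β) z ^ 2 +
    dd Complex.I (dd Complex.I β) z ^ 2)

theorem hsq_nonneg (z : ℂ) : 0 ≤ hsq α β z := by unfold hsq; positivity

@[fun_prop] theorem contDiff_hsq (hα : ContDiff ℝ ∞ α) (hβ : ContDiff ℝ ∞ β) :
    ContDiff ℝ ∞ (hsq α β) := by unfold hsq; fun_prop

theorem abs_dd_dd_le_of_hsq_le {P : ℝ} (hP : 0 ≤ P) {z : ℂ} (h : hsq α β z ≤ P ^ 2) {e e' : ℂ}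
    (he : IsDir e) (he' : IsDir e') : |dd e' (dd e α) z| ≤ P ∧ |dd e' (dd e β) z| ≤ P := by
  unfold hsq at h
  rcases he with rfl | rfl <;> rcases he' with rfl | rfl <;> constructor <;>
    refine abs_le_of_sq_le_sq ?_ hP <;>
    linarith [sq_nonneg (dd 1 (dd 1 α) z), sq_nonneg (dd Complex.I (dd 1 α) z),
      sq_nonneg (dd 1 (dd Complex.I α) z), sq_nonneg (dd Complex.I (dd Complex.I α) z),
      sq_nonneg (dd 1 (dd 1 β) z), sq_nonneg (dd Complex.I (dd 1 β) z),
      sq_nonneg (dd 1 (dd Complex.I β) z), sq_nonneg (dd Complex.I (dd Complex.I β) z)]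

namespace GLSol

theorem Lap_dd_pot (h : GLSol m α β) (e z : ℂ) : Lap (dd e (pot m α β)) z =
    (2 * (α z ^ 2 + β z ^ 2) - 2 * pot m α β z) * dd e (pot m α β) z - 2 * dd e (gsq α β) z := by
  have hα := h.sα
  have hβ := h.sβ
  have e1 : Lap (pot m α β) = fun z => 2 * m * pot m α β z - 2 * pot m α β z ^ 2 - 2 * gsq α β z := by
    funext z
    rw [h.Lap_pot]; unfold pot; ring
  rw [GinzburgLandau.Lap_dd (by fun_prop), e1]
  simp (disch := fun_prop) only [dd_sub, dd_mul, dd_pow, dd_const]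
  unfold pot
  norm_num; ring

theorem abs_dd_pot_le_of (h : GLSol m α β) {y : ℂ} {r G P : ℝ} (hr : 0 < r) (hG : 0 ≤ G)
    (hP : 0 ≤ P) (hb : ∀ z ∈ closedBall y r, 1 / 4 ≤ α z ^ 2 + β z ^ 2)
    (hg : ∀ z ∈ closedBall y r, gsq α β z ≤ G ^ 2) (hp : ∀ z ∈ closedBall y r, pot m α β z ≤ 1 / 16)
    (hD : ∀ z ∈ closedBall y r, hsq α β z ≤ P ^ 2) {e : ℂ} (he : IsDir e) :
    |dd e (pot m α β) y| ≤ 64 * G * P + 128 * G / r ^ 2 := by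
  have hα := h.sα
  have hβ := h.sβ
  have hgs : ∀ z ∈ closedBall y r, |2 * dd e (gsq α β) z| ≤ 16 * G * P := by
    intro z hz
    have a1 := abs_dd_le_of_gsq_le hG (hg z hz) (Or.inl rfl)
    have a2 := abs_dd_le_of_gsq_le hG (hg z hz) (Or.inr rfl)
    have b1 := abs_dd_dd_le_of_hsq_le hP (hD z hz) (Or.inl rfl) he
    have b2 := abs_dd_dd_le_of_hsq_le hP (hD z hz) (Or.inr rfl) he
    have c1 := abs_le.1 (abs_mul_le a1.1 b1.1)
    have c2 := abs_le.1 (abs_mul_le a1.2 b1.2)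
    have c3 := abs_le.1 (abs_mul_le a2.1 b2.1)
    have c4 := abs_le.1 (abs_mul_le a2.2 b2.2)
    rw [dd_gsq hα hβ, abs_le]
    constructor <;> linarith
  have hM : ∀ z ∈ closedBall y r, |dd e (pot m α β) z| ≤ 8 * G := by
    intro z hz
    have a := abs_dd_le_of_gsq_le hG (hg z hz) he
    have c1 := abs_le.1 (abs_mul_le (h.abs_le_two z).1 a.1)
    have c2 := abs_le.1 (abs_mul_le (h.abs_le_two z).2 a.2)
    rw [dd_pot hα hβ, abs_le]
    constructor <;> linarith
  have key : 16 * G * P / (1 / 4) + 4 * (8 * G) / (1 / 4 * r ^ 2) = 64 * G * P + 128 * G / r ^ 2 := by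
    field_simp; ring
  have h1 := le_of_Lap_ge (f := dd e (pot m α β)) (x := y) (d := r) (k := 1 / 4) (H := 16 * G * P)
    (M := 8 * G) (by fun_prop) hr (by norm_num) (by positivity) (by positivity)
    (fun z hz => (le_abs_self _).trans (hM z hz)) (fun z hz hpos => by
      have := (abs_le.1 (hgs z hz)).2
      have h2 := hb z hz
      have h3 := hp z hz
      rw [h.Lap_dd_pot]
      nlinarith)
  have h2 := le_of_Lap_ge (f := fun z => - dd e (pot m α β) z) (x := y) (d := r) (k := 1 / 4)
    (H := 16 * G * P)
    (M := 8 * G) (by fun_prop) hr (by norm_num) (by positivity) (by positivity)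
    (fun z hz => (neg_le_abs _).trans (hM z hz)) (fun z hz hpos => by
      have := (abs_le.1 (hgs z hz)).1
      have h2 := hb z hz
      have h3 := hp z hz
      rw [Lap_neg, h.Lap_dd_pot]
      nlinarith)
  rw [key] at h1 h2
  exact abs_le'.2 ⟨h1, h2⟩

theorem pot_le_of (h : GLSol m α β) {y : ℂ} {r G : ℝ} (hr : 0 < r)
    (hb : ∀ z ∈ closedBall y r, 1 / 4 ≤ α z ^ 2 + β z ^ 2)
    (hg : ∀ z ∈ closedBall y r, gsq α β z ≤ G ^ 2) : pot m α β y ≤ 4 * G ^ 2 + 16 / r ^ 2 := by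
  have hα := h.sα
  have hβ := h.sβ
  have := le_of_Lap_ge (f := pot m α β) (x := y) (d := r) (k := 1 / 2) (H := 2 * G ^ 2) (M := 2)
      (by fun_prop) hr (by norm_num) (by positivity) (by norm_num)
      (fun w _ => h.pot_le w) (fun w hw _ => by
        rw [h.Lap_pot]
        nlinarith [hg w hw, hb w hw, h.pot_nonneg w])
  refine this.trans (le_of_eq ?_)
  field_simp; ring

/-- One step of the Hessian estimate around a point where the scaled Hessian is almost maximal. -/
theorem hessian_step (h : GLSol m α β) {y : ℂ} {d A M : ℝ} (hd : 1 ≤ d) (hA : 1 ≤ A) (hM : 1 ≤ M)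
    (hb : ∀ z ∈ closedBall y (d / 2), 1 / 4 ≤ α z ^ 2 + β z ^ 2)
    (hg : ∀ z ∈ closedBall y (d / 2), gsq α β z ≤ (A / d) ^ 2)
    (hp : ∀ z ∈ closedBall y (d / 2), pot m α β z ≤ 1 / 16)
    (hp2 : ∀ z ∈ closedBall y (d / 2), pot m α β z ≤ (A / d) ^ 2)
    (hD : ∀ z ∈ closedBall y (d / 2), hsq α β z ≤ (4 * M / d ^ 2) ^ 2)
    (hDy : hsq α β y = (M / d ^ 2) ^ 2) : M ≤ 10 ^ 7 * A ^ 4 := by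
  have hα := h.sα
  have hβ := h.sβ
  have hd0 : 0 < d := by linarith
  have hdp : ∀ z ∈ closedBall y (d / 4), ∀ e, IsDir e →
      |dd e (pot m α β) z| ≤ 2304 * A * M / d ^ 3 := by
    intro z hz e he
    have hsub : closedBall z (d / 4) ⊆ closedBall y (d / 2) := by
      refine closedBall_subset_closedBall' ?_
      rw [mem_closedBall] at hz; linarith
    refine (h.abs_dd_pot_le_of (y := z) (r := d / 4) (G := A / d) (P := 4 * M / d ^ 2) (by positivity)
      (by positivity) (by positivity) (fun w hw => hb w (hsub hw)) (fun w hw => hg w (hsub hw))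
      (fun w hw => hp w (hsub hw)) (fun w hw => hD w (hsub hw)) he).trans ?_
    have : 64 * (A / d) * (4 * M / d ^ 2) + 128 * (A / d) / (d / 4) ^ 2 =
      (256 * A * M + 2048 * A) / d ^ 3 := by field_simp; ring
    rw [this]
    gcongr
    nlinarith
  set B : ℝ := 5000 * A ^ 3 with hB
  have hA2 : 1 ≤ A ^ 2 := one_le_pow₀ hA
  have hA3 : A ≤ A ^ 3 := by nlinarith
  have hAA : A ≤ A ^ 2 := by nlinarith
  have hL : ∀ z ∈ closedBall y (d / 4), ∀ e, IsDir e →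
      |Lap (dd e α) z| ≤ B * M / d ^ 3 ∧ |Lap (dd e β) z| ≤ B * M / d ^ 3 := by
    intro z hz e he
    have hz2 : z ∈ closedBall y (d / 2) := closedBall_subset_closedBall (by linarith) hz
    have a := abs_dd_le_of_gsq_le (by positivity) (hg z hz2) he
    have p1 : |pot m α β z| ≤ (A / d) ^ 2 := by
      rw [abs_of_nonneg (h.pot_nonneg z)]; exact hp2 z hz2
    have b := hdp z hz e he
    have c1 := abs_mul_le b (h.abs_le_two z).1
    have c2 := abs_mul_le b (h.abs_le_two z).2
    have c3 := abs_mul_le p1 a.1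
    have c4 := abs_mul_le p1 a.2
    have e1 : 2304 * A * M / d ^ 3 * 2 + (A / d) ^ 2 * (A / d) ≤ B * M / d ^ 3 := by
      have : 2304 * A * M / d ^ 3 * 2 + (A / d) ^ 2 * (A / d) = (4608 * A * M + A ^ 3) / d ^ 3 := by
        field_simp; ring
      rw [this]
      gcongr
      nlinarith
    rw [(h.Lap_dd e z).1, (h.Lap_dd e z).2, abs_neg, abs_neg]
    exact ⟨(abs_add_le _ _).trans ((add_le_add c1 c3).trans e1),
      (abs_add_le _ _).trans ((add_le_add c2 c4).trans e1)⟩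
  set ε : ℝ := 1 / (8 * B) with hε
  have hB1 : 5000 ≤ B := by rw [hB]; nlinarith
  have hε0 : 0 < ε := by positivity
  have hε1 : ε ≤ 1 / 8 := by
    rw [hε]; gcongr; linarith
  have hBε : B * ε = 1 / 8 := by rw [hε]; field_simp
  set Q : ℝ := (16 * A * B + M / 16) / d ^ 2 with hQ
  have hfin : ∀ e, IsDir e → ∀ e', IsDir e' → |dd e' (dd e α) y| ≤ Q ∧ |dd e' (dd e β) y| ≤ Q := by
    intro e he e' he'
    have hz2 : ∀ w ∈ closedBall y (2 * (ε * d)), w ∈ closedBall y (d / 2) := fun w hw =>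
      closedBall_subset_closedBall (by nlinarith) hw
    have hz4 : ∀ w ∈ closedBall y (2 * (ε * d)), w ∈ closedBall y (d / 4) := fun w hw =>
      closedBall_subset_closedBall (by nlinarith) hw
    have e1 : 2 * (A / d) / (ε * d) + B * M / d ^ 3 * (ε * d) / 2 = Q := by
      have : B * M / d ^ 3 * (ε * d) / 2 = (B * ε) * (M / d ^ 2 / 2) := by field_simp
      rw [this, hBε, hQ, hε]
      field_simp; ring
    have f1 := GinzburgLandau.abs_dd_le (f := dd e α) (x := y) (d := ε * d) (M := A / d)
      (N := B * M / d ^ 3) (by fun_prop) (by positivity)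
      (fun w hw => (abs_dd_le_of_gsq_le (by positivity) (hg w (hz2 w hw)) he).1)
      (fun w hw => (hL w (hz4 w hw) e he).1)
    have f2 := GinzburgLandau.abs_dd_le (f := dd e β) (x := y) (d := ε * d) (M := A / d)
      (N := B * M / d ^ 3) (by fun_prop) (by positivity)
      (fun w hw => (abs_dd_le_of_gsq_le (by positivity) (hg w (hz2 w hw)) he).2)
      (fun w hw => (hL w (hz4 w hw) e he).2)
    rw [e1] at f1 f2
    rcases he' with rfl | rfl
    exacts [⟨f1.1, f2.1⟩, ⟨f1.2, f2.2⟩]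
  have sq : ∀ {t : ℝ}, |t| ≤ Q → t ^ 2 ≤ Q ^ 2 := fun {t} ht => by
    have := pow_le_pow_left₀ (abs_nonneg _) ht 2
    rwa [sq_abs] at this
  have i1 : IsDir 1 := Or.inl rfl
  have iI : IsDir Complex.I := Or.inr rfl
  have hsum : (M / d ^ 2) ^ 2 ≤ 9 * Q ^ 2 := by
    rw [← hDy]
    unfold hsq
    linarith [sq (hfin 1 i1 1 i1).1, sq (hfin 1 i1 1 i1).2, sq (hfin 1 i1 _ iI).1,
      sq (hfin 1 i1 _ iI).2, sq (hfin _ iI 1 i1).1, sq (hfin _ iI 1 i1).2,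
      sq (hfin _ iI _ iI).1, sq (hfin _ iI _ iI).2, sq_nonneg Q]
  have hQ0 : 0 ≤ Q := by positivity
  have : M / d ^ 2 ≤ 3 * Q := by
    refine le_of_sq_le_sq ?_ (by positivity)
    linarith
  rw [hQ, mul_div_assoc', div_le_div_iff_of_pos_right (by positivity)] at this
  have : M ≤ 96 * A * B := by linarith
  rw [hB] at this
  nlinarith [pow_pos (by linarith : 0 < A) 4]

end GLSol

/-- Decay estimates for a Ginzburg-Landau solution of bounded energy on a large ball without
bad points. -/
theorem exists_local_decay (C₀ : ℝ) (hC₀ : 0 < C₀) :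
    ∃ R₁ C : ℝ, 1 ≤ R₁ ∧ 0 < C ∧ ∀ (m : ℝ) (α β : ℂ → ℝ), GLSol m α β → ∀ (x : ℂ) (R : ℝ), R₁ ≤ R →
      (∀ z ∈ ball x (9 * R), 1 / 4 ≤ α z ^ 2 + β z ^ 2) →
      ∫ z in closedBall x (9 * R), ed m α β z ≤ C₀ →
      gsq α β x ≤ C / R ^ 2 ∧ pot m α β x ≤ C / R ^ 2 ∧
        ∀ e, IsDir e → |dd e (pot m α β) x| ≤ C / R ^ 3 := by
  obtain ⟨R₂, C₂, hR₂, hC₂, h2⟩ := exists_gradient_bound C₀ hC₀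
  set A : ℝ := 40 + 4 * C₂ with hA
  have hA1 : 1 ≤ A := by linarith
  set M₁ : ℝ := 10 ^ 7 * A ^ 4 with hM₁
  have hM₁1 : 1 ≤ M₁ := by
    have : 1 ≤ A ^ 4 := one_le_pow₀ hA1
    linarith
  refine ⟨max R₂ (4 * A), 10 ^ 7 * (A ^ 2 + A * M₁), le_max_of_le_left hR₂, by positivity, ?_⟩
  intro m α β h x R hR hb hE
  have hα := h.sα
  have hβ := h.sβ
  have hRA : 4 * A ≤ R := (le_max_right _ _).trans hR
  have hR0 : 0 < R := by linarith
  have hg := h2 m α β h x R ((le_max_left _ _).trans hR) hb hE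
  have hbb : ∀ z ∈ closedBall x R, 1 / 4 ≤ α z ^ 2 + β z ^ 2 := fun z hz =>
    hb z (closedBall_subset_ball (by linarith) hz)
  have hgA : ∀ z ∈ closedBall x (R / 4), gsq α β z ≤ (A / R) ^ 2 := by
    intro z hz
    refine (hg z hz).trans ?_
    rw [div_pow]; gcongr; nlinarith
  set L : ℝ := R / 8 with hL
  have hpA : ∀ z ∈ closedBall x L, pot m α β z ≤ (A / R) ^ 2 := by
    intro z hz
    have hsub : closedBall z L ⊆ closedBall x (R / 4) := by
      refine closedBall_subset_closedBall' ?_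
      rw [mem_closedBall] at hz; linarith
    have hsub2 : closedBall x (R / 4) ⊆ closedBall x R := closedBall_subset_closedBall (by linarith)
    have := h.pot_le_of (y := z) (r := L) (G := Real.sqrt (C₂) / R) (by positivity)
      (fun w hw => hbb w (hsub2 (hsub hw))) (fun w hw => by
        rw [div_pow, Real.sq_sqrt hC₂.le]; exact hg w (hsub hw))
    refine this.trans ?_
    rw [div_pow, Real.sq_sqrt hC₂.le]
    have : 4 * (C₂ / R ^ 2) + 16 / L ^ 2 = (4 * C₂ + 1024) / R ^ 2 := by
      rw [hL]; field_simp; ring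
    rw [this, div_pow]
    gcongr; nlinarith
  have hp16 : ∀ z ∈ closedBall x L, pot m α β z ≤ 1 / 16 := by
    intro z hz
    refine (hpA z hz).trans ?_
    have : A / R ≤ 1 / 4 := by rw [div_le_iff₀ hR0]; linarith
    have := pow_le_pow_left₀ (by positivity) this 2
    linarith
  set W : ℂ → ℝ := fun y => (L - ‖y - x‖) ^ 4 * hsq α β y with hW
  have hhc := (contDiff_hsq hα hβ).continuous
  have hWc : Continuous W := by rw [hW]; fun_prop
  obtain ⟨y₀, hy₀, hmax⟩ := (isCompact_closedBall x L).exists_isMaxOn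
    ⟨x, mem_closedBall_self (by positivity)⟩ hWc.continuousOn
  set d : ℝ := L - ‖y₀ - x‖ with hd
  have hd0' : 0 ≤ d := by
    rw [mem_closedBall, dist_eq_norm] at hy₀; linarith
  have hWd : W y₀ = d ^ 4 * hsq α β y₀ := rfl
  have hnn : ∀ z, 0 ≤ hsq α β z := fun z => hsq_nonneg z
  have hbig : ∀ z, hsq α β z ≤ (200 : ℝ) ^ 2 := by
    intro z
    have i1 : IsDir 1 := Or.inl rfl
    have iI : IsDir Complex.I := Or.inr rfl
    have sq : ∀ {t : ℝ}, |t| ≤ 66 → t ^ 2 ≤ 66 ^ 2 := fun {t} ht => by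
      have := pow_le_pow_left₀ (abs_nonneg _) ht 2
      rwa [sq_abs] at this
    unfold hsq
    linarith [sq (h.abs_dd_dd_le i1 i1 z).1, sq (h.abs_dd_dd_le i1 i1 z).2,
      sq (h.abs_dd_dd_le i1 iI z).1, sq (h.abs_dd_dd_le i1 iI z).2,
      sq (h.abs_dd_dd_le iI i1 z).1, sq (h.abs_dd_dd_le iI i1 z).2,
      sq (h.abs_dd_dd_le iI iI z).1, sq (h.abs_dd_dd_le iI iI z).2]
  have hWle : W y₀ ≤ M₁ ^ 2 := by
    by_contra! hcon
    set M : ℝ := Real.sqrt (W y₀) with hM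
    have hWM : M ^ 2 = W y₀ := Real.sq_sqrt (by nlinarith)
    have hMM : M₁ < M := Real.lt_sqrt_of_sq_lt hcon
    have hd1 : 1 ≤ d := by
      by_contra! hlt
      have h4 : d ^ 4 ≤ 1 := pow_le_one₀ hd0' hlt.le
      have : W y₀ ≤ 200 ^ 2 := by
        rw [hWd]; nlinarith [hbig y₀, hnn y₀]
      have h5 : (200 : ℝ) ≤ M₁ := by
        have : 1 ≤ A ^ 4 := one_le_pow₀ hA1
        linarith
      nlinarith
    have hd0 : 0 < d := by linarith
    have hdR : d ≤ R := by
      have := norm_nonneg (y₀ - x)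
      linarith
    have hball : closedBall y₀ (d / 2) ⊆ closedBall x L := by
      refine closedBall_subset_closedBall' ?_
      rw [dist_eq_norm]; linarith
    have hAdR : (A / R) ^ 2 ≤ (A / d) ^ 2 := by gcongr
    have := h.hessian_step (y := y₀) (d := d) (A := A) (M := M) hd1 hA1 (by linarith)
      (fun z hz => hbb z (closedBall_subset_closedBall (by linarith) (hball hz)))
      (fun z hz => (hgA z (closedBall_subset_closedBall (by linarith) (hball hz))).trans hAdR)
      (fun z hz => hp16 z (hball hz)) (fun z hz => (hpA z (hball hz)).trans hAdR)
      (fun z hz => by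
        have h1 := hmax (hball hz)
        simp only [Set.mem_ofPred_eq] at h1
        rw [← hWM] at h1
        have h2 : d / 2 ≤ L - ‖z - x‖ := by
          rw [mem_closedBall, dist_eq_norm] at hz
          have : ‖z - x‖ ≤ ‖z - y₀‖ + ‖y₀ - x‖ := by
            simpa using norm_add_le (z - y₀) (y₀ - x)
          linarith
        have h3 : (d / 2) ^ 4 * hsq α β z ≤ M ^ 2 :=
          (mul_le_mul_of_nonneg_right (pow_le_pow_left₀ (by linarith) h2 4) (hnn z)).trans h1
        rw [div_pow, le_div_iff₀ (by positivity)]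
        linarith)
      (by rw [div_pow, hWM, hWd]; field_simp)
    linarith
  have hxL : ∀ z ∈ closedBall x (L / 2), hsq α β z ≤ (M₁ / (L / 2) ^ 2) ^ 2 := by
    intro z hz
    have h1 := hmax (closedBall_subset_closedBall (show L / 2 ≤ L by linarith) hz)
    simp only [Set.mem_ofPred_eq] at h1
    have h2 : L / 2 ≤ L - ‖z - x‖ := by
      rw [mem_closedBall, dist_eq_norm] at hz; linarith
    have h3 : (L / 2) ^ 4 * hsq α β z ≤ M₁ ^ 2 :=
      (mul_le_mul_of_nonneg_right (pow_le_pow_left₀ (by positivity) h2 4) (hnn z)).trans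
        (h1.trans hWle)
    rw [div_pow, le_div_iff₀ (by positivity)]
    linarith
  have hx0 : x ∈ closedBall x L := mem_closedBall_self (by positivity)
  have hx1 : x ∈ closedBall x (R / 4) := mem_closedBall_self (by positivity)
  have hle : (A / R) ^ 2 ≤ 10 ^ 7 * (A ^ 2 + A * M₁) / R ^ 2 := by
    rw [div_pow]; gcongr
    nlinarith [mul_pos (by linarith : 0 < A) (by linarith : 0 < M₁)]
  refine ⟨(hgA x hx1).trans hle, (hpA x hx0).trans hle, fun e he => ?_⟩
  have hs : closedBall x (L / 2) ⊆ closedBall x L := closedBall_subset_closedBall (by linarith)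
  refine (h.abs_dd_pot_le_of (y := x) (r := L / 2) (G := A / R) (P := M₁ / (L / 2) ^ 2) (by positivity)
    (by positivity) (by positivity)
    (fun z hz => hbb z (closedBall_subset_closedBall (by linarith) (hs hz)))
    (fun z hz => hgA z (closedBall_subset_closedBall (by linarith) (hs hz)))
    (fun z hz => hp16 z (hs hz)) hxL he).trans ?_
  have : 64 * (A / R) * (M₁ / (L / 2) ^ 2) + 128 * (A / R) / (L / 2) ^ 2 =
      (16384 * A * M₁ + 32768 * A) / R ^ 3 := by
    rw [hL]; field_simp; ring
  rw [this]
  gcongr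
  nlinarith [mul_pos (by linarith : 0 < A) (by linarith : 0 < M₁)]

end GinzburgLandau

namespace GinzburgLandau

open scoped ContDiff Topology

variable {m : ℝ} {α β : ℂ → ℝ}

theorem setIntegral_radial_eq_polar {g : ℂ → ℝ} (hg : Continuous g) (x : ℂ) {I : Set ℝ} {b : ℝ}
    (hI : MeasurableSet I) (hIb : I ⊆ Set.Iic b) :
    ∫ z in {z | ‖z - x‖ ∈ I}, g z =
      ∫ r in I ∩ Set.Ioi 0, r * ∫ θ in (-Real.pi)..Real.pi, g (pol x r θ) := by
  have hA : MeasurableSet {z : ℂ | ‖z - x‖ ∈ I} :=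
    (continuous_norm.comp (continuous_sub_right x)).measurable hI
  rw [← integral_indicator hA]
  set G : ℂ → ℝ := {z : ℂ | ‖z - x‖ ∈ I}.indicator g with hG
  have h1 : ∫ z, G z = ∫ z, G (x + z) := (integral_add_left_eq_self G x).symm
  rw [h1, ← Complex.integral_comp_polarCoord_symm (fun z => G (x + z)), polarCoord_target]
  have h2 : ∀ p : ℝ × ℝ, p.1 • G (x + Complex.polarCoord.symm p) = p.1 * G (pol x p.1 p.2) := by
    intro p
    have : x + Complex.polarCoord.symm p = pol x p.1 p.2 := by
      rw [Complex.polarCoord_symm_apply, pol, Complex.exp_mul_I]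
      push_cast; ring
    rw [this, smul_eq_mul]
  simp_rw [h2]
  have hcont : Continuous fun p : ℝ × ℝ => p.1 * g (pol x p.1 p.2) :=
    continuous_fst.mul (hg.comp (continuous_pol x))
  have h3 : ∫ p in Set.Ioi (0 : ℝ) ×ˢ Set.Ioo (-Real.pi) Real.pi, p.1 * G (pol x p.1 p.2)
      = ∫ p in (I ∩ Set.Ioi 0) ×ˢ Set.Ioc (-Real.pi) Real.pi, p.1 * G (pol x p.1 p.2) := by
    rw [Measure.volume_eq_prod, ← Measure.prod_restrict, ← Measure.prod_restrict,
      ← Measure.restrict_congr_set (Ioo_ae_eq_Ioc (μ := volume) (a := -Real.pi) (b := Real.pi)),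
      Measure.prod_restrict, Measure.prod_restrict]
    refine setIntegral_eq_of_subset_of_forall_sdiff_eq_zero
      ((measurableSet_Ioi (a := (0 : ℝ))).prod
      (measurableSet_Ioo (a := -Real.pi) (b := Real.pi)))
      (Set.prod_mono Set.inter_subset_right le_rfl) ?_
    rintro ⟨r, θ⟩ ⟨⟨hr, hθ⟩, hp⟩
    have hr' : r ∉ I := fun hle => hp ⟨⟨hle, hr⟩, hθ⟩
    have : G (pol x r θ) = 0 := by
      refine Set.indicator_of_notMem ?_ _
      simpa [norm_pol_sub, abs_of_pos (Set.mem_Ioi.1 hr)] using hr'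
    rw [this, mul_zero]
  have hm : MeasurableSet ((I ∩ Set.Ioi 0) ×ˢ Set.Ioc (-Real.pi) Real.pi) :=
    (hI.inter measurableSet_Ioi).prod measurableSet_Ioc
  have h4 : ∫ p in (I ∩ Set.Ioi 0) ×ˢ Set.Ioc (-Real.pi) Real.pi, p.1 * G (pol x p.1 p.2) =
      ∫ p in (I ∩ Set.Ioi 0) ×ˢ Set.Ioc (-Real.pi) Real.pi, p.1 * g (pol x p.1 p.2) := by
    refine setIntegral_congr_fun hm ?_
    rintro ⟨r, θ⟩ ⟨⟨hr, hr0⟩, hθ⟩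
    have : G (pol x r θ) = g (pol x r θ) := by
      refine Set.indicator_of_mem ?_ _
      simpa [norm_pol_sub, abs_of_pos (Set.mem_Ioi.1 hr0)] using hr
    simp only [this]
  rw [h3, h4, Measure.volume_eq_prod, setIntegral_prod]
  · refine setIntegral_congr_fun (hI.inter measurableSet_Ioi) fun r _ => ?_
    simp only
    rw [integral_const_mul, intervalIntegral.integral_of_le (by linarith [Real.pi_pos])]
  · rw [← Measure.volume_eq_prod]
    exact (hcont.continuousOn.integrableOn_compact
      ((isCompact_Icc (a := (0 : ℝ)) (b := b)).prod
        (isCompact_Icc (a := -Real.pi) (b := Real.pi)))).mono_set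
      (Set.prod_mono (fun r hr => ⟨(Set.mem_Ioi.1 hr.2).le, hIb hr.1⟩) Set.Ioc_subset_Icc_self)

theorem setIntegral_annulus_eq_polar {g : ℂ → ℝ} (hg : Continuous g) (x : ℂ) {a b : ℝ}
    (ha : 0 ≤ a) (hab : a ≤ b) :
    ∫ z in ball x b \ closedBall x a, g z =
      ∫ r in a..b, r * ∫ θ in (-Real.pi)..Real.pi, g (pol x r θ) := by
  have h1 : ball x b \ closedBall x a = {z : ℂ | ‖z - x‖ ∈ Set.Ioo a b} := by
    ext z; simp [dist_eq_norm, and_comm]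
  have h2 : Set.Ioo a b ∩ Set.Ioi 0 = Set.Ioo a b :=
    Set.inter_eq_left.2 fun r hr => ha.trans_lt hr.1
  rw [h1, setIntegral_radial_eq_polar hg x measurableSet_Ioo (b := b) fun r hr => hr.2.le, h2,
    intervalIntegral.integral_of_le hab, integral_Ioc_eq_integral_Ioo]

theorem setIntegral_closedBall_eq_polar {g : ℂ → ℝ} (hg : Continuous g) (x : ℂ) {b : ℝ}
    (hb : 0 ≤ b) :
    ∫ z in closedBall x b, g z =
      ∫ r in (0 : ℝ)..b, r * ∫ θ in (-Real.pi)..Real.pi, g (pol x r θ) := by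
  have h1 : closedBall x b = {z : ℂ | ‖z - x‖ ∈ Set.Iic b} := by
    ext z; simp [dist_eq_norm]
  have h2 : Set.Iic b ∩ Set.Ioi 0 = Set.Ioc 0 b := by
    ext r; simp [and_comm]
  rw [h1, setIntegral_radial_eq_polar hg x measurableSet_Iic le_rfl, h2,
    intervalIntegral.integral_of_le hb]

/-- Circulation of the vector field `(P, Q)` along the circle of radius `r` around `x`. -/
def circ (P Q : ℂ → ℝ) (x : ℂ) (r : ℝ) : ℝ :=
  ∫ θ in (-Real.pi)..Real.pi, r * (-Real.sin θ * P (pol x r θ) + Real.cos θ * Q (pol x r θ))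

theorem contDiff_pol (x : ℂ) : ContDiff ℝ ∞ fun p : ℝ × ℝ => pol x p.1 p.2 := by
  unfold pol
  have h1 : ContDiff ℝ ∞ fun p : ℝ × ℝ => (p.1 : ℂ) := Complex.ofRealCLM.contDiff.comp contDiff_fst
  have h2 : ContDiff ℝ ∞ fun p : ℝ × ℝ => (p.2 : ℂ) := Complex.ofRealCLM.contDiff.comp contDiff_snd
  fun_prop

theorem hasDerivAt_comp_pol_left {f : ℂ → ℝ} (hf : ContDiff ℝ ∞ f) (x : ℂ) (r θ : ℝ) :
    HasDerivAt (fun s => f (pol x s θ))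
      (Real.cos θ * dd 1 f (pol x r θ) + Real.sin θ * dd Complex.I f (pol x r θ)) r := by
  have h1 : HasDerivAt (fun s : ℝ => pol x s θ) (Complex.exp (θ * Complex.I)) r := by
    unfold pol
    have := (Complex.ofRealCLM.hasDerivAt (x := r)).mul_const (Complex.exp (θ * Complex.I))
    simpa using this.const_add x
  have h2 := ((differentiable_of_smooth hf) (pol x r θ)).hasFDerivAt.comp_hasDerivAt r h1
  rw [fderiv_apply_eq] at h2
  exact h2.congr_deriv (by simp [Complex.exp_re, Complex.exp_im])

theorem hasDerivAt_comp_pol_right {f : ℂ → ℝ} (hf : ContDiff ℝ ∞ f) (x : ℂ) (r θ : ℝ) :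
    HasDerivAt (fun s => f (pol x r s))
      (-(r * Real.sin θ) * dd 1 f (pol x r θ) + r * Real.cos θ * dd Complex.I f (pol x r θ)) θ := by
  have h2 := ((differentiable_of_smooth hf) (pol x r θ)).hasFDerivAt.comp_hasDerivAt θ
    (hasDerivAt_pol x r θ)
  rw [fderiv_apply_eq] at h2
  exact h2.congr_deriv (by
    simp only [Complex.add_re, Complex.ofReal_re, Complex.mul_I_re, Complex.ofReal_im,
      Complex.add_im, Complex.mul_I_im, neg_zero, add_zero, zero_add])

/-- Green's theorem on a disc. -/
theorem setIntegral_curl_eq_circ {P Q : ℂ → ℝ} (hP : ContDiff ℝ ∞ P) (hQ : ContDiff ℝ ∞ Q) (x : ℂ)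
    {R : ℝ} (hR : 0 ≤ R) :
    ∫ z in closedBall x R, (dd 1 Q z - dd Complex.I P z) = circ P Q x R := by
  have hpol := contDiff_pol x
  set f : ℝ × ℝ → ℝ := fun p => p.1 * (-Real.sin p.2 * P (pol x p.1 p.2) +
    Real.cos p.2 * Q (pol x p.1 p.2)) with hf
  set g : ℝ × ℝ → ℝ := fun p => -(Real.cos p.2 * P (pol x p.1 p.2) +
    Real.sin p.2 * Q (pol x p.1 p.2)) with hg
  have hfs : ContDiff ℝ ∞ f := by
    have := hP.comp hpol
    have := hQ.comp hpol
    simp only [Function.comp_def] at *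
    fun_prop
  have hgs : ContDiff ℝ ∞ g := by
    have := hP.comp hpol
    have := hQ.comp hpol
    simp only [Function.comp_def] at *
    fun_prop
  have hdf : ∀ p, HasFDerivAt f (fderiv ℝ f p) p := fun p =>
    ((hfs.differentiable (by simp)) p).hasFDerivAt
  have hdg : ∀ p, HasFDerivAt g (fderiv ℝ g p) p := fun p =>
    ((hgs.differentiable (by simp)) p).hasFDerivAt
  have key : ∀ r θ : ℝ, fderiv ℝ f (r, θ) (1, 0) + fderiv ℝ g (r, θ) (0, 1) =
      r * (dd 1 Q (pol x r θ) - dd Complex.I P (pol x r θ)) := by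
    intro r θ
    have l1 : HasDerivAt (fun s : ℝ => (s, θ)) ((1 : ℝ), (0 : ℝ)) r :=
      (hasDerivAt_id r).prodMk (hasDerivAt_const r θ)
    have l2 : HasDerivAt (fun s : ℝ => (r, s)) ((0 : ℝ), (1 : ℝ)) θ :=
      (hasDerivAt_const θ r).prodMk (hasDerivAt_id θ)
    have e1 := (hdf (r, θ)).comp_hasDerivAt r l1
    have e2 := (hdg (r, θ)).comp_hasDerivAt θ l2
    have d1 := (hasDerivAt_id r).mul (((hasDerivAt_comp_pol_left hP x r θ).const_mul (-Real.sin θ)).add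
      ((hasDerivAt_comp_pol_left hQ x r θ).const_mul (Real.cos θ)))
    have d2 := (((Real.hasDerivAt_cos θ).mul (hasDerivAt_comp_pol_right hP x r θ)).add
      ((Real.hasDerivAt_sin θ).mul (hasDerivAt_comp_pol_right hQ x r θ))).neg
    have u1 := e1.unique d1
    have u2 := e2.unique d2
    rw [u1, u2]
    have := Real.sin_sq_add_cos_sq θ
    simp only [id, Pi.add_apply]
    linear_combination r * (dd 1 Q (pol x r θ) - dd Complex.I P (pol x r θ)) * this
  have hdiv := integral2_divergence_prod_of_hasFDerivAt f g (fderiv ℝ f) (fderiv ℝ g) 0 (-Real.pi) R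
    Real.pi hfs.continuous.continuousOn hgs.continuous.continuousOn (fun p _ => hdf p)
    (fun p _ => hdg p) (by
      refine ContinuousOn.integrableOn_compact (isCompact_uIcc.prod isCompact_uIcc) ?_
      have h1 : Continuous (fderiv ℝ f) := hfs.continuous_fderiv (by simp)
      have h2 : Continuous (fderiv ℝ g) := hgs.continuous_fderiv (by simp)
      exact ((h1.clm_apply continuous_const).add (h2.clm_apply continuous_const)).continuousOn)
  simp only [key] at hdiv
  rw [setIntegral_closedBall_eq_polar (g := fun z => dd 1 Q z - dd Complex.I P z)
    ((continuous_dd hQ).sub (continuous_dd hP)) x hR]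
  simp only [intervalIntegral.integral_const_mul] at hdiv
  rw [hdiv]
  simp [hf, hg, pol_pi, circ]

/-- The circulation of the current of a non-vanishing planar loop is quantized. -/
theorem exists_int_circ_jt (hα : ContDiff ℝ ∞ α) (hβ : ContDiff ℝ ∞ β) (x : ℂ) (r : ℝ)
    (hb : ∀ θ, 1 / 4 ≤ α (pol x r θ) ^ 2 + β (pol x r θ) ^ 2) :
    ∃ n : ℤ, circ (jt α β 1) (jt α β Complex.I) x r = 2 * Real.pi * n := by
  set γ : ℝ → ℂ := fun θ => (α (pol x r θ) : ℂ) + β (pol x r θ) * Complex.I with hγ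
  set a' : ℝ → ℝ := fun θ => -(r * Real.sin θ) * dd 1 α (pol x r θ) +
    r * Real.cos θ * dd Complex.I α (pol x r θ) with ha'
  set b' : ℝ → ℝ := fun θ => -(r * Real.sin θ) * dd 1 β (pol x r θ) +
    r * Real.cos θ * dd Complex.I β (pol x r θ) with hb'
  set γ' : ℝ → ℂ := fun θ => (a' θ : ℂ) + b' θ * Complex.I with hγ'
  have hd : ∀ θ, HasDerivAt γ (γ' θ) θ := fun θ =>
    (hasDerivAt_comp_pol_right hα x r θ).ofReal_comp.add
      ((hasDerivAt_comp_pol_right hβ x r θ).ofReal_comp.mul_const Complex.I)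
  have hne : ∀ θ, γ θ ≠ 0 := by
    intro θ h0
    have h1 := congrArg Complex.re h0
    have h2 := congrArg Complex.im h0
    simp [hγ] at h1 h2
    have := hb θ
    rw [h1, h2] at this
    norm_num at this
  have hγc : Continuous γ := continuous_iff_continuousAt.2 fun θ => (hd θ).continuousAt
  have hpr := continuous_pol_right x r
  have hc1 := (continuous_dd (e := 1) hα).comp hpr
  have hc2 := (continuous_dd (e := Complex.I) hα).comp hpr
  have hc3 := (continuous_dd (e := 1) hβ).comp hpr
  have hc4 := (continuous_dd (e := Complex.I) hβ).comp hpr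
  simp only [Function.comp_def] at hc1 hc2 hc3 hc4
  have hγ'c : Continuous γ' := by rw [hγ', ha', hb']; fun_prop
  set w : ℝ → ℂ := fun θ => γ' θ / γ θ with hw
  have hwc : Continuous w := hγ'c.div hγc hne
  set F : ℝ → ℂ := fun t => ∫ θ in (-Real.pi)..t, w θ with hF
  have hFd : ∀ t, HasDerivAt F (w t) t := fun t =>
    intervalIntegral.integral_hasDerivAt_right (hwc.intervalIntegrable _ _)
      (hwc.stronglyMeasurableAtFilter _ _) hwc.continuousAt
  have hconst : ∀ t, HasDerivAt (fun t => γ t * Complex.exp (-F t)) 0 t := by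
    intro t
    have h1 := (hd t).mul ((hFd t).neg.cexp)
    refine h1.congr_deriv ?_
    have h2 : γ t * w t = γ' t := mul_div_cancel₀ _ (hne t)
    linear_combination (-Complex.exp (-F t)) * h2
  have heq := is_const_of_deriv_eq_zero (fun t => (hconst t).differentiableAt)
    (fun t => (hconst t).deriv) Real.pi (-Real.pi)
  have hγπ : γ Real.pi = γ (-Real.pi) := by simp [hγ, pol_pi]
  have hF0 : F (-Real.pi) = 0 := by simp [hF]
  simp only [hF0, hγπ, neg_zero, Complex.exp_zero, mul_one] at heq
  have hexp : Complex.exp (-F Real.pi) = 1 := by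
    have := hne (-Real.pi)
    exact mul_left_cancel₀ this (by rw [heq, mul_one])
  obtain ⟨n, hn⟩ := Complex.exp_eq_one_iff.1 hexp
  refine ⟨-n, ?_⟩
  have him : (F Real.pi).im = ∫ θ in (-Real.pi)..Real.pi, (w θ).im := by
    have := Complex.imCLM.intervalIntegral_comp_comm (hwc.intervalIntegrable (μ := volume) (-Real.pi) Real.pi)
    simpa [hF] using this.symm
  have hn2 : (F Real.pi).im = 2 * Real.pi * (-n : ℤ) := by
    have : F Real.pi = -(n * (2 * Real.pi * Complex.I)) := by rw [← hn, neg_neg]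
    rw [this]
    simp
    ring
  rw [← hn2, him, circ]
  refine intervalIntegral.integral_congr fun θ _ => ?_
  have h8 : 1 / 8 ≤ α (pol x r θ) ^ 2 + β (pol x r θ) ^ 2 := by linarith [hb θ]
  simp only [hw, Complex.div_im, hγ, hγ', Complex.normSq_apply]
  simp
  have h0 : α (pol x r θ) ^ 2 + β (pol x r θ) ^ 2 ≠ 0 := by linarith
  have h0' : α (pol x r θ) * α (pol x r θ) + β (pol x r θ) * β (pol x r θ) ≠ 0 := by
    rw [← sq, ← sq]; exact h0
  simp only [ha', hb']
  field_simp
  have k1 := jt_eq (α := α) (β := β) (e := 1) h8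
  have k2 := jt_eq (α := α) (β := β) (e := Complex.I) h8
  linear_combination (-(r * Real.sin θ)) * k1 + r * Real.cos θ * k2

end GinzburgLandau

namespace GinzburgLandau
open scoped ContDiff Topology

variable {c : ℝ} {α β : ℂ → ℝ}

/-- The current `Im (conj (u - 1) ∂ₑ u)`; in the direction `Complex.I` it is minus the momentum
density. -/
def mom (α β : ℂ → ℝ) (e z : ℂ) : ℝ := (α z - 1) * dd e β z - β z * dd e α z

@[fun_prop] theorem contDiff_mom (hα : ContDiff ℝ ∞ α) (hβ : ContDiff ℝ ∞ β) (e : ℂ) :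
    ContDiff ℝ ∞ (mom α β e) := by unfold mom; fun_prop

theorem curl_mom (hα : ContDiff ℝ ∞ α) (hβ : ContDiff ℝ ∞ β) (z : ℂ) :
    dd 1 (mom α β Complex.I) z - dd Complex.I (mom α β 1) z
      = 2 * (dd 1 α z * dd Complex.I β z - dd Complex.I α z * dd 1 β z) := by
  have e1 : dd 1 (dd Complex.I α) = dd Complex.I (dd 1 α) := dd_comm hα
  have e2 : dd 1 (dd Complex.I β) = dd Complex.I (dd 1 β) := dd_comm hβ
  unfold mom
  simp (disch := fun_prop) only [dd_sub, dd_mul, dd_const, e1, e2]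
  ring

/-- Finite energy travelling waves `α + iβ` of speed `c`, with integrable momentum density. -/
structure TWSol (c : ℝ) (α β : ℂ → ℝ) : Prop where
  sα : ContDiff ℝ ∞ α
  sβ : ContDiff ℝ ∞ β
  pos : 0 < c
  eα : ∀ z, Lap α z = c * dd Complex.I β z - pot 1 α β z * α z
  eβ : ∀ z, Lap β z = - (c * dd Complex.I α z) - pot 1 α β z * β z
  ied : Integrable (ed 1 α β)
  imom : Integrable (mom α β Complex.I)

/-- Real part of `(α + iβ) exp (i c x₂ / 2)`. -/
def gaugeRe (c : ℝ) (α β : ℂ → ℝ) (z : ℂ) : ℝ :=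
  α z * Real.cos (c / 2 * z.im) - β z * Real.sin (c / 2 * z.im)

/-- Imaginary part of `(α + iβ) exp (i c x₂ / 2)`. -/
def gaugeIm (c : ℝ) (α β : ℂ → ℝ) (z : ℂ) : ℝ :=
  α z * Real.sin (c / 2 * z.im) + β z * Real.cos (c / 2 * z.im)

@[fun_prop] theorem contDiff_cos_im : ContDiff ℝ ∞ (fun z : ℂ => Real.cos (c / 2 * z.im)) :=
  Real.contDiff_cos.comp (contDiff_const.mul contDiff_im)
@[fun_prop] theorem contDiff_sin_im : ContDiff ℝ ∞ (fun z : ℂ => Real.sin (c / 2 * z.im)) :=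
  Real.contDiff_sin.comp (contDiff_const.mul contDiff_im)

theorem dd_cos_im (e : ℂ) : dd e (fun z : ℂ => Real.cos (c / 2 * z.im))
    = fun z => - (c / 2 * e.im) * Real.sin (c / 2 * z.im) := by
  funext z
  have h : HasFDerivAt (fun z : ℂ => c / 2 * z.im) ((c / 2) • Complex.imCLM) z :=
    Complex.imCLM.hasFDerivAt.const_smul (c / 2)
  have := h.cos
  simp only [dd, this.fderiv]
  simp
  ring

theorem dd_sin_im (e : ℂ) : dd e (fun z : ℂ => Real.sin (c / 2 * z.im))
    = fun z => c / 2 * e.im * Real.cos (c / 2 * z.im) := by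
  funext z
  have h : HasFDerivAt (fun z : ℂ => c / 2 * z.im) ((c / 2) • Complex.imCLM) z :=
    Complex.imCLM.hasFDerivAt.const_smul (c / 2)
  have := h.sin
  simp only [dd, this.fderiv]
  simp
  ring

@[fun_prop] theorem contDiff_gaugeRe (hα : ContDiff ℝ ∞ α) (hβ : ContDiff ℝ ∞ β) :
    ContDiff ℝ ∞ (gaugeRe c α β) := by unfold gaugeRe; fun_prop
@[fun_prop] theorem contDiff_gaugeIm (hα : ContDiff ℝ ∞ α) (hβ : ContDiff ℝ ∞ β) :
    ContDiff ℝ ∞ (gaugeIm c α β) := by unfold gaugeIm; fun_prop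

theorem gauge_normSq (z : ℂ) :
    gaugeRe c α β z ^ 2 + gaugeIm c α β z ^ 2 = α z ^ 2 + β z ^ 2 := by
  have := Real.sin_sq_add_cos_sq (c / 2 * z.im)
  unfold gaugeRe gaugeIm
  linear_combination (α z ^ 2 + β z ^ 2) * this

theorem pot_gauge (z : ℂ) :
    pot (1 + c ^ 2 / 4) (gaugeRe c α β) (gaugeIm c α β) z = pot 1 α β z + c ^ 2 / 4 := by
  simp only [pot, gauge_normSq]; ring

theorem dd_gaugeRe (hα : ContDiff ℝ ∞ α) (hβ : ContDiff ℝ ∞ β) (e : ℂ) :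
    dd e (gaugeRe c α β) = fun z => gaugeRe c (dd e α) (dd e β) z
      - c / 2 * e.im * gaugeIm c α β z := by
  funext z
  unfold gaugeRe gaugeIm
  simp (disch := fun_prop) only [dd_sub, dd_mul, dd_cos_im, dd_sin_im]
  ring

theorem dd_gaugeIm (hα : ContDiff ℝ ∞ α) (hβ : ContDiff ℝ ∞ β) (e : ℂ) :
    dd e (gaugeIm c α β) = fun z => gaugeIm c (dd e α) (dd e β) z
      + c / 2 * e.im * gaugeRe c α β z := by
  funext z
  unfold gaugeRe gaugeIm
  simp (disch := fun_prop) only [dd_add, dd_mul, dd_cos_im, dd_sin_im]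
  ring

theorem gsq_gauge (hα : ContDiff ℝ ∞ α) (hβ : ContDiff ℝ ∞ β) (z : ℂ) :
    gsq (gaugeRe c α β) (gaugeIm c α β) z = gsq α β z
      + c * (α z * dd Complex.I β z - β z * dd Complex.I α z)
      + c ^ 2 / 4 * (α z ^ 2 + β z ^ 2) := by
  have := Real.sin_sq_add_cos_sq (c / 2 * z.im)
  simp only [gsq, dd_gaugeRe hα hβ, dd_gaugeIm hα hβ, gaugeRe, gaugeIm, Complex.one_im,
    Complex.I_im]
  linear_combination (dd 1 α z ^ 2 + dd Complex.I α z ^ 2 + dd 1 β z ^ 2 + dd Complex.I β z ^ 2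
      + c * (α z * dd Complex.I β z - β z * dd Complex.I α z)
      + c ^ 2 / 4 * (α z ^ 2 + β z ^ 2)) * this

theorem abs_cross_le (z : ℂ) :
    |c * (α z * dd Complex.I β z - β z * dd Complex.I α z)|
      ≤ (1 / 2) * gsq α β z + c ^ 2 / 2 * (α z ^ 2 + β z ^ 2) := by
  unfold gsq
  rw [abs_le]
  constructor <;>
  nlinarith [sq_nonneg (c * α z - dd Complex.I β z), sq_nonneg (c * β z + dd Complex.I α z),
    sq_nonneg (c * α z + dd Complex.I β z), sq_nonneg (c * β z - dd Complex.I α z),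
    sq_nonneg (dd 1 α z), sq_nonneg (dd 1 β z)]

namespace TWSol

theorem Lap_normSq (h : TWSol c α β) (z : ℂ) :
    Lap (fun z => α z ^ 2 + β z ^ 2) z = 2 * gsq α β z
      + 2 * (c * (α z * dd Complex.I β z - β z * dd Complex.I α z))
      - 2 * pot 1 α β z * (α z ^ 2 + β z ^ 2) := by
  have hα := h.sα
  have hβ := h.sβ
  rw [Lap_add (by fun_prop) (by fun_prop), Lap_sq hα, Lap_sq hβ, h.eα, h.eβ]
  unfold gsq
  ring

theorem normSq_le (h : TWSol c α β) (z : ℂ) : α z ^ 2 + β z ^ 2 ≤ 1 + c ^ 2 / 4 := by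
  have hα := h.sα
  have hβ := h.sβ
  have hc := h.pos
  have := nonpos_of_Lap_ge_sq (w := fun z => (α z ^ 2 + β z ^ 2) - (1 + c ^ 2 / 4)) (by fun_prop)
    (fun z hz => by
      rw [Lap_sub (by fun_prop) (by fun_prop), Lap_const, h.Lap_normSq]
      have h1 := (abs_le.1 (abs_cross_le (c := c) (α := α) (β := β) z)).1
      have h2 : - (gsq α β z) - c ^ 2 / 4 * (α z ^ 2 + β z ^ 2) ≤
          c * (α z * dd Complex.I β z - β z * dd Complex.I α z) := by
        unfold gsq
        nlinarith [sq_nonneg (c / 2 * α z + dd Complex.I β z),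
          sq_nonneg (c / 2 * β z - dd Complex.I α z), sq_nonneg (dd 1 α z), sq_nonneg (dd 1 β z)]
      simp only [pot] at hz ⊢
      nlinarith [sq_nonneg c]) z
  linarith

theorem gauge (h : TWSol c α β) (hc : c ≤ 2) :
    GLSol (1 + c ^ 2 / 4) (gaugeRe c α β) (gaugeIm c α β) := by
  have hα := h.sα
  have hβ := h.sβ
  have h0 := h.pos
  have a1 : ∀ z, dd 1 (dd 1 α) z = c * dd Complex.I β z - pot 1 α β z * α z
      - dd Complex.I (dd Complex.I α) z := fun z => by rw [← h.eα, Lap]; ring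
  have b1 : ∀ z, dd 1 (dd 1 β) z = - (c * dd Complex.I α z) - pot 1 α β z * β z
      - dd Complex.I (dd Complex.I β) z := fun z => by rw [← h.eβ, Lap]; ring
  refine ⟨by fun_prop, by fun_prop, by nlinarith, by nlinarith, fun z => ?_, fun z => ?_⟩
  · rw [pot_gauge]
    unfold Lap gaugeRe
    simp (disch := fun_prop) only [dd_sub, dd_add, dd_mul, dd_cos_im, dd_sin_im, dd_const, a1, b1,
      Complex.one_im, Complex.I_im]
    ring
  · rw [pot_gauge]
    unfold Lap gaugeIm
    simp (disch := fun_prop) only [dd_sub, dd_add, dd_mul, dd_cos_im, dd_sin_im, dd_const, a1, b1,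
      Complex.one_im, Complex.I_im]
    ring

theorem gsq_gauge_le (h : TWSol c α β) (hc : c ≤ 2) (z : ℂ) :
    gsq (gaugeRe c α β) (gaugeIm c α β) z ≤ 2 * gsq α β z + 2 * c ^ 2 := by
  have h1 := (abs_le.1 (abs_cross_le (c := c) (α := α) (β := β) z)).2
  have h2 := h.normSq_le z
  have h0 := h.pos
  rw [gsq_gauge h.sα h.sβ]
  nlinarith [gsq_nonneg (α := α) (β := β) z, mul_le_mul_of_nonneg_left
    (h2.trans (by nlinarith : 1 + c ^ 2 / 4 ≤ 2)) (sq_nonneg c)]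

theorem gsq_le_gauge (h : TWSol c α β) (hc : c ≤ 2) (z : ℂ) :
    gsq α β z ≤ 2 * gsq (gaugeRe c α β) (gaugeIm c α β) z + 2 * c ^ 2 := by
  have h1 := (abs_le.1 (abs_cross_le (c := c) (α := α) (β := β) z)).1
  have h2 := h.normSq_le z
  have h0 := h.pos
  rw [gsq_gauge h.sα h.sβ]
  nlinarith [gsq_nonneg (α := α) (β := β) z, mul_le_mul_of_nonneg_left
    (h2.trans (by nlinarith : 1 + c ^ 2 / 4 ≤ 2)) (sq_nonneg c)]

theorem gsq_le (h : TWSol c α β) (hc : c ≤ 2) (z : ℂ) : gsq α β z ≤ 400 := by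
  have h1 := h.gsq_le_gauge hc z
  have hv := (h.gauge hc).abs_dd_le z
  have e1 := sq_le_sq' (abs_le.1 hv.1.1).1 (abs_le.1 hv.1.1).2
  have e2 := sq_le_sq' (abs_le.1 hv.1.2).1 (abs_le.1 hv.1.2).2
  have e3 := sq_le_sq' (abs_le.1 hv.2.1).1 (abs_le.1 hv.2.1).2
  have e4 := sq_le_sq' (abs_le.1 hv.2.2).1 (abs_le.1 hv.2.2).2
  have h0 := h.pos
  have : c ^ 2 ≤ 4 := by nlinarith
  have : gsq (gaugeRe c α β) (gaugeIm c α β) z ≤ 4 * 36 := by unfold gsq; linarith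
  linarith

theorem ed_gauge_le (h : TWSol c α β) (hc : c ≤ 2) (z : ℂ) :
    ed (1 + c ^ 2 / 4) (gaugeRe c α β) (gaugeIm c α β) z ≤ 2 * ed 1 α β z + 3 * c ^ 2 := by
  have h1 := h.gsq_gauge_le hc z
  have h0 := h.pos
  have : c ^ 2 ≤ 4 := by nlinarith
  unfold ed
  rw [pot_gauge]
  nlinarith [sq_nonneg (pot 1 α β z - c ^ 2 / 4), sq_nonneg c]

end TWSol

end GinzburgLandau

namespace GinzburgLandau
open scoped ContDiff Topology

/-- One dimensional cutoff, equal to `1` for `|t| ≤ R` and to `0` for `|t| ≥ 2R`. -/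
def scut (R t : ℝ) : ℝ := Real.smoothTransition (2 - 1 / R ^ 2 * t ^ 2)

section scut

variable {R t : ℝ} {f : ℂ → ℝ}

@[fun_prop] theorem contDiff_scut (hf : ContDiff ℝ ∞ f) :
    ContDiff ℝ ∞ (fun z => scut R (f z)) :=
  contDiff_smoothTransition'.comp (by fun_prop : ContDiff ℝ ∞ fun z => 2 - 1 / R ^ 2 * f z ^ 2)

theorem abs_scut_le : |scut R t| ≤ 1 := by
  rw [scut, abs_of_nonneg (Real.smoothTransition.nonneg _)]
  exact Real.smoothTransition.le_one _

theorem scut_eq_one (hR : 0 < R) (ht : |t| ≤ R) : scut R t = 1 := by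
  apply Real.smoothTransition.one_of_one_le
  have h1 : t ^ 2 ≤ R ^ 2 := sq_le_sq' (abs_le.1 ht).1 (abs_le.1 ht).2
  have h2 : 1 / R ^ 2 * t ^ 2 ≤ 1 := by
    rw [one_div, inv_mul_le_iff₀ (by positivity)]; linarith
  linarith

theorem scut_arg_neg (hR : 0 < R) (ht : 2 * R < |t|) : 2 - 1 / R ^ 2 * t ^ 2 < 0 := by
  have h1 : (2 * R) ^ 2 < t ^ 2 := by
    rw [← sq_abs t]; exact pow_lt_pow_left₀ ht (by linarith) (by norm_num)
  have h2 : 4 < 1 / R ^ 2 * t ^ 2 := by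
    rw [one_div, lt_inv_mul_iff₀ (by positivity)]; linarith
  linarith

theorem scut_eq_zero (hR : 0 < R) (ht : 2 * R < |t|) : scut R t = 0 :=
  Real.smoothTransition.zero_of_nonpos (scut_arg_neg hR ht).le

theorem dd_scut (hf : ContDiff ℝ ∞ f) (e z : ℂ) : dd e (fun z => scut R (f z)) z
    = deriv Real.smoothTransition (2 - 1 / R ^ 2 * f z ^ 2)
      * (-(1 / R ^ 2 * (2 * f z * dd e f z))) := by
  unfold scut
  rw [dd_comp contDiff_smoothTransition' (by fun_prop)]
  simp (disch := fun_prop) only [dd_sub, dd_mul, dd_const, dd_pow]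
  norm_num

theorem dd_scut_eq_zero (hf : ContDiff ℝ ∞ f) (e : ℂ) (hR : 0 < R) {z : ℂ}
    (hz : |f z| < R ∨ 2 * R < |f z|) : dd e (fun z => scut R (f z)) z = 0 := by
  rw [dd_scut hf, deriv_smoothTransition_eq_zero, zero_mul]
  rcases hz with hz | hz
  · right
    have h1 : f z ^ 2 < R ^ 2 := sq_lt_sq' (abs_lt.1 hz).1 (abs_lt.1 hz).2
    have h2 : 1 / R ^ 2 * f z ^ 2 < 1 := by
      rw [one_div, inv_mul_lt_iff₀ (by positivity)]; linarith
    linarith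
  · exact Or.inl (scut_arg_neg hR hz)

theorem abs_dd_scut_le (hf : ContDiff ℝ ∞ f) (e : ℂ) (hR : 0 < R) {z : ℂ}
    (hz : |dd e f z| ≤ 1) : |dd e (fun z => scut R (f z)) z| ≤ 4 * cutC / R := by
  have hC := one_le_cutC
  by_cases h : 2 * R < |f z|
  · rw [dd_scut_eq_zero hf e hR (Or.inr h), abs_zero]; positivity
  rw [not_lt] at h
  rw [dd_scut hf, abs_mul, abs_neg, abs_mul, abs_mul, abs_mul, abs_of_pos (by positivity :
    0 < 1 / R ^ 2), abs_two]
  calc _ ≤ cutC * (1 / R ^ 2 * (2 * (2 * R) * 1)) := by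
        gcongr
        exact abs_deriv_smoothTransition_le _
    _ = _ := by field_simp; ring

end scut

theorem volume_rect (A B : ℝ) (hA : 0 ≤ A) :
    volume {z : ℂ | |z.re| ≤ A ∧ |z.im| ≤ B} = ENNReal.ofReal (2 * A * (2 * B)) := by
  have h : {z : ℂ | |z.re| ≤ A ∧ |z.im| ≤ B}
      = Complex.measurableEquivRealProd ⁻¹' (Set.Icc (-A) A ×ˢ Set.Icc (-B) B) := by
    ext z
    simp [Complex.measurableEquivRealProd_apply, abs_le]
    tauto
  rw [h, Complex.volume_preserving_equiv_real_prod.measure_preimage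
    (measurableSet_Icc.prod measurableSet_Icc).nullMeasurableSet, Measure.volume_eq_prod,
    Measure.prod_prod, Real.volume_Icc, Real.volume_Icc, ← ENNReal.ofReal_mul (by linarith)]
  ring_nf

/-- An anisotropic divergence theorem in the whole plane. -/
theorem integral_add_integral_moment_eq_zero {T₁ T₂ σ h : ℂ → ℝ} (hT₁ : ContDiff ℝ ∞ T₁)
    (hT₂ : ContDiff ℝ ∞ T₂) (hσ : ContDiff ℝ ∞ σ) (hdiv : ∀ z, dd 1 T₁ z + dd Complex.I T₂ z = σ z)
    (i1 : Integrable T₁) (i2 : Integrable σ) (i3 : Integrable (fun z => z.re * σ z))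
    (ih : Integrable h) (h0 : ∀ z, 0 ≤ h z) {C : ℝ} (hC : 0 ≤ C)
    (hb : ∀ l : ℝ, 1 ≤ l → ∀ z, |T₂ z| ≤ C * (l * h z + 1 / l)) (κ : ℝ) :
    (∫ z, T₁ z) + ∫ z, (z.re + κ) * σ z = 0 := by
  have hcc := one_le_cutC
  set χ : ℝ → ℂ → ℝ := fun A z => scut A z.re * scut (A ^ 5) z.im with hχ
  have sχ : ∀ A, ContDiff ℝ ∞ (χ A) := fun A => by simp only [hχ]; fun_prop
  set φ : ℝ → ℂ → ℝ := fun A z => (z.re + κ) * χ A z with hφ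
  have sφ : ∀ A, ContDiff ℝ ∞ (φ A) := fun A => by simp only [hφ]; fun_prop
  have cφ : ∀ A, 0 < A → HasCompactSupport (φ A) := fun A hA => by
    refine HasCompactSupport.intro (isCompact_closedBall (0 : ℂ) (2 * A + 2 * A ^ 5)) fun z hz => ?_
    have hz' : 2 * A < |z.re| ∨ 2 * A ^ 5 < |z.im| := by
      by_contra! hh
      apply hz
      rw [mem_closedBall, dist_zero_right]
      exact (Complex.norm_le_abs_re_add_abs_im z).trans (add_le_add hh.1 hh.2)
    simp only [hφ, hχ]
    rcases hz' with hz' | hz'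
    · rw [scut_eq_zero hA hz']; simp
    · rw [scut_eq_zero (by positivity) hz']; simp
  have d1 : ∀ A z, dd 1 (φ A) z = χ A z
      + (z.re + κ) * (dd 1 (fun z => scut A z.re) z * scut (A ^ 5) z.im)
      + (z.re + κ) * (scut A z.re * dd 1 (fun z => scut (A ^ 5) z.im) z) := fun A z => by
    simp only [hφ, hχ]
    simp (disch := fun_prop) only [dd_mul, dd_add, dd_const]
    simp
    ring
  have d1' : ∀ A z, dd 1 (fun z : ℂ => scut (A ^ 5) z.im) z = 0 := fun A z => by
    rw [dd_scut contDiff_im]; simp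
  have dI : ∀ A z, dd Complex.I (φ A) z =
      (z.re + κ) * (scut A z.re * dd Complex.I (fun z => scut (A ^ 5) z.im) z) := fun A z => by
    have : dd Complex.I (fun z : ℂ => scut A z.re) z = 0 := by
      rw [dd_scut contDiff_re]; simp
    simp only [hφ, hχ]
    simp (disch := fun_prop) only [dd_mul, dd_add, dd_const]
    rw [this]
    simp
  have hA0 : ∀ᶠ A : ℝ in atTop, 1 ≤ A ∧ |κ| ≤ A :=
    (eventually_ge_atTop 1).and (eventually_ge_atTop |κ|)
  have key : ∀ A : ℝ, 0 < A → ∫ z, φ A z * σ z =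
      - ((∫ z, dd 1 (φ A) z * T₁ z) + ∫ z, dd Complex.I (φ A) z * T₂ z) := fun A hA => by
    have := integral_mul_div (sφ A) (cφ A hA) hT₁ hT₂
    rw [integral_add] at this
    · rw [← this]; simp only [hdiv]
    · exact ((continuous_dd (sφ A)).mul hT₁.continuous).integrable_of_hasCompactSupport
        ((cφ A hA).fderiv_apply ℝ 1).mul_right
    · exact ((continuous_dd (sφ A)).mul hT₂.continuous).integrable_of_hasCompactSupport
        ((cφ A hA).fderiv_apply ℝ Complex.I).mul_right
  have l1 : Tendsto (fun A => ∫ z, φ A z * σ z) atTop (𝓝 (∫ z, (z.re + κ) * σ z)) := by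
    have hi : Integrable (fun z : ℂ => (z.re + κ) * σ z) := by
      refine (i3.add (i2.const_mul κ)).congr (Eventually.of_forall fun z => ?_)
      simp only [Pi.add_apply]; ring
    refine tendsto_integral_filter_of_dominated_convergence (fun z => ‖(z.re + κ) * σ z‖)
      (Eventually.of_forall fun A => ((sφ A).continuous.mul hσ.continuous).aestronglyMeasurable)
      (Eventually.of_forall fun A => Eventually.of_forall fun z => ?_) hi.norm
      (Eventually.of_forall fun z => ?_)
    · simp only [hφ, hχ, norm_mul, Real.norm_eq_abs]
      have h1 : |scut A z.re| * |scut (A ^ 5) z.im| ≤ 1 * 1 :=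
        mul_le_mul abs_scut_le abs_scut_le (abs_nonneg _) zero_le_one
      have h2 : 0 ≤ |z.re + κ| * |σ z| := by positivity
      nlinarith
    · apply tendsto_const_nhds.congr'
      filter_upwards [eventually_ge_atTop 1, eventually_ge_atTop |z.re|,
        eventually_ge_atTop |z.im|] with A h1 h2 h3
      simp only [hφ, hχ]
      rw [scut_eq_one (by linarith) h2, scut_eq_one (by positivity)
        (h3.trans (le_self_pow₀ h1 (by norm_num)))]
      ring
  have l2 : Tendsto (fun A => ∫ z, dd 1 (φ A) z * T₁ z) atTop (𝓝 (∫ z, T₁ z)) := by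
    refine tendsto_integral_filter_of_dominated_convergence (fun z => (1 + 12 * cutC) * ‖T₁ z‖)
      (Eventually.of_forall fun A =>
        ((continuous_dd (sφ A)).mul hT₁.continuous).aestronglyMeasurable)
      ?_ (i1.norm.const_mul _) (Eventually.of_forall fun z => ?_)
    · filter_upwards [hA0] with A hA
      refine Eventually.of_forall fun z => ?_
      rw [norm_mul, d1, d1']
      refine mul_le_mul_of_nonneg_right ?_ (norm_nonneg _)
      rw [Real.norm_eq_abs]
      have hA' : 0 < A := by linarith
      have h1 : |χ A z| ≤ 1 * 1 := abs_mul_le abs_scut_le abs_scut_le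
      have h2 : |(z.re + κ) * (dd 1 (fun z : ℂ => scut A z.re) z * scut (A ^ 5) z.im)|
          ≤ 12 * cutC := by
        by_cases hz : 2 * A < |z.re|
        · rw [dd_scut_eq_zero contDiff_re 1 hA' (Or.inr hz)]
          simp; linarith
        · have h3 : |z.re + κ| ≤ 3 * A := (abs_add_le _ _).trans (by linarith)
          have h4 := abs_dd_scut_le contDiff_re 1 hA' (z := z) (by simp)
          have h5 := abs_mul_le h3 (abs_mul_le h4 (abs_scut_le (R := A ^ 5) (t := z.im)))
          refine h5.trans (le_of_eq ?_)
          field_simp; ring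
      simp only [mul_zero, add_zero]
      exact (abs_add_le _ _).trans (by linarith)
    · apply tendsto_const_nhds.congr'
      filter_upwards [eventually_gt_atTop 1, eventually_gt_atTop |z.re|,
        eventually_ge_atTop |z.im|] with A h1 h2 h3
      rw [d1, d1', dd_scut_eq_zero contDiff_re 1 (by linarith) (Or.inl h2)]
      simp only [hχ]
      rw [scut_eq_one (by linarith) h2.le, scut_eq_one (by positivity)
        (h3.trans (le_self_pow₀ h1.le (by norm_num)))]
      ring
  have l3 : Tendsto (fun A => ∫ z, dd Complex.I (φ A) z * T₂ z) atTop (𝓝 0) := by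
    set K := 12 * cutC * C * ((∫ z, h z) + 16) with hK
    have hlim : Tendsto (fun A : ℝ => K / A) atTop (𝓝 0) := tendsto_const_nhds.div_atTop tendsto_id
    refine squeeze_zero_norm' ?_ hlim
    filter_upwards [hA0] with A hA
    have hA' : 0 < A := by linarith
    set S : Set ℂ := {z : ℂ | |z.re| ≤ 2 * A ∧ |z.im| ≤ 2 * A ^ 5} with hS
    have mS : MeasurableSet S := by
      apply IsClosed.measurableSet
      exact (isClosed_le (continuous_abs.comp Complex.continuous_re) continuous_const).inter
        (isClosed_le (continuous_abs.comp Complex.continuous_im) continuous_const)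
    have vS := volume_rect (2 * A) (2 * A ^ 5) (by positivity)
    have iS : Integrable (S.indicator fun _ => (1 : ℝ)) := by
      rw [integrable_indicator_iff mS]
      exact integrableOn_const (by rw [vS]; exact ENNReal.ofReal_ne_top)
    have hbound : ∀ z, ‖dd Complex.I (φ A) z * T₂ z‖ ≤ 12 * cutC / A ^ 4 * C *
        (A ^ 3 * h z + 1 / A ^ 3 * S.indicator (fun _ => (1 : ℝ)) z) := fun z => by
      rw [dI, Real.norm_eq_abs]
      by_cases hz : z ∈ S
      · have h3 : |z.re + κ| ≤ 3 * A := (abs_add_le _ _).trans (by linarith [hz.1])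
        have h4 := abs_dd_scut_le (R := A ^ 5) contDiff_im Complex.I (by positivity) (z := z)
          (by simp)
        have h5 := abs_mul_le (abs_mul_le h3 (abs_mul_le (abs_scut_le (R := A) (t := z.re)) h4))
          (hb (A ^ 3) (one_le_pow₀ hA.1) z)
        rw [Set.indicator_of_mem hz]
        refine h5.trans (le_of_eq ?_)
        field_simp; ring
      · have : scut A z.re * dd Complex.I (fun z => scut (A ^ 5) z.im) z = 0 := by
          by_cases h1 : 2 * A < |z.re|
          · rw [scut_eq_zero hA' h1]; simp
          · have : 2 * A ^ 5 < |z.im| := by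
              by_contra! h2
              exact hz ⟨not_lt.1 h1, h2⟩
            rw [dd_scut_eq_zero contDiff_im Complex.I (by positivity) (Or.inr this)]; simp
        rw [this, Set.indicator_of_notMem hz]
        simp only [mul_zero, zero_mul, abs_zero, add_zero]
        have := h0 z
        positivity
    have h6 := norm_integral_le_of_norm_le
      (((ih.const_mul (A ^ 3)).add (iS.const_mul (1 / A ^ 3))).const_mul (12 * cutC / A ^ 4 * C))
      (Eventually.of_forall hbound)
    refine h6.trans (le_of_eq ?_)
    simp only [Pi.add_apply]
    rw [integral_const_mul, integral_add (ih.const_mul _) (iS.const_mul _), integral_const_mul,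
      integral_const_mul, integral_indicator mS, setIntegral_const, Measure.real, vS,
      ENNReal.toReal_ofReal (by positivity), hK]
    simp only [smul_eq_mul, mul_one]
    field_simp
    ring
  have l4 := (l2.add l3).neg
  rw [add_zero] at l4
  have l5 := l1.congr' (by filter_upwards [eventually_gt_atTop 0] with A hA using key A hA)
  have := tendsto_nhds_unique l4 l5
  linarith

/-- The second diagonal entry of an integrable divergence free tensor has zero mean. -/
theorem integral_eq_zero_of_div_eq_zero {T₁ T₂ : ℂ → ℝ} (hT₁ : ContDiff ℝ ∞ T₁)
    (hT₂ : ContDiff ℝ ∞ T₂) (hdiv : ∀ z, dd 1 T₁ z + dd Complex.I T₂ z = 0)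
    (i1 : Integrable T₁) (i2 : Integrable T₂) : ∫ z, T₂ z = 0 := by
  have hcc := one_le_cutC
  set φ : ℝ → ℂ → ℝ := fun A z => z.im * cut 0 A z with hφ
  have sφ : ∀ A, ContDiff ℝ ∞ (φ A) := fun A => by simp only [hφ]; fun_prop
  have cφ : ∀ A, 0 < A → HasCompactSupport (φ A) := fun A hA => (hasCompactSupport_cut hA).mul_left
  have d1 : ∀ A z, dd 1 (φ A) z = z.im * dd 1 (cut 0 A) z := fun A z => by
    simp only [hφ]
    simp (disch := fun_prop) only [dd_mul]
    simp
  have dI : ∀ A z, dd Complex.I (φ A) z = cut 0 A z + z.im * dd Complex.I (cut 0 A) z :=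
      fun A z => by
    simp only [hφ]
    simp (disch := fun_prop) only [dd_mul]
    simp
  have key : ∀ A : ℝ, 0 < A → 
      (∫ z, dd 1 (φ A) z * T₁ z) + ∫ z, dd Complex.I (φ A) z * T₂ z = 0 := fun A hA => by
    have := integral_mul_div (sφ A) (cφ A hA) hT₁ hT₂
    simp only [hdiv, mul_zero, integral_zero] at this
    rw [integral_add] at this
    · linarith
    · exact ((continuous_dd (sφ A)).mul hT₁.continuous).integrable_of_hasCompactSupport
        ((cφ A hA).fderiv_apply ℝ 1).mul_right
    · exact ((continuous_dd (sφ A)).mul hT₂.continuous).integrable_of_hasCompactSupport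
        ((cφ A hA).fderiv_apply ℝ Complex.I).mul_right
  have bound : ∀ e, IsDir e → ∀ A : ℝ, 0 < A → ∀ z : ℂ, |z.im * dd e (cut 0 A) z| ≤ 8 * cutC := by
    intro e he A hA z
    by_cases hz : z ∈ closedBall 0 (2 * A)
    · rw [mem_closedBall, dist_zero_right] at hz
      have h1 : |z.im| ≤ 2 * A := (Complex.abs_im_le_norm z).trans hz
      have h1' : |z.re| ≤ 2 * A := (Complex.abs_re_le_norm z).trans hz
      have h2 : |dd e (nsq 0) z| ≤ 2 * (2 * A) := by
        rcases he with rfl | rfl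
        · rw [dd_one_nsq', abs_mul, abs_two]; simpa using h1'
        · rw [dd_I_nsq', abs_mul, abs_two]; simpa using h1
      rw [dd_cut]
      have h3 : |-(1 / A ^ 2 * dd e (nsq 0) z)| ≤ 1 / A ^ 2 * (2 * (2 * A)) := by
        rw [abs_neg]
        exact abs_mul_le (le_of_eq (abs_of_pos (by positivity))) h2
      refine (abs_mul_le h1 (abs_mul_le (abs_deriv_smoothTransition_le _) h3)).trans (le_of_eq ?_)
      field_simp; ring
    · rw [dd_cut, (deriv_cut_arg_eq_zero hA fun h => hz h.1).1]
      simp; linarith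
  have van : ∀ e, ∀ z : ℂ, ∀ᶠ A in atTop, dd e (cut 0 A) z = 0 := by
    intro e z
    filter_upwards [eventually_gt_atTop ‖z‖, eventually_gt_atTop 0] with A hA hA0
    rw [dd_cut, (deriv_cut_arg_eq_zero hA0 fun h => h.2 (by simpa using hA)).1, zero_mul]
  have l1 : Tendsto (fun A => ∫ z, dd 1 (φ A) z * T₁ z) atTop (𝓝 (∫ _ : ℂ, (0 : ℝ))) := by
    refine tendsto_integral_filter_of_dominated_convergence (fun z => (8 * cutC) * ‖T₁ z‖)
      (Eventually.of_forall fun A =>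
        ((continuous_dd (sφ A)).mul hT₁.continuous).aestronglyMeasurable)
      ?_ (i1.norm.const_mul _) (Eventually.of_forall fun z => ?_)
    · filter_upwards [eventually_gt_atTop 0] with A hA
      refine Eventually.of_forall fun z => ?_
      rw [norm_mul, d1]
      exact mul_le_mul_of_nonneg_right (bound 1 (Or.inl rfl) A hA z) (norm_nonneg _)
    · apply tendsto_const_nhds.congr'
      filter_upwards [van 1 z] with A hA
      rw [d1, hA]; simp
  have l2 : Tendsto (fun A => ∫ z, dd Complex.I (φ A) z * T₂ z) atTop (𝓝 (∫ z, T₂ z)) := by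
    refine tendsto_integral_filter_of_dominated_convergence (fun z => (1 + 8 * cutC) * ‖T₂ z‖)
      (Eventually.of_forall fun A =>
        ((continuous_dd (sφ A)).mul hT₂.continuous).aestronglyMeasurable)
      ?_ (i2.norm.const_mul _) (Eventually.of_forall fun z => ?_)
    · filter_upwards [eventually_gt_atTop 0] with A hA
      refine Eventually.of_forall fun z => ?_
      rw [norm_mul, dI]
      refine mul_le_mul_of_nonneg_right ((abs_add_le _ _).trans (add_le_add ?_ 
        (bound _ (Or.inr rfl) A hA z))) (norm_nonneg _)
      rw [abs_of_nonneg (cut_nonneg _)]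
      exact cut_le_one _
    · apply tendsto_const_nhds.congr'
      filter_upwards [van Complex.I z, eventually_ge_atTop ‖z‖, eventually_gt_atTop 0]
        with A hA h1 h2
      rw [dI, hA, cut_eq_one h2 (by simpa using h1)]; simp
  have l4 := l1.add l2
  have l5 := tendsto_const_nhds (x := (0 : ℝ)) (f := (atTop : Filter ℝ))
  have := tendsto_nhds_unique l4 (l5.congr' (by
    filter_upwards [eventually_gt_atTop 0] with A hA using (key A hA).symm))
  simpa using this

end GinzburgLandau

namespace GinzburgLandau
open scoped ContDiff Topology

variable {c : ℝ} {α β : ℂ → ℝ}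

/-- Energy density of a pair. -/
def en (α β : ℂ → ℝ) (z : ℂ) : ℝ := (1 / 2) * gsq α β z + (1 / 4) * pot 1 α β z ^ 2

@[fun_prop] theorem contDiff_en (hα : ContDiff ℝ ∞ α) (hβ : ContDiff ℝ ∞ β) :
    ContDiff ℝ ∞ (en α β) := by unfold en; fun_prop

theorem en_nonneg (z : ℂ) : 0 ≤ en α β z := by
  have := gsq_nonneg (α := α) (β := β) z
  unfold en; positivity

theorem ed_le_en (z : ℂ) : ed 1 α β z ≤ 4 * en α β z := by
  have := gsq_nonneg (α := α) (β := β) z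
  unfold en ed; linarith

theorem en_le_ed (z : ℂ) : en α β z ≤ ed 1 α β z := by
  have := gsq_nonneg (α := α) (β := β) z
  unfold en ed; nlinarith [sq_nonneg (pot 1 α β z)]

/-- Vorticity. -/
def vor (α β : ℂ → ℝ) (z : ℂ) : ℝ := dd 1 (jt α β Complex.I) z - dd Complex.I (jt α β 1) z

@[fun_prop] theorem contDiff_vor (hα : ContDiff ℝ ∞ α) (hβ : ContDiff ℝ ∞ β) :
    ContDiff ℝ ∞ (vor α β) := by unfold vor; fun_prop

theorem vor_eq_zero (hα : ContDiff ℝ ∞ α) (hβ : ContDiff ℝ ∞ β) {z : ℂ}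
    (hz : 1 / 8 < α z ^ 2 + β z ^ 2) : vor α β z = 0 := by
  rw [vor, curl_jt hα hβ, deriv_stepF_eq_zero hz]; ring

theorem invF_nonneg {t : ℝ} (ht : 0 ≤ t) : 0 ≤ invF t := div_nonneg (stepF_nonneg t) ht

theorem abs_invF_sub_one_le {t : ℝ} (ht : 0 ≤ t) : |invF t - 1| ≤ 20 * |1 - t| := by
  rcases le_or_gt (1 / 8) t with h | h
  · have h1 : t ≠ 0 := by linarith
    have : invF t - 1 = (1 - t) / t := by rw [invF, stepF_eq_one h]; field_simp
    rw [this, abs_div, abs_of_nonneg ht, div_le_iff₀ (by linarith)]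
    nlinarith [abs_nonneg (1 - t)]
  · have h1 : invF t ≤ 16 := by
      rcases le_or_gt t (1 / 16) with h2 | h2
      · rw [invF, stepF_eq_zero h2]; norm_num
      · rw [invF, div_le_iff₀ (by linarith)]
        linarith [stepF_le_one t]
    have h2 := invF_nonneg ht
    rw [abs_of_pos (by linarith : 0 < 1 - t), abs_le]
    constructor <;> linarith

/-- The definite potential energy near a zero. -/
def muZ : ℝ := Real.pi / 2560000

theorem muZ_pos : 0 < muZ := by unfold muZ; positivity

theorem sum_setIntegral_le {ι : Type*} (t : Finset ι) (s : ι → Set ℂ) {f : ℂ → ℝ}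
    (hf : Integrable f) (h0 : ∀ z, 0 ≤ f z) (ms : ∀ i ∈ t, MeasurableSet (s i))
    (hd : Set.Pairwise (t : Set ι) (Function.onFun Disjoint s)) {U : Set ℂ} (hU : ∀ i ∈ t, s i ⊆ U)
    : ∑ i ∈ t, ∫ z in s i, f z ≤ ∫ z in U, f z := by
  rw [← integral_biUnion_finset t ms hd fun i _ => hf.integrableOn]
  exact setIntegral_mono_set hf.integrableOn (Eventually.of_forall h0)
    (LE.le.eventuallyLE (Set.iUnion₂_subset hU))

namespace TWSol

theorem abs_jt_sub_le (h : TWSol c α β) (hc : c ≤ 2) {e : ℂ} (he : IsDir e) (z : ℂ) :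
    |jt α β e z - (α z * dd e β z - β z * dd e α z)| ≤ 60 * ed 1 α β z := by
  have h0 := h.pos
  have hN := h.normSq_le z
  have hN2 : α z ^ 2 + β z ^ 2 ≤ 2 := by nlinarith
  have ha : |α z| ≤ 3 / 2 := abs_le_of_sq_le_sq (by nlinarith [sq_nonneg (β z)]) (by norm_num)
  have hb : |β z| ≤ 3 / 2 := abs_le_of_sq_le_sq (by nlinarith [sq_nonneg (α z)]) (by norm_num)
  have h1 : jt α β e z - (α z * dd e β z - β z * dd e α z)
      = (invF (α z ^ 2 + β z ^ 2) - 1) * (α z * dd e β z - β z * dd e α z) := by unfold jt; ring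
  have h2 := abs_invF_sub_one_le (t := α z ^ 2 + β z ^ 2) (by positivity)
  have h3 : |α z * dd e β z - β z * dd e α z| ≤ 3 / 2 * |dd e β z| + 3 / 2 * |dd e α z| :=
    (abs_sub _ _).trans (add_le_add (by rw [abs_mul]; gcongr) (by rw [abs_mul]; gcongr))
  rw [h1]
  refine (abs_mul_le h2 h3).trans ?_
  have h4 : dd e α z ^ 2 + dd e β z ^ 2 ≤ gsq α β z := by
    unfold gsq
    rcases he with rfl | rfl
    · nlinarith [sq_nonneg (dd Complex.I α z), sq_nonneg (dd Complex.I β z)]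
    · nlinarith [sq_nonneg (dd 1 α z), sq_nonneg (dd 1 β z)]
  have h5 : pot 1 α β z ^ 2 = |1 - (α z ^ 2 + β z ^ 2)| ^ 2 := by rw [sq_abs]; rfl
  unfold ed
  rw [h5, ← sq_abs (dd e α z), ← sq_abs (dd e β z)] at *
  nlinarith [sq_nonneg (|1 - (α z ^ 2 + β z ^ 2)| - |dd e α z|),
    sq_nonneg (|1 - (α z ^ 2 + β z ^ 2)| - |dd e β z|), sq_nonneg (|dd e α z|),
    sq_nonneg (|dd e β z|), sq_nonneg (|1 - (α z ^ 2 + β z ^ 2)|)]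

theorem abs_vor_le (h : TWSol c α β) (hc : c ≤ 2) (z : ℂ) :
    |vor α β z| ≤ 10000 * cutC * pot 1 α β z ^ 2 := by
  have hcc := one_le_cutC
  rcases lt_or_ge (1 / 8) (α z ^ 2 + β z ^ 2) with hz | hz
  · rw [vor_eq_zero h.sα h.sβ hz, abs_zero]; positivity
  · have h1 : 49 / 64 ≤ pot 1 α β z ^ 2 := by
      have : 7 / 8 ≤ pot 1 α β z := by unfold pot; linarith
      nlinarith
    have h2 : |dd 1 α z * dd Complex.I β z - dd Complex.I α z * dd 1 β z| ≤ 200 := by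
      have := h.gsq_le hc z
      unfold gsq at this
      rw [abs_le]
      constructor <;> nlinarith [sq_nonneg (dd 1 α z + dd Complex.I β z),
        sq_nonneg (dd 1 α z - dd Complex.I β z), sq_nonneg (dd 1 β z + dd Complex.I α z),
        sq_nonneg (dd 1 β z - dd Complex.I α z)]
    rw [vor, curl_jt h.sα h.sβ]
    refine (abs_mul_le (B := 200) (A := 2 * (16 * cutC)) ?_ h2).trans ?_
    · rw [abs_mul, abs_two]
      exact mul_le_mul_of_nonneg_left (abs_deriv_stepF_le _) (by norm_num)
    · nlinarith

theorem integrable_pot_sq (h : TWSol c α β) : Integrable (fun z => pot 1 α β z ^ 2) := by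
  have hα := h.sα
  have hβ := h.sβ
  refine h.ied.mono' ((contDiff_pot hα hβ).pow 2).continuous.aestronglyMeasurable
    (Eventually.of_forall fun z => ?_)
  rw [Real.norm_of_nonneg (sq_nonneg _)]
  exact pot_sq_le_ed z

theorem integrable_en (h : TWSol c α β) : Integrable (en α β) := by
  have hα := h.sα
  have hβ := h.sβ
  refine h.ied.mono' (contDiff_en hα hβ).continuous.aestronglyMeasurable
    (Eventually.of_forall fun z => ?_)
  rw [Real.norm_of_nonneg (en_nonneg _)]
  exact en_le_ed z

theorem integrable_T11 (h : TWSol c α β) : Integrable (T11 1 α β) :=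
  h.ied.mono' (contDiff_T11 h.sα h.sβ).continuous.aestronglyMeasurable
    (Eventually.of_forall fun z => (abs_T_le z).1)
theorem integrable_T12 (h : TWSol c α β) : Integrable (T12 α β) :=
  h.ied.mono' (contDiff_T12 h.sα h.sβ).continuous.aestronglyMeasurable
    (Eventually.of_forall fun z => (abs_T_le z).2.1)
theorem integrable_T22 (h : TWSol c α β) : Integrable (T22 1 α β) :=
  h.ied.mono' (contDiff_T22 h.sα h.sβ).continuous.aestronglyMeasurable
    (Eventually.of_forall fun z => (abs_T_le z).2.2)

theorem abs_mom_one_le (h : TWSol c α β) {l : ℝ} (hl : 1 ≤ l) (z : ℂ) :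
    |mom α β 1 z| ≤ (2 + c) * (l * ed 1 α β z + 1 / l) := by
  have h0 := h.pos
  have hN := h.normSq_le z
  have ha : |α z| ≤ 1 + c := abs_le_of_sq_le_sq (by nlinarith [sq_nonneg (β z)]) (by linarith)
  have hb : |β z| ≤ 1 + c := abs_le_of_sq_le_sq (by nlinarith [sq_nonneg (α z)]) (by linarith)
  have ha' : |α z - 1| ≤ 2 + c := (abs_sub _ _).trans (by rw [abs_one]; linarith)
  have hb' : |β z| ≤ 2 + c := by linarith
  have h1 : |mom α β 1 z| ≤ (2 + c) * |dd 1 β z| + (2 + c) * |dd 1 α z| :=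
    (abs_sub _ _).trans (add_le_add (by rw [abs_mul]; gcongr) (by rw [abs_mul]; gcongr))
  have hl0 : 0 < l := by linarith
  have key : ∀ t : ℝ, |t| ≤ (l * t ^ 2 + 1 / l) / 2 := fun t => by
    have : l * t ^ 2 + 1 / l - 2 * |t| = (l * |t| - 1) ^ 2 / l := by
      rw [← sq_abs t]; field_simp; ring
    have h2 : 0 ≤ (l * |t| - 1) ^ 2 / l := by positivity
    linarith
  have h2 := key (dd 1 α z)
  have h3 := key (dd 1 β z)
  have h4 : l * (dd 1 α z ^ 2 + dd 1 β z ^ 2) ≤ l * ed 1 α β z := by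
    refine mul_le_mul_of_nonneg_left ?_ hl0.le
    unfold ed gsq
    nlinarith [sq_nonneg (dd Complex.I α z), sq_nonneg (dd Complex.I β z),
      sq_nonneg (pot 1 α β z)]
  have h5 := ed_nonneg (m := 1) (α := α) (β := β) z
  rw [← mul_add] at h1
  refine h1.trans (mul_le_mul_of_nonneg_left ?_ (by linarith))
  nlinarith [mul_nonneg hl0.le h5]

/-- The momentum. -/
theorem integral_T11 (h : TWSol c α β) :
    ∫ z, T11 1 α β z = c * (-(1 / 2) * ∫ z, mom α β Complex.I z) := by
  have hα := h.sα
  have hβ := h.sβ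
  have h0 := h.pos
  have := integral_add_integral_moment_eq_zero (T₁ := fun z => T11 1 α β z + c / 2 * mom α β Complex.I z)
    (T₂ := fun z => T12 α β z - c / 2 * mom α β 1 z) (σ := fun _ => 0) (h := ed 1 α β)
    (C := 1 + c / 2 * (2 + c)) (by fun_prop) (by fun_prop) (by fun_prop) (fun z => ?_)
    (h.integrable_T11.add (h.imom.const_mul _)) (by simp) (by simp) h.ied ed_nonneg (by positivity)
    (fun l hl z => ?_) 0
  · simp only [mul_zero, integral_zero, add_zero] at this
    rw [integral_add h.integrable_T11 (h.imom.const_mul _), integral_const_mul] at this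
    linarith
  · simp (disch := fun_prop) only [dd_add, dd_sub, dd_mul, dd_const]
    have h1 := div_T_one (m := 1) hα hβ z
    have h2 := curl_mom hα hβ z
    rw [h.eα, h.eβ] at h1
    linear_combination h1 + c / 2 * h2
  · have h1 := h.abs_mom_one_le hl z
    have h2 := (abs_T_le (m := 1) (α := α) (β := β) z).2.1
    have h3 := ed_nonneg (m := 1) (α := α) (β := β) z
    have h4 : 0 ≤ 1 / l := by positivity
    refine (abs_sub _ _).trans ?_
    rw [abs_mul, abs_of_pos (by positivity : 0 < c / 2)]
    have h5 := mul_le_mul_of_nonneg_left h1 (by positivity : 0 ≤ c / 2)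
    nlinarith

theorem mul_momentum_le (h : TWSol c α β) :
    c * (-(1 / 2) * ∫ z, mom α β Complex.I z) ≤ ∫ z, en α β z := by
  rw [← h.integral_T11]
  refine integral_mono h.integrable_T11 h.integrable_en fun z => ?_
  simp only [T11, en, gsq]
  nlinarith [sq_nonneg (dd 1 α z), sq_nonneg (dd 1 β z)]

theorem integral_pot_sq (h : TWSol c α β) :
    ∫ z, pot 1 α β z ^ 2 = 2 * c * (-(1 / 2) * ∫ z, mom α β Complex.I z) := by
  have h1 := h.integral_T11
  have h2 := integral_eq_zero_of_div_eq_zero (contDiff_T12 h.sα h.sβ)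
    (contDiff_T22 (m := 1) h.sα h.sβ) (fun z => ?_) h.integrable_T12 h.integrable_T22
  · have h3 : ∫ z, (T11 1 α β z + T22 1 α β z) = ∫ z, (1 / 2) * pot 1 α β z ^ 2 := by
      simp only [T11_add_T22]
    rw [integral_add h.integrable_T11 h.integrable_T22, integral_const_mul] at h3
    linarith
  · have h1 := div_T_two (m := 1) h.sα h.sβ z
    rw [h.eα, h.eβ] at h1
    rw [h1]; ring

theorem muZ_le (h : TWSol c α β) (hc : c ≤ 1 / 40) {x : ℂ} (hx : α x ^ 2 + β x ^ 2 ≤ 1 / 4) :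
    muZ ≤ ∫ z in closedBall x 1, pot 1 α β z ^ 2 := by
  have hα := h.sα
  have hβ := h.sβ
  have h0 := h.pos
  have h1 := (h.gauge (by linarith)).le_integral_pot_sq (x := x) (by rw [gauge_normSq]; exact hx)
  have h2 : ∫ z in closedBall x 1, pot (1 + c ^ 2 / 4) (gaugeRe c α β) (gaugeIm c α β) z ^ 2
      ≤ ∫ z in closedBall x 1, (2 * pot 1 α β z ^ 2 + c ^ 4 / 8) := by
    refine setIntegral_mono_on (integrableOn_closedBall ?_ x 1) (integrableOn_closedBall ?_ x 1)
      measurableSet_closedBall fun z _ => ?_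
    · exact ((contDiff_pot (contDiff_gaugeRe hα hβ) (contDiff_gaugeIm hα hβ)).pow 2).continuous
    · exact (by fun_prop : ContDiff ℝ ∞ fun z => 2 * pot 1 α β z ^ 2 + c ^ 4 / 8).continuous
    · rw [pot_gauge]; nlinarith [sq_nonneg (pot 1 α β z - c ^ 2 / 4)]
  rw [integral_add ((h.integrable_pot_sq.const_mul 2).integrableOn)
    (integrableOn_const measure_closedBall_lt_top.ne), integral_const_mul, setIntegral_const,
    volume_real_closedBall _ zero_le_one, smul_eq_mul] at h2
  have h3 : c ^ 4 ≤ (1 / 40) ^ 4 := pow_le_pow_left₀ h0.le hc 4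
  have h4 := Real.pi_pos
  unfold muZ
  nlinarith

theorem card_mul_muZ_le (h : TWSol c α β) (hc : c ≤ 1 / 40) {S : ℝ} (hS : 1 ≤ S) (t : Finset ℂ)
    (ht : ∀ z ∈ t, α z ^ 2 + β z ^ 2 < 1 / 4)
    (hsep : ∀ z ∈ t, ∀ w ∈ t, z ≠ w → 2 * S < dist z w) :
    (t.card : ℝ) * muZ ≤ ∫ z, pot 1 α β z ^ 2 := by
  have h1 : ∑ x ∈ t, muZ ≤ ∑ x ∈ t, ∫ z in closedBall x 1, pot 1 α β z ^ 2 :=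
    Finset.sum_le_sum fun x hx => h.muZ_le hc (ht x hx).le
  rw [Finset.sum_const, nsmul_eq_mul] at h1
  refine h1.trans ((sum_setIntegral_le t (fun x => closedBall x 1) h.integrable_pot_sq
    (fun z => sq_nonneg _) (fun _ _ => measurableSet_closedBall) (fun z hz w hw hzw => ?_)
    (fun _ _ => Set.subset_univ _)).trans (by rw [setIntegral_univ]))
  exact closedBall_disjoint_closedBall (by linarith [hsep z hz w hw hzw])

theorem exists_cover (h : TWSol c α β) (hc : c ≤ 1 / 40) {S : ℝ} (hS : 1 ≤ S) :
    ∃ t : Finset ℂ, (∀ z ∈ t, α z ^ 2 + β z ^ 2 < 1 / 4) ∧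
      (t.card : ℝ) * muZ ≤ ∫ z, pot 1 α β z ^ 2 ∧
      ∀ z, α z ^ 2 + β z ^ 2 < 1 / 4 → ∃ b ∈ t, dist z b ≤ 2 * S := by
  classical
  set P : Finset ℂ → Prop := fun t => (∀ z ∈ t, α z ^ 2 + β z ^ 2 < 1 / 4) ∧
    (∀ z ∈ t, ∀ w ∈ t, z ≠ w → 2 * S < dist z w) with hP
  obtain ⟨n, hn⟩ := exists_nat_ge ((∫ z, pot 1 α β z ^ 2) / muZ)
  have hb : ∀ t, P t → t.card ≤ n := fun t ht => by
    have := h.card_mul_muZ_le hc hS t ht.1 ht.2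
    rw [← le_div_iff₀ muZ_pos] at this
    exact_mod_cast this.trans hn
  set A : Set ℕ := {k | ∃ t, P t ∧ t.card = k} with hA
  have hne : A.Nonempty := ⟨0, ∅, ⟨by simp, by simp⟩, rfl⟩
  have hbd : BddAbove A := ⟨n, fun k hk => by
    obtain ⟨t, ht, rfl⟩ := hk
    exact hb t ht⟩
  obtain ⟨t, ht, htc⟩ := Nat.sSup_mem hne hbd
  refine ⟨t, ht.1, h.card_mul_muZ_le hc hS t ht.1 ht.2, fun z hz => ?_⟩
  by_contra! hcon
  have hzt : z ∉ t := fun hzt => by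
    have := hcon z hzt
    rw [dist_self] at this; linarith
  have hP' : P (insert z t) := by
    refine ⟨fun w hw => ?_, fun w hw v hv hwv => ?_⟩
    · rcases Finset.mem_insert.1 hw with rfl | hw
      · exact hz
      · exact ht.1 w hw
    · rcases Finset.mem_insert.1 hw with hw' | hw <;> rcases Finset.mem_insert.1 hv with hv' | hv
      · exact absurd (hw'.trans hv'.symm) hwv
      · rw [hw']; exact hcon v hv
      · rw [hv', dist_comm]; exact hcon w hw
      · exact ht.2 w hw v hv hwv
  have := le_csSup hbd (⟨_, hP', rfl⟩ : (insert z t).card ∈ A)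
  rw [Finset.card_insert_of_notMem hzt] at this
  omega

theorem exists_bad_subset (h : TWSol c α β) (hc : c ≤ 1 / 40) :
    ∃ R, 0 < R ∧ ∀ z, α z ^ 2 + β z ^ 2 < 1 / 4 → z ∈ closedBall 0 R := by
  obtain ⟨t, -, -, ht⟩ := h.exists_cover hc le_rfl
  refine ⟨∑ b ∈ t, ‖b‖ + 3, by positivity, fun z hz => ?_⟩
  obtain ⟨b, hb, hzb⟩ := ht z hz
  have h1 : ‖b‖ ≤ ∑ b ∈ t, ‖b‖ := Finset.single_le_sum (f := fun b => ‖b‖)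
    (fun _ _ => norm_nonneg _) hb
  rw [mem_closedBall, dist_zero_right]
  have h2 : ‖z‖ ≤ ‖z - b‖ + ‖b‖ := by simpa using norm_add_le (z - b) b
  rw [dist_eq_norm] at hzb
  linarith

theorem hasCompactSupport_vor (h : TWSol c α β) (hc : c ≤ 1 / 40) :
    HasCompactSupport (vor α β) := by
  obtain ⟨R, -, hR⟩ := h.exists_bad_subset hc
  refine HasCompactSupport.intro (isCompact_closedBall 0 R) fun z hz => ?_
  refine vor_eq_zero h.sα h.sβ ?_
  by_contra! hh
  exact hz (hR z (by linarith))

theorem integrable_vor (h : TWSol c α β) (hc : c ≤ 1 / 40) : Integrable (vor α β) :=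
  (contDiff_vor h.sα h.sβ).continuous.integrable_of_hasCompactSupport (h.hasCompactSupport_vor hc)

theorem integrable_re_mul_vor (h : TWSol c α β) (hc : c ≤ 1 / 40) :
    Integrable (fun z => z.re * vor α β z) :=
  (Complex.continuous_re.mul (contDiff_vor h.sα h.sβ).continuous).integrable_of_hasCompactSupport
    (h.hasCompactSupport_vor hc).mul_left

/-- First moments of the vorticity. -/
theorem integral_moment_vor (h : TWSol c α β) (hc : c ≤ 1 / 40) (κ : ℝ) :
    |(∫ z, (z.re + κ) * vor α β z) - (-∫ z, mom α β Complex.I z)| ≤ 60 * ∫ z, ed 1 α β z := by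
  have hα := h.sα
  have hβ := h.sβ
  have h0 := h.pos
  have hd : ∀ e, IsDir e → ∀ z, |jt α β e z - dd e β z - mom α β e z| ≤ 60 * ed 1 α β z :=
    fun e he z => by
      have := h.abs_jt_sub_le (by linarith) he z
      unfold mom
      convert this using 2; ring
  have i1 : Integrable (fun z => jt α β Complex.I z - dd Complex.I β z - mom α β Complex.I z) :=
    (h.ied.const_mul 60).mono' (by
      exact (by fun_prop : ContDiff ℝ ∞ fun z => jt α β Complex.I z - dd Complex.I β z
        - mom α β Complex.I z).continuous.aestronglyMeasurable)
      (Eventually.of_forall (hd _ (Or.inr rfl)))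
  have i2 : Integrable (fun z => jt α β Complex.I z - dd Complex.I β z) := by
    refine (i1.add h.imom).congr (Eventually.of_forall fun z => ?_)
    simp only [Pi.add_apply]; ring
  have := integral_add_integral_moment_eq_zero
    (T₁ := fun z => jt α β Complex.I z - dd Complex.I β z)
    (T₂ := fun z => dd 1 β z - jt α β 1 z) (σ := vor α β) (h := ed 1 α β)
    (C := 60 + (2 + c)) (by fun_prop) (by fun_prop) (by fun_prop) (fun z => ?_) i2
    (h.integrable_vor hc) (h.integrable_re_mul_vor hc) h.ied ed_nonneg (by positivity)
    (fun l hl z => ?_) κ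
  · have h1 : ∫ z, (jt α β Complex.I z - dd Complex.I β z - mom α β Complex.I z)
        = (∫ z, (jt α β Complex.I z - dd Complex.I β z)) - ∫ z, mom α β Complex.I z :=
      integral_sub i2 h.imom
    have h2 := norm_integral_le_of_norm_le (h.ied.const_mul 60)
      (f := fun z => jt α β Complex.I z - dd Complex.I β z - mom α β Complex.I z)
      (Eventually.of_forall (hd Complex.I (Or.inr rfl)))
    rw [h1, integral_const_mul, Real.norm_eq_abs, ← abs_neg] at h2
    refine le_trans (le_of_eq ?_) h2
    congr 1
    linarith
  · simp (disch := fun_prop) only [dd_sub]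
    unfold vor
    rw [dd_comm hβ]; ring
  · have h1 := h.abs_mom_one_le hl z
    have h2 := hd 1 (Or.inl rfl) z
    have h3 := ed_nonneg (m := 1) (α := α) (β := β) z
    have h4 : 0 ≤ 1 / l := by positivity
    have h5 : |dd 1 β z - jt α β 1 z| ≤ 60 * ed 1 α β z + |mom α β 1 z| := by
      rw [abs_sub_comm]
      have := abs_add_le (jt α β 1 z - dd 1 β z - mom α β 1 z) (mom α β 1 z)
      rw [sub_add_cancel] at this
      linarith
    nlinarith

theorem integral_vor (h : TWSol c α β) (hc : c ≤ 1 / 40) : ∫ z, vor α β z = 0 := by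
  by_contra hne
  have iv := h.integrable_vor hc
  have im := h.integrable_re_mul_vor hc
  set X := (∫ z, z.re * vor α β z) - (-∫ z, mom α β Complex.I z) with hX
  have key : ∀ κ : ℝ, |X + κ * ∫ z, vor α β z| ≤ 60 * ∫ z, ed 1 α β z := fun κ => by
    have := h.integral_moment_vor hc κ
    have e : ∫ z, (z.re + κ) * vor α β z = (∫ z, z.re * vor α β z) + κ * ∫ z, vor α β z := by
      rw [← integral_const_mul, ← integral_add im (iv.const_mul κ)]
      congr 1; funext z; ring
    rw [e] at this
    rw [hX]; convert this using 2; ring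
  have h1 := key ((60 * (∫ z, ed 1 α β z) + 1 - X) / ∫ z, vor α β z)
  rw [div_mul_cancel₀ _ hne] at h1
  have := (abs_le.1 h1).2
  linarith

end TWSol

end GinzburgLandau

namespace GinzburgLandau
open scoped ContDiff Topology

variable {c : ℝ} {α β : ℂ → ℝ}

/-- Energy density with a weakened potential. -/
def ee (α β : ℂ → ℝ) (z : ℂ) : ℝ := (1 / 2) * gsq α β z + (1 / 16) * pot 1 α β z ^ 2

@[fun_prop] theorem contDiff_ee (hα : ContDiff ℝ ∞ α) (hβ : ContDiff ℝ ∞ β) :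
    ContDiff ℝ ∞ (ee α β) := by unfold ee; fun_prop

theorem ee_nonneg (z : ℂ) : 0 ≤ ee α β z := by
  have := gsq_nonneg (α := α) (β := β) z
  unfold ee; positivity

theorem ed_le_ee (z : ℂ) : ed 1 α β z ≤ 16 * ee α β z := by
  have := gsq_nonneg (α := α) (β := β) z
  unfold ee ed; linarith

theorem ee_eq (z : ℂ) : ee α β z = en α β z - (3 / 16) * pot 1 α β z ^ 2 := by
  unfold ee en; ring

theorem ee_le_en (z : ℂ) : ee α β z ≤ en α β z := by
  rw [ee_eq]; linarith [sq_nonneg (pot 1 α β z)]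

theorem le_ee {z : ℂ} (hz : 1 / 4 ≤ α z ^ 2 + β z ^ 2) (q₁ q₂ : ℝ) :
    jt α β 1 z * q₁ + jt α β Complex.I z * q₂ - (1 / 2) * (q₁ ^ 2 + q₂ ^ 2)
      - 16 * (q₁ ^ 2 + q₂ ^ 2) ^ 2 ≤ ee α β z := by
  have e1 := jt_eq (e := 1) (by linarith : 1 / 8 ≤ α z ^ 2 + β z ^ 2)
  have e2 := jt_eq (e := Complex.I) (by linarith : 1 / 8 ≤ α z ^ 2 + β z ^ 2)
  set N := α z ^ 2 + β z ^ 2 with hN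
  set j₁ := jt α β 1 z
  set j₂ := jt α β Complex.I z
  have hp : pot 1 α β z = 1 - N := rfl
  have hg : N * (j₁ ^ 2 + j₂ ^ 2) ≤ gsq α β z := by
    refine le_of_mul_le_mul_left ?_ (by linarith : 0 < N)
    have : N * (N * (j₁ ^ 2 + j₂ ^ 2)) = (N * j₁) ^ 2 + (N * j₂) ^ 2 := by ring
    rw [this, e1, e2, hN]
    unfold gsq
    nlinarith [sq_nonneg (α z * dd 1 α z + β z * dd 1 β z),
      sq_nonneg (α z * dd Complex.I α z + β z * dd Complex.I β z)]
  set Q := q₁ ^ 2 + q₂ ^ 2 with hQ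
  have hQ0 : 0 ≤ Q := by positivity
  have h1 : j₁ * q₁ + j₂ * q₂ ≤ (1 / 2) * (N * (j₁ ^ 2 + j₂ ^ 2)) + (1 / (2 * N)) * Q := by
    have hN0 : 0 < N := by linarith
    have : (1 / 2) * (N * (j₁ ^ 2 + j₂ ^ 2)) + (1 / (2 * N)) * Q - (j₁ * q₁ + j₂ * q₂) =
        (1 / (2 * N)) * ((N * j₁ - q₁) ^ 2 + (N * j₂ - q₂) ^ 2) := by
      rw [hQ]; field_simp; ring
    have h2 : 0 ≤ (1 / (2 * N)) * ((N * j₁ - q₁) ^ 2 + (N * j₂ - q₂) ^ 2) := by positivity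
    linarith
  have h2 : (1 / (2 * N)) * Q ≤ (1 / 2 + 2 * |1 - N|) * Q := by
    refine mul_le_mul_of_nonneg_right ?_ hQ0
    rw [div_le_iff₀ (by linarith)]
    rcases abs_cases (1 - N) with h | h <;> rw [h.1] <;> nlinarith
  have h3 : 2 * |1 - N| * Q ≤ (1 / 16) * (1 - N) ^ 2 + 16 * Q ^ 2 := by
    nlinarith [sq_nonneg (|1 - N| - 16 * Q), sq_abs (1 - N)]
  rw [ee, hp]
  nlinarith

theorem le_circle_ee (hα : ContDiff ℝ ∞ α) (hβ : ContDiff ℝ ∞ β) (x : ℂ) {ρ : ℝ} (hρ : 0 < ρ)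
    (hb : ∀ z, ‖z - x‖ = ρ → 1 / 4 ≤ α z ^ 2 + β z ^ 2) :
    (|circ (jt α β 1) (jt α β Complex.I) x ρ| - Real.pi) * ρ⁻¹ - 32 * Real.pi * ρ⁻¹ ^ 3 ≤
      ρ * ∫ θ in (-Real.pi)..Real.pi, ee α β (pol x ρ θ) := by
  have key : ∀ s : ℝ, s ^ 2 = 1 →
      (s * circ (jt α β 1) (jt α β Complex.I) x ρ - Real.pi) * ρ⁻¹ - 32 * Real.pi * ρ⁻¹ ^ 3 ≤
      ρ * ∫ θ in (-Real.pi)..Real.pi, ee α β (pol x ρ θ) := fun s hs => by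
    have cp := continuous_pol_right x ρ
    have c1 := (contDiff_jt (e := 1) hα hβ).continuous.comp cp
    have c2 := (contDiff_jt (e := Complex.I) hα hβ).continuous.comp cp
    have c3 := (contDiff_ee hα hβ).continuous.comp cp
    simp only [Function.comp_def] at c1 c2 c3
    have h1 : ∫ θ in (-Real.pi)..Real.pi, (s * ρ⁻¹ ^ 2 * (ρ * (-Real.sin θ * jt α β 1 (pol x ρ θ) +
        Real.cos θ * jt α β Complex.I (pol x ρ θ))) - ((1 / 2) * ρ⁻¹ ^ 2 + 16 * ρ⁻¹ ^ 4))
        ≤ ∫ θ in (-Real.pi)..Real.pi, ee α β (pol x ρ θ) := by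
      refine intervalIntegral.integral_mono_on (by linarith [Real.pi_pos])
        (Continuous.intervalIntegrable (by fun_prop) _ _) (c3.intervalIntegrable _ _)
        fun θ _ => ?_
      have := le_ee (hb (pol x ρ θ) (by rw [norm_pol_sub, abs_of_pos hρ])) (s * ρ⁻¹ * -Real.sin θ)
        (s * ρ⁻¹ * Real.cos θ)
      have e : (s * ρ⁻¹ * -Real.sin θ) ^ 2 + (s * ρ⁻¹ * Real.cos θ) ^ 2 = ρ⁻¹ ^ 2 := by
        have : (s * ρ⁻¹ * -Real.sin θ) ^ 2 + (s * ρ⁻¹ * Real.cos θ) ^ 2 =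
          s ^ 2 * ρ⁻¹ ^ 2 * (Real.sin θ ^ 2 + Real.cos θ ^ 2) := by ring
        rw [this, hs, Real.sin_sq_add_cos_sq]; ring
      rw [e] at this
      refine le_trans (le_of_eq ?_) this
      have : ρ⁻¹ ^ 2 * ρ = ρ⁻¹ := by field_simp
      linear_combination (s * (-Real.sin θ * jt α β 1 (pol x ρ θ) +
        Real.cos θ * jt α β Complex.I (pol x ρ θ))) * this
    rw [intervalIntegral.integral_sub (Continuous.intervalIntegrable (by fun_prop) _ _)
      (by simp), intervalIntegral.integral_const_mul, intervalIntegral.integral_const,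
      smul_eq_mul] at h1
    have h2 := mul_le_mul_of_nonneg_left h1 hρ.le
    refine le_trans (le_of_eq ?_) h2
    rw [← circ]
    field_simp
    ring
  rcases abs_cases (circ (jt α β 1) (jt α β Complex.I) x ρ) with h | h
  · simpa [h.1] using key 1 (by norm_num)
  · simpa [h.1] using key (-1) (by norm_num)

/-- Lower bound for the energy on an annulus without zeros. -/
theorem le_integral_annulus (hα : ContDiff ℝ ∞ α) (hβ : ContDiff ℝ ∞ β) (x : ℂ) {a b : ℝ}
    (ha : 0 < a) (hab : a < b)
    (hb : ∀ z, a < ‖z - x‖ → ‖z - x‖ < b → 1 / 4 ≤ α z ^ 2 + β z ^ 2) :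
    (∃ n : ℤ, ∫ z in closedBall x a, vor α β z = 2 * Real.pi * n) ∧
    (|∫ z in closedBall x a, vor α β z| - Real.pi) * Real.log (b / a)
      - 16 * Real.pi * (a⁻¹ ^ 2 - b⁻¹ ^ 2) ≤ ∫ z in ball x b \ closedBall x a, ee α β z := by
  set D := ∫ z in closedBall x a, vor α β z with hD
  have hc : ∀ ρ, a < ρ → ρ < b → circ (jt α β 1) (jt α β Complex.I) x ρ = D := fun ρ h1 h2 => by
    rw [← setIntegral_curl_eq_circ (contDiff_jt hα hβ) (contDiff_jt hα hβ) x (by linarith), hD]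
    refine setIntegral_eq_of_subset_of_forall_sdiff_eq_zero measurableSet_closedBall
      (closedBall_subset_closedBall h1.le) fun z hz => ?_
    refine vor_eq_zero hα hβ ?_
    simp only [Set.mem_sdiff, mem_closedBall, dist_eq_norm, not_le] at hz
    linarith [hb z hz.2 (by linarith)]
  refine ⟨?_, ?_⟩
  · have h1 : a < (a + b) / 2 := by linarith
    have h2 : (a + b) / 2 < b := by linarith
    rw [← hc _ h1 h2]
    refine exists_int_circ_jt hα hβ x _ fun θ => ?_
    have : ‖pol x ((a + b) / 2) θ - x‖ = (a + b) / 2 := by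
      rw [norm_pol_sub, abs_of_pos (by linarith)]
    exact hb _ (by rw [this]; exact h1) (by rw [this]; exact h2)
  · rw [setIntegral_annulus_eq_polar (contDiff_ee hα hβ).continuous x ha.le hab.le]
    have hpos : ∀ r ∈ Set.uIcc a b, r ≠ 0 := fun r hr => by
      rw [Set.uIcc_of_le hab.le] at hr; linarith [hr.1]
    have hcont : ContinuousOn
        (fun r : ℝ => (|D| - Real.pi) * r⁻¹ - 32 * Real.pi * r⁻¹ ^ 3) (Set.uIcc a b) :=
      (continuousOn_const.mul (continuousOn_inv₀.mono hpos)).sub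
        (continuousOn_const.mul ((continuousOn_inv₀.mono hpos).pow 3))
    have h1 : ∫ r in a..b, ((|D| - Real.pi) * r⁻¹ - 32 * Real.pi * r⁻¹ ^ 3) =
        (|D| - Real.pi) * Real.log (b / a) - 16 * Real.pi * (a⁻¹ ^ 2 - b⁻¹ ^ 2) := by
      rw [intervalIntegral.integral_eq_sub_of_hasDerivAt
        (f := fun r => (|D| - Real.pi) * Real.log r + 16 * Real.pi * r⁻¹ ^ 2)
        (fun r hr => ?_) hcont.intervalIntegrable,
        Real.log_div (by linarith) (by linarith)]
      · ring
      · have h0 := hpos r hr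
        refine (((Real.hasDerivAt_log h0).const_mul (|D| - Real.pi)).add
          (((hasDerivAt_inv h0).pow 2).const_mul (16 * Real.pi))).congr_deriv ?_
        simp only [Nat.add_one_sub_one, pow_one, Nat.cast_ofNat]; field_simp; ring
    rw [← h1]
    have cc := continuous_circle_integral (g := fun r θ => ee α β (pol x r θ))
      ((contDiff_ee hα hβ).continuous.comp (continuous_pol x))
    refine intervalIntegral.integral_mono_on_of_le_Ioo hab.le hcont.intervalIntegrable
      ((continuous_id.mul cc).intervalIntegrable _ _) fun r hr => ?_
    rw [← hc r hr.1 hr.2]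
    exact le_circle_ee hα hβ x (ha.trans hr.1) fun z hz =>
      hb z (by rw [hz]; exact hr.1) (by rw [hz]; exact hr.2)

end GinzburgLandau

namespace GinzburgLandau
open scoped ContDiff Topology

variable {c : ℝ} {α β : ℂ → ℝ} {S : Finset (ℂ × ℝ)}

/-- The union of a finite family of closed balls. -/
def ballUnion (S : Finset (ℂ × ℝ)) : Set ℂ := ⋃ b ∈ S, closedBall b.1 b.2

/-- The sum of the radii of a family of balls. -/
def radSum (S : Finset (ℂ × ℝ)) : ℝ := ∑ b ∈ S, b.2

/-- The sum of the inverse squares of the radii of a family of balls. -/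
def invSqSum (S : Finset (ℂ × ℝ)) : ℝ := ∑ b ∈ S, b.2⁻¹ ^ 2

/-- A family of balls covering the region where the modulus is small. -/
structure IsCover (α β : ℂ → ℝ) (S : Finset (ℂ × ℝ)) : Prop where
  one_le : ∀ b ∈ S, 1 ≤ b.2
  cov : ∀ z, α z ^ 2 + β z ^ 2 < 1 / 4 → ∃ b ∈ S, dist z b.1 ≤ b.2
  meets : ∀ b ∈ S, ∃ z, α z ^ 2 + β z ^ 2 < 1 / 4 ∧ dist z b.1 ≤ b.2

/-- A cover whose balls stay disjoint when dilated by `t`. -/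
structure IsDilatable (α β : ℂ → ℝ) (S : Finset (ℂ × ℝ)) (t : ℝ) : Prop extends
    IsCover α β S where
  one_lt : 1 < t
  sep : ∀ a ∈ S, ∀ b ∈ S, a ≠ b → t * (a.2 + b.2) ≤ dist a.1 b.1

/-- Dilation of a family of balls about their centres. -/
def dilate (t : ℝ) (S : Finset (ℂ × ℝ)) : Finset (ℂ × ℝ) :=
  open Classical in S.image fun b => (b.1, t * b.2)

theorem mem_ballUnion {z : ℂ} : z ∈ ballUnion S ↔ ∃ b ∈ S, dist z b.1 ≤ b.2 := by
  simp [ballUnion]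

theorem measurableSet_ballUnion : MeasurableSet (ballUnion S) :=
  Finset.measurableSet_biUnion _ fun _ _ => measurableSet_closedBall

theorem invSqSum_nonneg : 0 ≤ invSqSum S := Finset.sum_nonneg fun _ _ => sq_nonneg _

theorem sum_dilate {t : ℝ} (ht : t ≠ 0) (f : ℂ × ℝ → ℝ) :
    ∑ b ∈ dilate t S, f b = ∑ b ∈ S, f (b.1, t * b.2) := by
  classical
  rw [dilate, Finset.sum_image fun a _ b _ h => ?_]
  rw [Prod.mk.injEq] at h
  exact Prod.ext h.1 (mul_left_cancel₀ ht h.2)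

theorem radSum_dilate {t : ℝ} (ht : t ≠ 0) : radSum (dilate t S) = t * radSum S := by
  rw [radSum, sum_dilate ht, radSum, Finset.mul_sum]

theorem mem_dilate {t : ℝ} {b : ℂ × ℝ} : b ∈ dilate t S ↔ ∃ a ∈ S, (a.1, t * a.2) = b := by
  simp only [dilate, Finset.mem_image]

theorem card_dilate_le (t : ℝ) : (dilate t S).card ≤ S.card := Finset.card_image_le

namespace IsCover

theorem nonempty (h : IsCover α β S) (hz : ∃ z, α z ^ 2 + β z ^ 2 < 1 / 4) : S.Nonempty := by
  obtain ⟨z, hz⟩ := hz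
  obtain ⟨b, hb, -⟩ := h.cov z hz
  exact ⟨b, hb⟩

theorem le_radSum (h : IsCover α β S) {b : ℂ × ℝ} (hb : b ∈ S) : b.2 ≤ radSum S :=
  Finset.single_le_sum (f := fun b : ℂ × ℝ => b.2) (fun a ha => by linarith [h.one_le a ha]) hb

theorem radSum_pos (h : IsCover α β S) (hz : ∃ z, α z ^ 2 + β z ^ 2 < 1 / 4) :
    1 ≤ radSum S := by
  obtain ⟨b, hb⟩ := h.nonempty hz
  exact (h.one_le b hb).trans (h.le_radSum hb)

theorem dilate (h : IsCover α β S) {t : ℝ} (ht : 1 ≤ t) : IsCover α β (dilate t S) := by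
  have h1 : ∀ b ∈ S, b.2 ≤ t * b.2 := fun b hb => by nlinarith [h.one_le b hb]
  refine ⟨fun b hb => ?_, fun z hz => ?_, fun b hb => ?_⟩
  · obtain ⟨a, ha, rfl⟩ := mem_dilate.1 hb
    exact (h.one_le a ha).trans (h1 a ha)
  · obtain ⟨b, hb, hzb⟩ := h.cov z hz
    exact ⟨_, mem_dilate.2 ⟨b, hb, rfl⟩, hzb.trans (h1 b hb)⟩
  · obtain ⟨a, ha, rfl⟩ := mem_dilate.1 hb
    obtain ⟨z, hz, hza⟩ := h.meets a ha
    exact ⟨z, hz, hza.trans (h1 a ha)⟩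

theorem ballUnion_subset_dilate (h : IsCover α β S) {t : ℝ} (ht : 1 ≤ t) :
    ballUnion S ⊆ ballUnion (GinzburgLandau.dilate t S) := fun z hz => by
  obtain ⟨b, hb, hzb⟩ := mem_ballUnion.1 hz
  exact mem_ballUnion.2 ⟨_, mem_dilate.2 ⟨b, hb, rfl⟩,
    hzb.trans (by nlinarith [h.one_le b hb])⟩

/-- Two intersecting balls of a cover can be merged. -/
theorem exists_merge (h : IsCover α β S) {a b : ℂ × ℝ} (ha : a ∈ S) (hb : b ∈ S) (hab : a ≠ b)
    (hd : dist a.1 b.1 ≤ a.2 + b.2) :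
    ∃ S' : Finset (ℂ × ℝ), IsCover α β S' ∧ S'.card < S.card ∧ radSum S' ≤ radSum S ∧
      invSqSum S' ≤ invSqSum S ∧ ballUnion S ⊆ ballUnion S' := by
  classical
  have ra := h.one_le a ha
  have rb := h.one_le b hb
  set s := a.2 + b.2 with hs
  have hs0 : 0 < s := by linarith
  set x : ℂ := a.1 + ((b.2 / s : ℝ) : ℂ) * (b.1 - a.1) with hx
  have hb' : b ∈ S.erase a := Finset.mem_erase.2 ⟨hab.symm, hb⟩
  set S₀ := (S.erase a).erase b with hS₀
  have hax : dist a.1 x ≤ b.2 := by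
    have : dist a.1 x = b.2 / s * dist a.1 b.1 := by
      rw [hx, dist_eq_norm, dist_eq_norm, sub_add_cancel_left, norm_neg, norm_mul,
        Complex.norm_real, Real.norm_of_nonneg (by positivity), norm_sub_rev]
    rw [this, div_mul_eq_mul_div, div_le_iff₀ hs0]
    nlinarith
  have hbx : dist b.1 x ≤ a.2 := by
    have : dist b.1 x = a.2 / s * dist a.1 b.1 := by
      have e : b.1 - x = ((a.2 / s : ℝ) : ℂ) * (b.1 - a.1) := by
        have : ((a.2 / s : ℝ) : ℂ) + ((b.2 / s : ℝ) : ℂ) = 1 := by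
          rw [← Complex.ofReal_add, ← add_div, ← hs, div_self hs0.ne', Complex.ofReal_one]
        rw [hx]; linear_combination (-(b.1 - a.1)) * this
      rw [dist_eq_norm, dist_eq_norm, e, norm_mul,
        Complex.norm_real, Real.norm_of_nonneg (by positivity), norm_sub_rev]
    rw [this, div_mul_eq_mul_div, div_le_iff₀ hs0]
    nlinarith
  have hsub : ∀ {z : ℂ} {d : ℂ × ℝ}, d ∈ S → dist z d.1 ≤ d.2 →
      ∃ e ∈ insert (x, s) S₀, dist z e.1 ≤ e.2 := fun {z d} hd hz => by
    by_cases h1 : d = a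
    · subst h1
      exact ⟨_, Finset.mem_insert_self _ _, (dist_triangle z d.1 x).trans (by simp only; linarith)⟩
    by_cases h2 : d = b
    · subst h2
      exact ⟨_, Finset.mem_insert_self _ _, (dist_triangle z d.1 x).trans (by simp only; linarith)⟩
    exact ⟨d, Finset.mem_insert_of_mem (Finset.mem_erase.2 ⟨h2, Finset.mem_erase.2 ⟨h1, hd⟩⟩), hz⟩
  have hsum : ∀ f : ℂ × ℝ → ℝ, ∑ d ∈ S, f d = f a + (f b + ∑ d ∈ S₀, f d) := fun f => by
    rw [hS₀, Finset.add_sum_erase _ f hb', Finset.add_sum_erase _ f ha]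
  have hins : ∀ f : ℂ × ℝ → ℝ, 0 ≤ f (x, s) →
      ∑ d ∈ insert (x, s) S₀, f d ≤ f (x, s) + ∑ d ∈ S₀, f d := fun f hf => by
    by_cases hm : (x, s) ∈ S₀
    · rw [Finset.insert_eq_of_mem hm]; linarith
    · rw [Finset.sum_insert hm]
  refine ⟨insert (x, s) S₀, ⟨fun d hd => ?_, fun z hz => ?_, fun d hd => ?_⟩, ?_, ?_, ?_, ?_⟩
  · rcases Finset.mem_insert.1 hd with rfl | hd
    · change 1 ≤ s; linarith
    · exact h.one_le d (Finset.mem_of_mem_erase (Finset.mem_of_mem_erase hd))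
  · obtain ⟨d, hd, hzd⟩ := h.cov z hz
    exact hsub hd hzd
  · rcases Finset.mem_insert.1 hd with rfl | hd
    · obtain ⟨z, hz, hza⟩ := h.meets a ha
      exact ⟨z, hz, (dist_triangle z a.1 x).trans (by simp only; linarith)⟩
    · exact h.meets d (Finset.mem_of_mem_erase (Finset.mem_of_mem_erase hd))
  · refine (Finset.card_insert_le _ _).trans_lt ?_
    have h1 := Finset.card_erase_lt_of_mem hb'
    have h2 := Finset.card_erase_lt_of_mem ha
    rw [← hS₀] at h1
    omega
  · refine (hins (fun d => d.2) hs0.le).trans ?_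
    rw [radSum, hsum fun d => d.2]
    simp only; linarith
  · refine (hins (fun d => d.2⁻¹ ^ 2) (sq_nonneg _)).trans ?_
    rw [invSqSum, hsum fun d => d.2⁻¹ ^ 2]
    have : s⁻¹ ^ 2 ≤ a.2⁻¹ ^ 2 := by
      have h1 : s⁻¹ ≤ a.2⁻¹ := inv_anti₀ (by linarith) (by linarith)
      have h2 : 0 < s⁻¹ := inv_pos.2 hs0
      nlinarith
    simp only
    nlinarith [sq_nonneg b.2⁻¹]
  · intro z hz
    obtain ⟨d, hd, hzd⟩ := mem_ballUnion.1 hz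
    exact mem_ballUnion.2 (hsub hd hzd)

end IsCover

namespace IsDilatable

variable {t : ℝ}

theorem annulus (h : IsDilatable α β S t) {b : ℂ × ℝ} (hb : b ∈ S) {z : ℂ}
    (hz : z ∈ ball b.1 (t * b.2) \ closedBall b.1 b.2) : z ∉ ballUnion S := fun hm => by
  obtain ⟨a, ha, hza⟩ := mem_ballUnion.1 hm
  rw [Set.mem_sdiff, mem_ball, mem_closedBall, not_le] at hz
  have hne : a ≠ b := fun e => by subst e; linarith
  have h1 := h.sep a ha b hb hne
  have h2 := dist_triangle_left a.1 b.1 z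
  nlinarith [h.one_le a ha, h.one_lt]

theorem quarter_le (h : IsDilatable α β S t) {b : ℂ × ℝ} (hb : b ∈ S) (z : ℂ)
    (h1 : b.2 < ‖z - b.1‖) (h2 : ‖z - b.1‖ < t * b.2) : 1 / 4 ≤ α z ^ 2 + β z ^ 2 := by
  by_contra! hh
  exact h.annulus hb (z := z) (by simp [dist_eq_norm, h1, h2]) (mem_ballUnion.2 (h.cov z hh))

theorem pairwise_disjoint (h : IsDilatable α β S t) : Set.Pairwise (S : Set (ℂ × ℝ))
    (Function.onFun Disjoint fun b => ball b.1 (t * b.2) \ closedBall b.1 b.2) :=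
  fun a ha b hb hab => ((ball_disjoint_ball (by linarith [h.sep a ha b hb hab])).mono
    Set.sdiff_subset Set.sdiff_subset)

theorem sum_annuli_add_le (h : IsDilatable α β S t) {f : ℂ → ℝ} (hf : Integrable f)
    (h0 : ∀ z, 0 ≤ f z) :
    (∑ b ∈ S, ∫ z in ball b.1 (t * b.2) \ closedBall b.1 b.2, f z)
      + (∫ z in (ballUnion (dilate t S))ᶜ, f z) ≤ ∫ z in (ballUnion S)ᶜ, f z := by
  have h1 := sum_setIntegral_le S (fun b => ball b.1 (t * b.2) \ closedBall b.1 b.2) hf h0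
    (fun _ _ => measurableSet_ball.diff measurableSet_closedBall) h.pairwise_disjoint
    (U := (ballUnion S)ᶜ ∩ ballUnion (dilate t S)) fun b hb z hz => ⟨h.annulus hb hz,
      mem_ballUnion.2 ⟨_, mem_dilate.2 ⟨b, hb, rfl⟩, (mem_ball.1 hz.1).le⟩⟩
  have h2 : Disjoint ((ballUnion S)ᶜ ∩ ballUnion (dilate t S)) (ballUnion (dilate t S))ᶜ :=
    Set.disjoint_left.2 fun z hz hz' => hz' hz.2
  have h3 := setIntegral_union h2 measurableSet_ballUnion.compl hf.integrableOn hf.integrableOn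
  have h4 : ∫ z in ((ballUnion S)ᶜ ∩ ballUnion (dilate t S)) ∪ (ballUnion (dilate t S))ᶜ, f z ≤
      ∫ z in (ballUnion S)ᶜ, f z := by
    refine setIntegral_mono_set hf.integrableOn (Eventually.of_forall h0) (LE.le.eventuallyLE ?_)
    exact Set.union_subset Set.inter_subset_left
      (Set.compl_subset_compl.2 (h.ballUnion_subset_dilate h.one_lt.le))
  linarith

end IsDilatable

/-- The ball growth method: a lower bound for the energy gained during each dilation phase yields a
lower bound for the energy outside a cover. -/
theorem growth {f : ℂ → ℝ} (hf : Integrable f) (h0 : ∀ z, 0 ≤ f z) (Stop : Prop)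
    {κ T₀ ρ Ce K : ℝ} (hκ : 0 ≤ κ) (hCe : 0 ≤ Ce) (hK : 0 ≤ K)
    (hz : ∃ z, α z ^ 2 + β z ^ 2 < 1 / 4)
    (hT : ∀ S, IsCover α β S → radSum S = ρ →
      T₀ - K * invSqSum S ≤ ∫ z in (ballUnion S)ᶜ, f z)
    (hH : ∀ S t, IsDilatable α β S t → t * radSum S ≤ ρ → Stop ∨
      κ * Real.log t - K * (invSqSum S - invSqSum (dilate t S)) - Ce ≤
        ∑ b ∈ S, ∫ z in ball b.1 (t * b.2) \ closedBall b.1 b.2, f z) (hS : IsCover α β S)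
    (hR : radSum S ≤ ρ) :
    Stop ∨ T₀ + κ * Real.log (ρ / radSum S) - K * invSqSum S - Ce * S.card ≤
      ∫ z in (ballUnion S)ᶜ, f z := by
  obtain ⟨n, hn⟩ : ∃ n, S.card ≤ n := ⟨_, le_rfl⟩
  induction n generalizing S with
  | zero =>
    exact absurd (hS.nonempty hz) (by simpa using hn)
  | succ n ih =>
    have R0 := hS.radSum_pos hz
    have merge : ∀ {S : Finset (ℂ × ℝ)}, IsCover α β S → radSum S ≤ ρ → S.card ≤ n + 1 →
        (∃ a ∈ S, ∃ b ∈ S, a ≠ b ∧ dist a.1 b.1 ≤ a.2 + b.2) → Stop ∨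
        T₀ + κ * Real.log (ρ / radSum S) - K * invSqSum S - Ce * (S.card - 1) ≤
          ∫ z in (ballUnion S)ᶜ, f z := by
      rintro S hS hR hn ⟨a, ha, b, hb, hab, hd⟩
      obtain ⟨S', h1, h2, h3, h4, h5⟩ := hS.exists_merge ha hb hab hd
      rcases ih h1 (h3.trans hR) (by omega) with h | h
      · exact Or.inl h
      · right
        have R1 := h1.radSum_pos hz
        have e1 : κ * Real.log (ρ / radSum S) ≤ κ * Real.log (ρ / radSum S') := by
          refine mul_le_mul_of_nonneg_left (Real.log_le_log (by
            have := hS.radSum_pos hz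
            exact div_pos (by linarith) (by linarith)) ?_) hκ
          exact div_le_div_of_nonneg_left (by linarith) (by linarith) h3
        have e2 : (S'.card : ℝ) + 1 ≤ S.card := by exact_mod_cast h2
        have e3 : ∫ z in (ballUnion S')ᶜ, f z ≤ ∫ z in (ballUnion S)ᶜ, f z :=
          setIntegral_mono_set hf.integrableOn (Eventually.of_forall h0)
            (LE.le.eventuallyLE (Set.compl_subset_compl.2 h5))
        nlinarith
    by_cases hpair : ∃ a ∈ S, ∃ b ∈ S, a ≠ b ∧ dist a.1 b.1 ≤ a.2 + b.2
    · rcases merge hS hR hn hpair with h | h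
      · exact Or.inl h
      · right; nlinarith
    · push Not at hpair
      have hcard : (1 : ℝ) ≤ S.card := by exact_mod_cast (hS.nonempty hz).card_pos
      rcases hR.eq_or_lt with hR | hR
      · right
        rw [← hR, div_self (by linarith), Real.log_one]
        have := hT S hS hR
        nlinarith
      set t := ρ / radSum S with ht
      have t1 : 1 < t := (one_lt_div (by linarith)).2 hR
      by_cases hsep : ∀ a ∈ S, ∀ b ∈ S, a ≠ b → t * (a.2 + b.2) ≤ dist a.1 b.1
      · have hd : IsDilatable α β S t := ⟨hS, t1, hsep⟩
        have htR : t * radSum S = ρ := div_mul_cancel₀ _ (by linarith)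
        rcases hH S t hd htR.le with h | h
        · exact Or.inl h
        · right
          have h1 := hT _ (hS.dilate t1.le) (by rw [radSum_dilate (by linarith), htR])
          have h2 := hd.sum_annuli_add_le hf h0
          nlinarith
      · push Not at hsep
        obtain ⟨a₀, ha₀, b₀, hb₀, hab₀, hd₀⟩ := hsep
        obtain ⟨⟨a, b⟩, hab, hmin⟩ := (S.offDiag).exists_min_image
          (fun p => dist p.1.1 p.2.1 / (p.1.2 + p.2.2))
          ⟨(a₀, b₀), Finset.mem_offDiag.2 ⟨ha₀, hb₀, hab₀⟩⟩
        obtain ⟨ha, hb, hab⟩ := Finset.mem_offDiag.1 hab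
        simp only at hmin ha hb hab
        have pos : ∀ a ∈ S, ∀ b ∈ S, 0 < a.2 + b.2 := fun a ha b hb => by
          linarith [hS.one_le a ha, hS.one_le b hb]
        set s := dist a.1 b.1 / (a.2 + b.2) with hs
        have s1 : 1 < s := (one_lt_div (pos a ha b hb)).2 (hpair a ha b hb hab)
        have st : s < t := (hmin (a₀, b₀) (Finset.mem_offDiag.2 ⟨ha₀, hb₀, hab₀⟩)).trans_lt
          ((div_lt_iff₀ (pos a₀ ha₀ b₀ hb₀)).2 hd₀)
        have hd : IsDilatable α β S s := ⟨hS, s1, fun a ha b hb hab =>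
          (le_div_iff₀ (pos a ha b hb)).1 (hmin (a, b) (Finset.mem_offDiag.2 ⟨ha, hb, hab⟩))⟩
        have hsR : s * radSum S ≤ ρ := by
          have : t * radSum S = ρ := div_mul_cancel₀ _ (by linarith)
          nlinarith
        rcases hH S s hd hsR with h | h
        · exact Or.inl h
        have s0 : s ≠ 0 := by linarith
        have hne : (a.1, s * a.2) ≠ (b.1, s * b.2) := fun e => by
          rw [Prod.mk.injEq] at e
          exact hab (Prod.ext e.1 (mul_left_cancel₀ s0 e.2))
        have hle : dist a.1 b.1 ≤ s * a.2 + s * b.2 := by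
          rw [← mul_add, hs, div_mul_cancel₀ _ (pos a ha b hb).ne']
        rcases merge (hS.dilate s1.le) (by rwa [radSum_dilate s0])
          ((card_dilate_le s).trans hn) ⟨_, mem_dilate.2 ⟨a, ha, rfl⟩, _,
            mem_dilate.2 ⟨b, hb, rfl⟩, hne, hle⟩ with h' | h'
        · exact Or.inl h'
        · right
          have h2 := hd.sum_annuli_add_le hf h0
          rw [radSum_dilate s0, mul_comm s, ← div_div, ← ht,
            Real.log_div (by linarith) s0] at h'
          have h3 : ((dilate s S).card : ℝ) ≤ S.card := by exact_mod_cast card_dilate_le s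
          nlinarith

end GinzburgLandau

namespace GinzburgLandau
open scoped ContDiff Topology

variable {c : ℝ} {α β : ℂ → ℝ} {S : Finset (ℂ × ℝ)}

/-- The total vorticity of a ball. -/
def deg (α β : ℂ → ℝ) (b : ℂ × ℝ) : ℝ := ∫ z in closedBall b.1 b.2, vor α β z

theorem two_pi_le_sum {ι : Type*} (s : Finset ι) (D : ι → ℝ)
    (hD : ∀ i ∈ s, ∃ n : ℤ, D i = 2 * Real.pi * n) (h0 : ∑ i ∈ s, D i = 0)
    (hne : ∃ i ∈ s, D i ≠ 0) : 2 * Real.pi ≤ ∑ i ∈ s, max (|D i| - Real.pi) 0 := by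
  classical
  have hpi := Real.pi_pos
  have hw : ∀ i ∈ s, D i ≠ 0 → Real.pi ≤ max (|D i| - Real.pi) 0 := fun i hi hne => by
    obtain ⟨n, hn⟩ := hD i hi
    have hn0 : n ≠ 0 := fun e => hne (by rw [hn, e]; simp)
    have : (1 : ℝ) ≤ |(n : ℝ)| := by exact_mod_cast Int.one_le_abs hn0
    refine le_max_of_le_left ?_
    rw [hn, abs_mul, abs_of_pos (by linarith)]
    nlinarith
  obtain ⟨i, hi, hi0⟩ := hne
  obtain ⟨j, hj, hij, hj0⟩ : ∃ j ∈ s, j ≠ i ∧ D j ≠ 0 := by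
    by_contra! hh
    rw [Finset.sum_eq_single_of_mem i hi hh] at h0
    exact hi0 h0
  have h1 : ∑ k ∈ ({i, j} : Finset ι), max (|D k| - Real.pi) 0 ≤ ∑ k ∈ s, max (|D k| - Real.pi) 0 :=
    Finset.sum_le_sum_of_subset_of_nonneg (by
      intro k hk; simp only [Finset.mem_insert, Finset.mem_singleton] at hk
      rcases hk with rfl | rfl <;> assumption) fun _ _ _ => le_max_right _ _
  rw [Finset.sum_pair hij.symm] at h1
  linarith [hw i hi hi0, hw j hj hj0]

theorem IsDilatable.disj {t : ℝ} (h : IsDilatable α β S t) :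
    ∀ a ∈ S, ∀ b ∈ S, a ≠ b → a.2 + b.2 < dist a.1 b.1 := fun a ha b hb hab => by
  nlinarith [h.sep a ha b hb hab, h.one_lt, h.one_le a ha, h.one_le b hb]

theorem IsDilatable.exists_int_deg {t : ℝ} (hα : ContDiff ℝ ∞ α) (hβ : ContDiff ℝ ∞ β)
    (h : IsDilatable α β S t) {b : ℂ × ℝ} (hb : b ∈ S) : ∃ n : ℤ, deg α β b = 2 * Real.pi * n :=
  (le_integral_annulus hα hβ b.1 (by linarith [h.one_le b hb])
    (by nlinarith [h.one_le b hb, h.one_lt]) (h.quarter_le hb)).1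

theorem IsDilatable.le_integral_annulus {t : ℝ} (hα : ContDiff ℝ ∞ α) (hβ : ContDiff ℝ ∞ β)
    (h : IsDilatable α β S t) {b : ℂ × ℝ} (hb : b ∈ S) :
    max (|deg α β b| - Real.pi) 0 * Real.log t
      - 16 * Real.pi * (b.2⁻¹ ^ 2 - (t * b.2)⁻¹ ^ 2) ≤
      ∫ z in ball b.1 (t * b.2) \ closedBall b.1 b.2, ee α β z := by
  have hr := h.one_le b hb
  have ht := h.one_lt
  have hrt : b.2 < t * b.2 := by nlinarith
  have h1 := (GinzburgLandau.le_integral_annulus hα hβ b.1 (by linarith) hrt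
    (h.quarter_le hb)).2
  rw [mul_div_cancel_right₀ _ (by linarith)] at h1
  rcases max_cases (|deg α β b| - Real.pi) 0 with hm | hm
  · rw [hm.1]; exact h1
  · rw [hm.1]
    have h2 : 0 ≤ ∫ z in ball b.1 (t * b.2) \ closedBall b.1 b.2, ee α β z :=
      integral_nonneg fun z => ee_nonneg z
    have h3 : (t * b.2)⁻¹ ^ 2 ≤ b.2⁻¹ ^ 2 := by
      have := inv_anti₀ (by linarith : 0 < b.2) hrt.le
      have : 0 ≤ (t * b.2)⁻¹ := inv_nonneg.2 (by linarith)
      gcongr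
    nlinarith [Real.pi_pos]

namespace TWSol

theorem integrable_ee (h : TWSol c α β) : Integrable (ee α β) := by
  have : ee α β = fun z => en α β z - (3 / 16) * pot 1 α β z ^ 2 := funext fun z => ee_eq z
  rw [this]
  exact h.integrable_en.sub (h.integrable_pot_sq.const_mul _)

theorem integral_ee (h : TWSol c α β) :
    ∫ z, ee α β z = (∫ z, en α β z) - (3 / 16) * ∫ z, pot 1 α β z ^ 2 := by
  simp_rw [ee_eq]
  rw [integral_sub h.integrable_en (h.integrable_pot_sq.const_mul _), integral_const_mul]

theorem integral_eq_sum_balls (hS : IsCover α β S)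
    (hd : ∀ a ∈ S, ∀ b ∈ S, a ≠ b → a.2 + b.2 < dist a.1 b.1) {g : ℂ → ℝ} (hg : Integrable g)
    (h0 : ∀ z, 1 / 4 ≤ α z ^ 2 + β z ^ 2 → g z = 0) :
    ∫ z, g z = ∑ b ∈ S, ∫ z in closedBall b.1 b.2, g z := by
  rw [← integral_biUnion_finset S (fun _ _ => measurableSet_closedBall)
    (fun a ha b hb hab => closedBall_disjoint_closedBall (hd a ha b hb hab))
    fun _ _ => hg.integrableOn]
  refine (setIntegral_eq_integral_of_forall_compl_eq_zero fun z hz => h0 z ?_).symm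
  by_contra! hh
  exact hz (mem_ballUnion.2 (hS.cov z hh))

theorem sum_deg (h : TWSol c α β) (hc : c ≤ 1 / 40) (hS : IsCover α β S)
    (hd : ∀ a ∈ S, ∀ b ∈ S, a ≠ b → a.2 + b.2 < dist a.1 b.1) : ∑ b ∈ S, deg α β b = 0 := by
  rw [← h.integral_vor hc, integral_eq_sum_balls hS hd (h.integrable_vor hc)
    fun z hz => vor_eq_zero h.sα h.sβ (by linarith)]
  rfl

/-- The momentum is given by the dipole moment of the degrees. -/
theorem abs_moment_sub_le (h : TWSol c α β) (hc : c ≤ 1 / 40) (hS : IsCover α β S)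
    (hd : ∀ a ∈ S, ∀ b ∈ S, a ≠ b → a.2 + b.2 < dist a.1 b.1) :
    |2 * (-(1 / 2) * ∫ z, mom α β Complex.I z) - ∑ b ∈ S, b.1.re * deg α β b| ≤
      240 * (∫ z, en α β z) + 10000 * cutC * radSum S * ∫ z, pot 1 α β z ^ 2 := by
  have h0 := h.pos
  have i1 := h.integrable_re_mul_vor hc
  have i2 := h.integrable_vor hc
  have h1 := h.integral_moment_vor hc 0
  simp only [add_zero] at h1
  have h2 : ∫ z, ed 1 α β z ≤ 4 * ∫ z, en α β z := by
    rw [← integral_const_mul]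
    exact integral_mono h.ied (h.integrable_en.const_mul _) fun z => ed_le_en z
  have h3 := integral_eq_sum_balls hS hd i1 fun z hz => by
    rw [vor_eq_zero h.sα h.sβ (by linarith), mul_zero]
  have hV : 0 ≤ ∫ z, pot 1 α β z ^ 2 := integral_nonneg fun z => sq_nonneg _
  have h4 : ∀ b ∈ S, |(∫ z in closedBall b.1 b.2, z.re * vor α β z) - b.1.re * deg α β b| ≤
      b.2 * (10000 * cutC * ∫ z, pot 1 α β z ^ 2) := fun b hb => by
    have hb1 := hS.one_le b hb
    rw [deg, ← integral_const_mul, ← integral_sub i1.integrableOn (i2.integrableOn.const_mul _)]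
    have e1 : |∫ z in closedBall b.1 b.2, (z.re * vor α β z - b.1.re * vor α β z)| ≤
        ∫ z in closedBall b.1 b.2, b.2 * (10000 * cutC * pot 1 α β z ^ 2) := by
      rw [← Real.norm_eq_abs]
      refine norm_integral_le_of_norm_le
        ((h.integrable_pot_sq.const_mul (10000 * cutC)).const_mul b.2).integrableOn ?_
      refine (ae_restrict_mem measurableSet_closedBall).mono fun z hz => ?_
      rw [Real.norm_eq_abs, ← sub_mul]
      refine abs_mul_le ?_ (h.abs_vor_le (by linarith) z)
      rw [← Complex.sub_re]
      exact (Complex.abs_re_le_norm _).trans (by simpa [dist_eq_norm] using hz)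
    refine e1.trans ?_
    rw [integral_const_mul, integral_const_mul]
    have e2 : ∫ z in closedBall b.1 b.2, pot 1 α β z ^ 2 ≤ ∫ z, pot 1 α β z ^ 2 :=
      setIntegral_le_integral h.integrable_pot_sq (Eventually.of_forall fun z => sq_nonneg _)
    have := one_le_cutC
    gcongr
  have h5 : |(∫ z, z.re * vor α β z) - ∑ b ∈ S, b.1.re * deg α β b| ≤
      10000 * cutC * radSum S * ∫ z, pot 1 α β z ^ 2 := by
    rw [h3, ← Finset.sum_sub_distrib]
    refine (Finset.abs_sum_le_sum_abs _ _).trans ((Finset.sum_le_sum h4).trans (le_of_eq ?_))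
    rw [← Finset.sum_mul, radSum]; ring
  have h6 := abs_sub_le (2 * (-(1 / 2) * ∫ z, mom α β Complex.I z)) (∫ z, z.re * vor α β z)
    (∑ b ∈ S, b.1.re * deg α β b)
  rw [abs_sub_comm] at h1
  have e : 2 * (-(1 / 2) * ∫ z, mom α β Complex.I z) = -∫ z, mom α β Complex.I z := by ring
  rw [e] at h6 ⊢
  linarith

theorem exists_deg_ne_zero (h : TWSol c α β) (hc : c ≤ 1 / 40) (hS : IsCover α β S)
    (hd : ∀ a ∈ S, ∀ b ∈ S, a ≠ b → a.2 + b.2 < dist a.1 b.1)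
    (hp : 240 * (∫ z, en α β z) + 10000 * cutC * radSum S * (∫ z, pot 1 α β z ^ 2) <
      2 * (-(1 / 2) * ∫ z, mom α β Complex.I z)) : ∃ b ∈ S, deg α β b ≠ 0 := by
  by_contra! hh
  have h1 := h.abs_moment_sub_le hc hS hd
  rw [Finset.sum_eq_zero fun b hb => by rw [hh b hb, mul_zero], sub_zero] at h1
  linarith [le_abs_self (2 * (-(1 / 2) * ∫ z, mom α β Complex.I z))]

theorem radSum_bound {R Rm p : ℝ} (hR : R ≤ Rm)
    (hp : 240 * (∫ z, en α β z) + 10000 * cutC * Rm * (∫ z, pot 1 α β z ^ 2) < p) :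
    240 * (∫ z, en α β z) + 10000 * cutC * R * (∫ z, pot 1 α β z ^ 2) < p := by
  have hV : 0 ≤ ∫ z, pot 1 α β z ^ 2 := integral_nonneg fun z => sq_nonneg _
  have h1 : 10000 * cutC * R * (∫ z, pot 1 α β z ^ 2) ≤
      10000 * cutC * Rm * (∫ z, pot 1 α β z ^ 2) := by
    have := one_le_cutC
    gcongr
  linarith

/-- Logarithmic lower bound for the energy outside a cover. -/
theorem le_integral_compl (h : TWSol c α β) (hc : c ≤ 1 / 40)
    (hz : ∃ z, α z ^ 2 + β z ^ 2 < 1 / 4) {Rm : ℝ}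
    (hp : 240 * (∫ z, en α β z) + 10000 * cutC * Rm * (∫ z, pot 1 α β z ^ 2) <
      2 * (-(1 / 2) * ∫ z, mom α β Complex.I z)) (hS : IsCover α β S) (hR : radSum S ≤ Rm) :
    2 * Real.pi * Real.log (Rm / radSum S) - 16 * Real.pi * invSqSum S ≤
      ∫ z in (ballUnion S)ᶜ, ee α β z := by
  have hpi := Real.pi_pos
  have h1 := growth (κ := 2 * Real.pi) (T₀ := 0) (ρ := Rm) (Ce := 0) (K := 16 * Real.pi)
    h.integrable_ee ee_nonneg False (by positivity) le_rfl (by positivity) hz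
    (fun S _ _ => ?_) (fun S t hd htR => ?_) hS hR
  · rcases h1 with h1 | h1
    · exact h1.elim
    · linarith
  · have h2 : 0 ≤ ∫ z in (ballUnion S)ᶜ, ee α β z := integral_nonneg fun z => ee_nonneg z
    have := invSqSum_nonneg (S := S)
    nlinarith
  · right
    have h3 := Finset.sum_le_sum fun b hb => hd.le_integral_annulus h.sα h.sβ hb
    rw [Finset.sum_sub_distrib, ← Finset.sum_mul, ← Finset.mul_sum, Finset.sum_sub_distrib] at h3
    have hR0 := hd.toIsCover.radSum_pos hz
    have h4 := h.exists_deg_ne_zero hc hd.toIsCover hd.disj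
      (radSum_bound (by nlinarith [hd.one_lt] : radSum S ≤ Rm) hp)
    have h5 := two_pi_le_sum S (deg α β) (fun b hb => hd.exists_int_deg h.sα h.sβ hb)
      (h.sum_deg hc hd.toIsCover hd.disj) h4
    have h6 := mul_le_mul_of_nonneg_right h5 (Real.log_nonneg hd.one_lt.le)
    rw [invSqSum, invSqSum, sum_dilate (by linarith [hd.one_lt])]
    linarith

end TWSol

end GinzburgLandau

namespace GinzburgLandau
open scoped ContDiff Topology

variable {c : ℝ} {α β : ℂ → ℝ} {S : Finset (ℂ × ℝ)}

/-- Travelling waves with small energy compared with their momentum `p`, and with a zero. -/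
structure QM (Λ p c : ℝ) (α β : ℂ → ℝ) : Prop extends TWSol c α β where
  mom_eq : -(1 / 2) * ∫ z, mom α β Complex.I z = p
  energy_le : ∫ z, en α β z ≤ 2 * Real.pi * Real.log p + Λ
  exists_lt : ∃ z, α z ^ 2 + β z ^ 2 < 1 / 4

theorem eventually_mul_pow_log_le (A : ℝ) (k : ℕ) :
    ∀ᶠ p : ℝ in atTop, A * (1 + Real.log p) ^ k ≤ p := by
  have h1 := (Real.isLittleO_pow_log_id_atTop (n := k)).bound
    (show (0 : ℝ) < 1 / ((|A| + 1) * 2 ^ k) by positivity)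
  have h2 := Real.tendsto_log_atTop.eventually_ge_atTop 1
  filter_upwards [h1, h2, eventually_ge_atTop 0] with p h1 h2 h3
  have hL : 0 ≤ Real.log p ^ k := by positivity
  rw [id, Real.norm_of_nonneg hL, Real.norm_of_nonneg h3, div_mul_eq_mul_div, one_mul,
    le_div_iff₀ (by positivity)] at h1
  calc A * (1 + Real.log p) ^ k ≤ |A| * (2 * Real.log p) ^ k := by
        gcongr
        · exact le_abs_self A
        · linarith
    _ = |A| * (Real.log p ^ k * 2 ^ k) := by rw [mul_pow]; ring
    _ ≤ (|A| + 1) * (Real.log p ^ k * 2 ^ k) := by gcongr; linarith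
    _ ≤ p := by linarith

theorem QM.energy_le' {Λ p : ℝ} (h : QM Λ p c α β) (hΛ : 0 < Λ) (hp : 1 ≤ p) :
    ∫ z, en α β z ≤ (7 + Λ) * (1 + Real.log p) := by
  have h1 := h.energy_le
  have h2 := Real.log_nonneg hp
  nlinarith [Real.pi_lt_d2, Real.pi_pos, mul_nonneg hΛ.le h2]

theorem QM.potential_eq {Λ p : ℝ} (h : QM Λ p c α β) : ∫ z, pot 1 α β z ^ 2 = 2 * c * p := by
  rw [h.integral_pot_sq, h.mom_eq]

theorem QM.speed_mul_le {Λ p : ℝ} (h : QM Λ p c α β) : c * p ≤ ∫ z, en α β z := by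
  rw [← h.mom_eq]; exact h.mul_momentum_le

theorem TWSol.exists_isCover (h : TWSol c α β) (hc : c ≤ 1 / 40) {s : ℝ} (hs : 1 ≤ s) :
    ∃ S : Finset (ℂ × ℝ), IsCover α β S ∧ (∀ b ∈ S, b.2 = 2 * s) ∧
      (S.card : ℝ) * muZ ≤ ∫ z, pot 1 α β z ^ 2 := by
  classical
  obtain ⟨t, h1, h2, h3⟩ := h.exists_cover hc hs
  have hinj : Function.Injective fun b : ℂ => (b, 2 * s) := fun a b hab => (Prod.mk.inj hab).1
  refine ⟨t.image fun b => (b, 2 * s), ⟨fun b hb => ?_, fun z hz => ?_, fun b hb => ?_⟩,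
    fun b hb => ?_, ?_⟩
  · obtain ⟨a, -, rfl⟩ := Finset.mem_image.1 hb
    simp only; linarith
  · obtain ⟨a, ha, hza⟩ := h3 z hz
    exact ⟨_, Finset.mem_image_of_mem _ ha, hza⟩
  · obtain ⟨a, ha, rfl⟩ := Finset.mem_image.1 hb
    exact ⟨a, h1 a ha, by simp only [dist_self]; linarith⟩
  · obtain ⟨a, -, rfl⟩ := Finset.mem_image.1 hb
    rfl
  · rwa [Finset.card_image_of_injective _ hinj]

/-- The potential energy is bounded independently of the momentum. -/
theorem exists_potential_bound {Λ : ℝ} (hΛ : 0 < Λ) : ∃ V₀ : ℝ, 1 ≤ V₀ ∧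
    ∀ᶠ p : ℝ in atTop, ∀ c α β, QM Λ p c α β → c ≤ 1 / 40 ∧ ∫ z, pot 1 α β z ^ 2 ≤ V₀ := by
  have hμ := muZ_pos
  have hpi := Real.pi_pos
  have hC := one_le_cutC
  set K := 10000 * cutC with hK
  have hK0 : 1 ≤ K := by rw [hK]; linarith
  set a := muZ / (25600 * K) with ha
  have ha0 : 0 < a := by positivity
  refine ⟨max 1 (16 * (Λ - 2 * Real.pi * Real.log a + 1 / 16 +
    4 * Real.pi * Real.log (64 * Real.pi))), le_max_left _ _, ?_⟩
  filter_upwards [eventually_ge_atTop 1, eventually_mul_pow_log_le (241 * (7 + Λ)) 1,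
    eventually_mul_pow_log_le (9 * (7 + Λ) ^ 2 / a) 2] with p hp1 hp2 hp3 c α β h
  have hL := Real.log_nonneg hp1
  have hE := h.energy_le' hΛ hp1
  set X := (7 + Λ) * (1 + Real.log p) with hX
  have hX1 : 1 ≤ X := by nlinarith [mul_nonneg hΛ.le hL]
  have hE' := h.energy_le
  set E := ∫ z, en α β z with hE_def
  have hcp := h.speed_mul_le
  have hV := h.potential_eq
  have hXp : 241 * X ≤ p := by rw [pow_one] at hp2; linarith
  have hc : c ≤ 1 / 40 := by
    by_contra! hh
    have := mul_lt_mul_of_pos_right hh (by linarith : 0 < p)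
    linarith
  refine ⟨hc, le_max_of_le_right ?_⟩
  obtain ⟨S, hS, hr, hn⟩ := h.toTWSol.exists_isCover hc (s := 12800) (by norm_num)
  have hcard : (1 : ℝ) ≤ S.card := by exact_mod_cast (hS.nonempty h.exists_lt).card_pos
  set V := ∫ z, pot 1 α β z ^ 2 with hV_def
  have hV2 : V ≤ 2 * X := by linarith
  have hV0 : 0 < V := lt_of_lt_of_le (by positivity) hn
  have hR : radSum S = 25600 * S.card := by
    rw [radSum, Finset.sum_congr rfl hr, Finset.sum_const, nsmul_eq_mul]; ring
  have hI : 16 * Real.pi * invSqSum S ≤ V / 16 := by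
    have e : invSqSum S = S.card * (2 * 12800 : ℝ)⁻¹ ^ 2 := by
      rw [invSqSum, Finset.sum_congr rfl fun b hb => by rw [hr b hb], Finset.sum_const,
        nsmul_eq_mul]
    have : 16 * Real.pi * invSqSum S = S.card * muZ / 16 := by
      rw [e, muZ]; ring
    linarith
  have hRm : p * a / (1 + V) ^ 2 ≤ p / (K * (1 + V)) / radSum S := by
    rw [hR, div_div, ha, mul_div_assoc', div_div]
    rw [div_le_div_iff₀ (by positivity) (by positivity)]
    have : muZ * S.card ≤ 1 + V := by linarith
    calc p * muZ * (K * (1 + V) * (25600 * S.card))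
        = p * (25600 * K) * (1 + V) * (muZ * S.card) := by ring
      _ ≤ p * (25600 * K) * (1 + V) * (1 + V) := by gcongr
      _ = _ := by ring
  clear_value a
  have hone : 1 ≤ p * a / (1 + V) ^ 2 := by
    rw [le_div_iff₀ (by positivity)]
    have h1 : 9 * X ^ 2 ≤ p * a := by
      have : 9 * (7 + Λ) ^ 2 / a * (1 + Real.log p) ^ 2 = 9 * X ^ 2 / a := by rw [hX]; ring
      rw [this, div_le_iff₀ ha0] at hp3
      exact hp3
    have h2 : 1 + V ≤ 3 * X := by linarith
    have h3 : (1 + V) ^ 2 ≤ (3 * X) ^ 2 := by gcongr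
    linarith
  have hR0 : 0 < radSum S := by rw [hR]; positivity
  have hRle : radSum S ≤ p / (K * (1 + V)) := (one_le_div hR0).1 (hone.trans hRm)
  have key := h.toTWSol.le_integral_compl hc h.exists_lt (Rm := p / (K * (1 + V))) ?_ hS hRle
  · have h1 : ∫ z in (ballUnion S)ᶜ, ee α β z ≤ E - (3 / 16) * V := by
      rw [hE_def, hV_def, ← h.integral_ee]
      exact setIntegral_le_integral h.integrable_ee (Eventually.of_forall fun z => ee_nonneg z)
    have h2 : Real.log p + Real.log a - 2 * Real.log (1 + V) ≤
        Real.log (p / (K * (1 + V)) / radSum S) := by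
      refine le_trans (le_of_eq ?_) (Real.log_le_log (by positivity) hRm)
      rw [Real.log_div (by positivity) (by positivity), Real.log_mul (by positivity) ha0.ne',
        Real.log_pow]
      norm_num
    have h3 : 4 * Real.pi * Real.log (1 + V) ≤ (1 + V) / 16 +
        4 * Real.pi * Real.log (64 * Real.pi) := by
      have h4 := Real.log_le_sub_one_of_pos (show 0 < (1 + V) / (64 * Real.pi) by positivity)
      rw [Real.log_div (by positivity) (by positivity)] at h4
      have h5 := mul_le_mul_of_nonneg_left h4 (by positivity : 0 ≤ 4 * Real.pi)
      have : 4 * Real.pi * ((1 + V) / (64 * Real.pi)) = (1 + V) / 16 := by field_simp; ring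
      linarith
    have h4 := mul_le_mul_of_nonneg_left h2 (by positivity : 0 ≤ 2 * Real.pi)
    linarith
  · rw [h.mom_eq, ← hK]
    have : K * (p / (K * (1 + V))) * V ≤ p := by
      have : K * (p / (K * (1 + V))) * V = p * (V / (1 + V)) := by field_simp
      rw [this]
      have : V / (1 + V) ≤ 1 := (div_le_one (by positivity)).2 (by linarith)
      exact mul_le_of_le_one_right (by linarith) this
    rw [← hE_def, ← hV_def]
    linarith

end GinzburgLandau

namespace GinzburgLandau
open scoped ContDiff Topology

variable {c : ℝ} {α β : ℂ → ℝ} {S : Finset (ℂ × ℝ)}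

/-- The definite energy of a dyadic annulus around a zero. -/
def etaZ : ℝ := muZ / (512 * cutC)

theorem etaZ_pos : 0 < etaZ := by
  have := one_le_cutC
  have := muZ_pos
  unfold etaZ; positivity

theorem etaZ_le : etaZ ≤ 3 * Real.pi := by
  have := one_le_cutC
  have := Real.pi_pos
  rw [etaZ, muZ, div_le_iff₀ (by linarith)]
  nlinarith

namespace TWSol

theorem etaZ_le_integral_annulus (h : TWSol c α β) (hc : c ≤ 1 / 40) {x b : ℂ}
    (hx : α x ^ 2 + β x ^ 2 ≤ 1 / 4) {R : ℝ} (hR : dist x b + 1 ≤ R)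
    (hcR : 384 * Real.pi * cutC * (c * R) ^ 2 ≤ 2 * muZ) :
    etaZ ≤ ∫ z in closedBall b (2 * R) \ ball b R, ee α β z := by
  have hα := h.sα
  have hβ := h.sβ
  have hv := h.gauge (by linarith)
  have hC := one_le_cutC
  have hR0 : 0 < R := by linarith [dist_nonneg (x := x) (y := b)]
  have h1 := hv.le_integral_pot_sq (x := x) (by rw [gauge_normSq]; exact hx)
  have h2 := setIntegral_mono_ball (x := b) (R := R) (s := closedBall x 1)
    ((contDiff_pot (m := 1 + c ^ 2 / 4) hv.sα hv.sβ).continuous.pow 2)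
    (fun z => sq_nonneg _) (closedBall_subset_closedBall' (by linarith))
  have h3 := hv.pohozaev b hR0
  set A := closedBall b (2 * R) \ ball b R with hA
  have h4 : ∫ z in A, ed (1 + c ^ 2 / 4) (gaugeRe c α β) (gaugeIm c α β) z ≤
      ∫ z in A, (32 * ee α β z + 3 * c ^ 2) := by
    have mA : MeasurableSet A := measurableSet_annulus b R (2 * R)
    refine setIntegral_mono_on
      (integrableOn_annulus (contDiff_ed hv.sα hv.sβ).continuous b R (2 * R))
      (integrableOn_annulus (by fun_prop) b R (2 * R)) mA
      fun z _ => ?_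
    linarith [h.ed_gauge_le (by linarith) z, ed_le_ee (α := α) (β := β) z]
  have hfin : volume A ≠ ⊤ :=
    ((measure_mono Set.sdiff_subset).trans_lt measure_closedBall_lt_top).ne
  rw [integral_add (integrableOn_annulus (by fun_prop) b R (2 * R))
    (integrableOn_const hfin), integral_const_mul, setIntegral_const, smul_eq_mul] at h4
  have h5 : volume.real A ≤ Real.pi * (2 * R) ^ 2 := by
    rw [← volume_real_closedBall b (by linarith)]
    exact measureReal_mono Set.sdiff_subset measure_closedBall_lt_top.ne
  have h6 : volume.real A * (3 * c ^ 2) ≤ Real.pi * (2 * R) ^ 2 * (3 * c ^ 2) := by gcongr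
  have h7 := mul_le_mul_of_nonneg_left (h4.trans (add_le_add_right h6 _))
    (by positivity : 0 ≤ 32 * cutC)
  rw [etaZ, div_le_iff₀ (by positivity)]
  have h8 : (1 / 4) * (Real.pi * (1 / 400) ^ 2) = 4 * muZ := by unfold muZ; ring
  simp only [Pi.pow_apply] at h2
  rw [← hA] at h7
  have e (I : ℝ) : 32 * cutC * (32 * I + Real.pi * (2 * R) ^ 2 * (3 * c ^ 2)) =
    1024 * cutC * I + 384 * Real.pi * cutC * (c * R) ^ 2 := by ring
  rw [e] at h7
  linarith

/-- A ball meeting the zero set carries a definite energy at every larger scale. -/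
theorem le_integral_annulus_of_meets (h : TWSol c α β) (hc : c ≤ 1 / 40) {x b : ℂ}
    (hx : α x ^ 2 + β x ^ 2 ≤ 1 / 4) {r t : ℝ} (hr : 1 ≤ r) (ht : 1 < t) (hd : dist x b ≤ r)
    (hcR : 384 * Real.pi * cutC * (c * (t * r)) ^ 2 ≤ 2 * muZ) :
    etaZ / 3 * Real.log t - etaZ ≤ ∫ z in ball b (t * r) \ closedBall b r, ee α β z := by
  have hα := h.sα
  have hβ := h.sβ
  have h0 := h.pos
  have hη := etaZ_pos
  have hC := one_le_cutC
  have hnn : 0 ≤ ∫ z in ball b (t * r) \ closedBall b r, ee α β z :=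
    integral_nonneg fun z => ee_nonneg z
  have hlog := Real.log_pos ht
  set k := ⌊Real.log t / 3⌋₊ with hk
  have hk1 : (k : ℝ) ≤ Real.log t / 3 := Nat.floor_le (by positivity)
  have hk2 : Real.log t / 3 < k + 1 := Nat.lt_floor_add_one _
  rcases Nat.eq_zero_or_pos k with hk0 | hk0
  · rw [hk0] at hk2
    push_cast at hk2
    nlinarith
  have ht2 : 2 * (4 : ℝ) ^ k < t := by
    have e1 : Real.exp (3 * k) ≤ t := by
      rw [← Real.le_log_iff_exp_le (by linarith)]; linarith
    have e2 : (8 : ℝ) < Real.exp 3 := by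
      have : Real.exp 3 = Real.exp 1 ^ 3 := by rw [← Real.exp_nat_mul]; norm_num
      rw [this]
      have := Real.exp_one_gt_d9
      calc (8 : ℝ) = 2 ^ 3 := by norm_num
        _ < _ := by gcongr; linarith
    have e3 : Real.exp (3 * k) = Real.exp 3 ^ k := by rw [mul_comm, Real.exp_nat_mul]
    have e4 : (8 : ℝ) ^ k < Real.exp 3 ^ k := pow_lt_pow_left₀ e2 (by norm_num) hk0.ne'
    have e5 : 2 * (4 : ℝ) ^ k ≤ 8 ^ k := by
      have : (8 : ℝ) ^ k = 2 ^ k * 4 ^ k := by rw [← mul_pow]; norm_num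
      rw [this]
      have : (2 : ℝ) ^ 1 ≤ 2 ^ k := pow_le_pow_right₀ (by norm_num) hk0
      gcongr
      linarith
    linarith
  have hs := sum_annuli_le (contDiff_ee hα hβ).continuous ee_nonneg b (by linarith : 0 < 2 * r) k
  have h4 : ∀ i ∈ Finset.range k, etaZ ≤
      ∫ z in closedBall b (2 * (2 * r * 4 ^ i)) \ ball b (2 * r * 4 ^ i), ee α β z := fun i hi => by
    have hi4 : (1 : ℝ) ≤ 4 ^ i := one_le_pow₀ (by norm_num)
    refine h.etaZ_le_integral_annulus hc hx (by nlinarith) (le_trans ?_ hcR)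
    have : (4 : ℝ) ^ i ≤ 4 ^ k := pow_le_pow_right₀ (by norm_num) (Finset.mem_range.1 hi).le
    have : 2 * r * 4 ^ i ≤ t * r := by nlinarith
    have := Real.pi_pos
    gcongr
  have h5 := Finset.sum_le_sum h4
  rw [Finset.sum_const, Finset.card_range, nsmul_eq_mul] at h5
  have h6 : ∫ z in closedBall b (2 * r * 4 ^ k) \ ball b (2 * r), ee α β z ≤
      ∫ z in ball b (t * r) \ closedBall b r, ee α β z := by
    refine setIntegral_mono_set h.integrable_ee.integrableOn (Eventually.of_forall ee_nonneg)
      (LE.le.eventuallyLE fun z hz => ?_)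
    simp only [Set.mem_sdiff, mem_ball, mem_closedBall, not_lt, not_le] at hz ⊢
    exact ⟨by nlinarith, by linarith⟩
  nlinarith

/-- Either few balls suffice to cover, or there is an additional energy gain. -/
theorem growth_or (h : TWSol c α β) (hc : c ≤ 1 / 40)
    (hz : ∃ z, α z ^ 2 + β z ^ 2 < 1 / 4) {Rm ρ : ℝ}
    (hp : 240 * (∫ z, en α β z) + 10000 * cutC * Rm * (∫ z, pot 1 α β z ^ 2) <
      2 * (-(1 / 2) * ∫ z, mom α β Complex.I z)) (hρ : ρ ≤ Rm)
    (hcρ : 384 * Real.pi * cutC * (c * ρ) ^ 2 ≤ 2 * muZ)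
    (hS : IsCover α β S) (hR : radSum S ≤ ρ) :
    (∃ S', IsCover α β S' ∧ S'.card ≤ 2 ∧ radSum S' ≤ ρ) ∨
    2 * Real.pi * Real.log (Rm / ρ) + (2 * Real.pi + etaZ / 3) * Real.log (ρ / radSum S)
      - 16 * Real.pi * invSqSum S - etaZ * S.card ≤ ∫ z in (ballUnion S)ᶜ, ee α β z := by
  have hpi := Real.pi_pos
  have hη := etaZ_pos
  have hη2 := etaZ_le
  have hC := one_le_cutC
  have h0 := h.pos
  refine growth h.integrable_ee ee_nonneg _ (by positivity) hη.le (by positivity) hz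
    (fun S hS hR => ?_) (fun S t hd htR => ?_) hS hR
  · have := h.le_integral_compl hc hz hp hS (by rw [hR]; exact hρ)
    rwa [hR] at this
  have ht := hd.one_lt
  have hR0 := hd.toIsCover.radSum_pos hz
  have hRρ : radSum S ≤ ρ := by nlinarith
  by_cases hcard : S.card ≤ 2
  · exact Or.inl ⟨S, hd.toIsCover, hcard, hRρ⟩
  right
  have hL := Real.log_pos ht
  have hsum : ∀ F : ℂ × ℝ → ℝ, ∑ b ∈ S, (max (|deg α β b| - Real.pi) 0 * Real.log t
      - 16 * Real.pi * (b.2⁻¹ ^ 2 - (t * b.2)⁻¹ ^ 2) + F b) =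
      (∑ b ∈ S, max (|deg α β b| - Real.pi) 0) * Real.log t -
        16 * Real.pi * (invSqSum S - invSqSum (dilate t S)) + ∑ b ∈ S, F b := fun F => by
    rw [Finset.sum_add_distrib, Finset.sum_sub_distrib, ← Finset.sum_mul, ← Finset.mul_sum,
      Finset.sum_sub_distrib, invSqSum, invSqSum, sum_dilate (by linarith)]
  by_cases hall : ∀ b ∈ S, deg α β b ≠ 0
  · have h1 := Finset.sum_le_sum fun b hb => hd.le_integral_annulus h.sα h.sβ hb
    have h2 := hsum fun _ => 0
    simp only [add_zero, Finset.sum_const_zero] at h2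
    rw [h2] at h1
    have h3 : 3 * Real.pi ≤ ∑ b ∈ S, max (|deg α β b| - Real.pi) 0 := by
      have h4 : ∀ b ∈ S, Real.pi ≤ max (|deg α β b| - Real.pi) 0 := fun b hb => by
        obtain ⟨n, hn⟩ := hd.exists_int_deg h.sα h.sβ hb
        have hn0 : n ≠ 0 := fun e => hall b hb (by rw [hn, e]; simp)
        have : (1 : ℝ) ≤ |(n : ℝ)| := by exact_mod_cast Int.one_le_abs hn0
        refine le_max_of_le_left ?_
        rw [hn, abs_mul, abs_of_pos (by linarith)]
        nlinarith
      have h5 := Finset.sum_le_sum h4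
      rw [Finset.sum_const, nsmul_eq_mul] at h5
      have h6 : (3 : ℝ) ≤ S.card := by exact_mod_cast (by omega : 3 ≤ S.card)
      nlinarith
    nlinarith
  · push Not at hall
    obtain ⟨b₀, hb₀, hdeg⟩ := hall
    have h5 := two_pi_le_sum S (deg α β) (fun b hb => hd.exists_int_deg h.sα h.sβ hb)
      (h.sum_deg hc hd.toIsCover hd.disj)
      (h.exists_deg_ne_zero hc hd.toIsCover hd.disj (radSum_bound (hRρ.trans hρ) hp))
    classical
    have h1 : ∑ b ∈ S, (max (|deg α β b| - Real.pi) 0 * Real.log t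
      - 16 * Real.pi * (b.2⁻¹ ^ 2 - (t * b.2)⁻¹ ^ 2) +
        if b₀ = b then etaZ / 3 * Real.log t - etaZ else 0) ≤
        ∑ b ∈ S, ∫ z in ball b.1 (t * b.2) \ closedBall b.1 b.2, ee α β z := by
      refine Finset.sum_le_sum fun b hb => ?_
      split_ifs with he
      · subst he
        have hr := hd.one_le b₀ hb₀
        obtain ⟨x, hx, hxb⟩ := hd.meets b₀ hb₀
        have h6 := h.le_integral_annulus_of_meets hc hx.le hr ht hxb (le_trans (by
          have : t * b₀.2 ≤ ρ := by nlinarith [hd.toIsCover.le_radSum hb₀]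
          gcongr) hcρ)
        rw [hdeg, abs_zero, max_eq_right (by linarith)]
        have h3 : (t * b₀.2)⁻¹ ^ 2 ≤ b₀.2⁻¹ ^ 2 := by
          have := inv_anti₀ (by linarith : 0 < b₀.2) (by nlinarith : b₀.2 ≤ t * b₀.2)
          have : 0 ≤ (t * b₀.2)⁻¹ := inv_nonneg.2 (by nlinarith)
          gcongr
        nlinarith
      · rw [add_zero]
        exact hd.le_integral_annulus h.sα h.sβ hb
    rw [hsum, Finset.sum_ite_eq, if_pos hb₀] at h1
    nlinarith

end TWSol

end GinzburgLandau

namespace GinzburgLandau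
open scoped ContDiff Topology

variable {c : ℝ} {α β : ℂ → ℝ} {S : Finset (ℂ × ℝ)}

theorem QM.integral_ee_le {Λ p : ℝ} (h : QM Λ p c α β) :
    ∫ z, ee α β z ≤ 2 * Real.pi * Real.log p + Λ :=
  (integral_mono h.integrable_ee h.integrable_en ee_le_en).trans h.energy_le

/-- The zero set is covered by at most two balls of bounded radius. -/
theorem exists_two_balls {Λ V₀ : ℝ} (hΛ : 0 < Λ) (hV₀ : 1 ≤ V₀) : ∃ ρ : ℝ, 1 ≤ ρ ∧
    ∀ᶠ p : ℝ in atTop, ∀ c α β, QM Λ p c α β → c ≤ 1 / 40 → ∫ z, pot 1 α β z ^ 2 ≤ V₀ →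
      ∃ S, IsCover α β S ∧ S.card ≤ 2 ∧ radSum S ≤ ρ := by
  have hμ := muZ_pos
  have hpi := Real.pi_pos
  have hC := one_le_cutC
  have hη := etaZ_pos
  set K := 10000 * cutC with hK
  have hK0 : 1 ≤ K := by rw [hK]; linarith
  set N := V₀ / muZ with hN
  have hN0 : 0 < N := by positivity
  set M := 1 + 2 * N with hM
  have hM1 : 1 ≤ M := by linarith
  set Y := Λ + 2 * Real.pi * Real.log (K * V₀) + 2 * Real.pi * Real.log M +
    16 * Real.pi * N + etaZ * N with hY
  set X := (|Y| + 1) / (etaZ / 3) with hX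
  have hX0 : 0 ≤ X := by positivity
  have hXY : Y < etaZ / 3 * X := by
    rw [hX, mul_div_cancel₀ _ (by positivity)]; linarith [le_abs_self Y]
  set ρ := M * Real.exp X with hρ
  have hMρ : M ≤ ρ := le_mul_of_one_le_right (by linarith) (Real.one_le_exp hX0)
  refine ⟨ρ, hM1.trans hMρ, ?_⟩
  have hρ0 : 0 < ρ := by linarith
  filter_upwards [eventually_mul_pow_log_le (241 * (7 + Λ)) 1, eventually_ge_atTop (K * V₀ * ρ),
    eventually_ge_atTop 1,
    eventually_ge_atTop (384 * Real.pi * cutC * (V₀ * ρ) ^ 2 / (2 * muZ))]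
    with p hp1 hp2 hp3 hp4 c α β h hc hV
  have hp0 : 0 < p := by linarith
  have h0 := h.pos
  have hE := h.energy_le' hΛ hp3
  have hcp : c * p ≤ V₀ / 2 := by have := h.potential_eq; linarith
  obtain ⟨S, hS, hr, hcard⟩ := h.toTWSol.exists_isCover hc le_rfl
  have hcardN : (S.card : ℝ) ≤ N := by
    rw [hN, le_div_iff₀ hμ]; exact hcard.trans hV
  have hrad : radSum S = 2 * S.card := by
    rw [radSum, Finset.sum_congr rfl fun b hb => hr b hb]; simp [mul_comm]
  have hinv : invSqSum S ≤ N := by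
    rw [invSqSum, Finset.sum_congr rfl fun b hb => by rw [hr b hb]]
    simp only [Finset.sum_const, nsmul_eq_mul]
    norm_num; linarith
  have hradM : radSum S ≤ M := by rw [hrad]; linarith
  have hrad1 := hS.radSum_pos h.exists_lt
  have hKV : 0 < K * V₀ := by positivity
  have hen0 : 0 ≤ ∫ z, en α β z := integral_nonneg fun z => en_nonneg z
  have g1 : 240 * (∫ z, en α β z) + 10000 * cutC * (p / (K * V₀)) * (∫ z, pot 1 α β z ^ 2) <
      2 * (-(1 / 2) * ∫ z, mom α β Complex.I z) := by
    rw [h.mom_eq, ← hK]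
    have h2 : K * (p / (K * V₀)) * (∫ z, pot 1 α β z ^ 2) ≤ K * (p / (K * V₀)) * V₀ := by
      gcongr
    have h3 : K * (p / (K * V₀)) * V₀ = p := by field_simp
    have hL := Real.log_nonneg hp3
    rw [pow_one] at hp1
    nlinarith
  have g2 : ρ ≤ p / (K * V₀) := by rw [le_div_iff₀ hKV]; linarith
  have g3 : 384 * Real.pi * cutC * (c * ρ) ^ 2 ≤ 2 * muZ := by
    rw [div_le_iff₀ (by positivity)] at hp4
    have h2 : c * ρ * p ≤ V₀ * ρ := by nlinarith
    have h3 : 384 * Real.pi * cutC * (c * ρ * p) ^ 2 ≤ p * (2 * muZ) * p := by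
      calc 384 * Real.pi * cutC * (c * ρ * p) ^ 2
          ≤ 384 * Real.pi * cutC * (V₀ * ρ) ^ 2 := by gcongr
        _ ≤ p * (2 * muZ) * 1 := by linarith
        _ ≤ p * (2 * muZ) * p := by gcongr
    have h4 : (384 * Real.pi * cutC * (c * ρ) ^ 2) * p ^ 2 ≤ 2 * muZ * p ^ 2 := by linarith
    exact le_of_mul_le_mul_right h4 (by positivity)
  rcases h.toTWSol.growth_or hc h.exists_lt g1 g2 g3 hS (hradM.trans hMρ) with h1 | h1
  · exact h1
  · exfalso
    have h2 := h1.trans ((setIntegral_le_integral h.integrable_ee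
      (Eventually.of_forall ee_nonneg)).trans h.integral_ee_le)
    have h3 : X ≤ Real.log (ρ / radSum S) := by
      rw [Real.le_log_iff_exp_le (by positivity), le_div_iff₀ (by linarith), hρ, mul_comm]
      gcongr
    have h4 : Real.log (p / (K * V₀) / ρ) =
        Real.log p - Real.log (K * V₀) - (Real.log M + X) := by
      rw [Real.log_div (by positivity) hρ0.ne', Real.log_div hp0.ne' hKV.ne', hρ,
        Real.log_mul (by positivity) (Real.exp_pos _).ne', Real.log_exp]
    rw [h4] at h2
    have h5 : (2 * Real.pi + etaZ / 3) * X ≤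
        (2 * Real.pi + etaZ / 3) * Real.log (ρ / radSum S) := by gcongr
    have h6 : 16 * Real.pi * invSqSum S ≤ 16 * Real.pi * N := by gcongr
    have h7 : etaZ * S.card ≤ etaZ * N := by gcongr
    linarith

end GinzburgLandau

namespace GinzburgLandau
open scoped ContDiff Topology

variable {c : ℝ} {α β : ℂ → ℝ} {S : Finset (ℂ × ℝ)}

theorem IsCover.exists_uniform (h : IsCover α β S) {ρ : ℝ} (hρ : ∀ b ∈ S, b.2 ≤ ρ) :
    ∃ S', IsCover α β S' ∧ S'.card ≤ S.card ∧ ∀ b ∈ S', b.2 = ρ := by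
  classical
  refine ⟨S.image fun b => (b.1, ρ), ⟨fun b hb => ?_, fun z hz => ?_, fun b hb => ?_⟩,
    Finset.card_image_le, fun b hb => ?_⟩
  · obtain ⟨a, ha, rfl⟩ := Finset.mem_image.1 hb
    exact (h.one_le a ha).trans (hρ a ha)
  · obtain ⟨b, hb, hzb⟩ := h.cov z hz
    exact ⟨_, Finset.mem_image_of_mem _ hb, hzb.trans (hρ b hb)⟩
  · obtain ⟨a, ha, rfl⟩ := Finset.mem_image.1 hb
    obtain ⟨z, hz, hza⟩ := h.meets a ha
    exact ⟨z, hz, hza.trans (hρ a ha)⟩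
  · obtain ⟨a, ha, rfl⟩ := Finset.mem_image.1 hb
    rfl

namespace TWSol

/-- The zero set cannot be covered by a single ball of moderate radius. -/
theorem one_lt_card (h : TWSol c α β) (hc : c ≤ 1 / 40) {Rm : ℝ}
    (hp : 240 * (∫ z, en α β z) + 10000 * cutC * Rm * (∫ z, pot 1 α β z ^ 2) <
      2 * (-(1 / 2) * ∫ z, mom α β Complex.I z)) (hS : IsCover α β S) (hR : radSum S ≤ Rm) :
    1 < S.card := by
  by_contra! hcard
  have hd : ∀ a ∈ S, ∀ b ∈ S, a ≠ b → a.2 + b.2 < dist a.1 b.1 := fun a ha b hb hab =>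
    (hab (Finset.card_le_one.1 hcard a ha b hb)).elim
  obtain ⟨b, hb, hne⟩ := h.exists_deg_ne_zero hc hS hd (radSum_bound hR hp)
  have h1 := h.sum_deg hc hS hd
  rw [Finset.sum_eq_single_of_mem b hb fun a ha hab =>
    (hab (Finset.card_le_one.1 hcard a ha b hb)).elim] at h1
  exact hne h1

theorem exists_pair (h : TWSol c α β) (hc : c ≤ 1 / 40) {Rm ρ t : ℝ}
    (hp : 240 * (∫ z, en α β z) + 10000 * cutC * Rm * (∫ z, pot 1 α β z ^ 2) <
      2 * (-(1 / 2) * ∫ z, mom α β Complex.I z)) (hS : IsCover α β S) (hcard : S.card ≤ 2)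
    (hρ : radSum S ≤ ρ) (hρ1 : 1 ≤ ρ) (ht : 1 < t) (htR : 2 * (t * ρ) ≤ Rm) :
    ∃ x y : ℂ, x ≠ y ∧ IsDilatable α β {(x, ρ), (y, ρ)} t := by
  classical
  obtain ⟨T, hT, hTc, hTr⟩ := hS.exists_uniform (ρ := ρ) fun b hb => (hS.le_radSum hb).trans hρ
  have hrad : radSum T ≤ 2 * ρ := by
    rw [radSum, Finset.sum_congr rfl hTr, Finset.sum_const, nsmul_eq_mul]
    have : (T.card : ℝ) ≤ 2 := by exact_mod_cast hTc.trans hcard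
    gcongr
  have h1 := h.one_lt_card hc hp hT (hrad.trans (by nlinarith))
  have h2 : T.card = 2 := by omega
  obtain ⟨⟨x, r⟩, ⟨y, s⟩, hab, rfl⟩ := Finset.card_eq_two.1 h2
  obtain rfl : r = ρ := hTr (x, r) (by simp)
  obtain rfl : s = r := hTr (y, s) (by simp)
  have hxy : x ≠ y := fun e => hab (by rw [e])
  have hfar : t * (s + s) ≤ dist x y := by
    by_contra! hlt
    obtain ⟨T', hT', hc', hr', -⟩ := (hT.dilate ht.le).exists_merge (a := (x, t * s))
      (b := (y, t * s)) (mem_dilate.2 ⟨(x, s), by simp, rfl⟩)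
      (mem_dilate.2 ⟨(y, s), by simp, rfl⟩) (fun e => hxy (Prod.mk.inj e).1)
      (by simp only; linarith)
    rw [radSum_dilate (by linarith)] at hr'
    have h3 := h.one_lt_card hc hp hT' (hr'.trans (by nlinarith))
    have h4 := card_dilate_le (S := {(x, s), (y, s)}) t
    omega
  refine ⟨x, y, hxy, hT, ht, fun a ha b hb hne => ?_⟩
  simp only [Finset.mem_insert, Finset.mem_singleton] at ha hb
  rcases ha with rfl | rfl <;> rcases hb with rfl | rfl
  · exact (hne rfl).elim
  · exact hfar
  · rw [dist_comm]; exact hfar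
  · exact (hne rfl).elim

end TWSol

/-- The zero set lies in two distant balls, of opposite unit degrees. -/
structure IsDipole (α β : ℂ → ℝ) (ρ p : ℝ) (x y : ℂ) : Prop where
  quarter_le : ∀ z, ρ < dist z x → ρ < dist z y → 1 / 4 ≤ α z ^ 2 + β z ^ 2
  far : 63 / 200 * p ≤ dist x y
  deg_left : |∫ z in closedBall x ρ, vor α β z| = 2 * Real.pi
  deg_right : |∫ z in closedBall y ρ, vor α β z| = 2 * Real.pi

theorem IsDipole.symm {ρ p : ℝ} {x y : ℂ} (h : IsDipole α β ρ p x y) : IsDipole α β ρ p y x :=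
  ⟨fun z h1 h2 => h.quarter_le z h2 h1, by rw [dist_comm]; exact h.far, h.deg_right, h.deg_left⟩

/-- Two distant balls of opposite degrees of modulus at least two carry too much energy. -/
theorem IsDilatable.le_integral_pair {ρ t : ℝ} {x y : ℂ} (hα : ContDiff ℝ ∞ α)
    (hβ : ContDiff ℝ ∞ β) (hi : Integrable (ee α β)) (hxy : x ≠ y)
    (h : IsDilatable α β {(x, ρ), (y, ρ)} t) {n : ℤ} (hx : deg α β (x, ρ) = 2 * Real.pi * n)
    (hy : deg α β (y, ρ) = -(2 * Real.pi * n)) (hn : 2 ≤ |(n : ℝ)|) :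
    4 * Real.pi * Real.log t - 32 * Real.pi ≤ ∫ z, ee α β z := by
  have hpi := Real.pi_pos
  have hne : ((x, ρ) : ℂ × ℝ) ≠ (y, ρ) := fun e => hxy (Prod.mk.inj e).1
  have mx : ((x, ρ) : ℂ × ℝ) ∈ ({(x, ρ), (y, ρ)} : Finset (ℂ × ℝ)) := by simp
  have my : ((y, ρ) : ℂ × ℝ) ∈ ({(x, ρ), (y, ρ)} : Finset (ℂ × ℝ)) := by simp
  have hρ : 1 ≤ ρ := h.one_le _ mx
  have e1 := h.le_integral_annulus hα hβ mx
  have e2 := h.le_integral_annulus hα hβ my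
  have e3 := h.sum_annuli_add_le hi ee_nonneg
  have e4 := setIntegral_le_integral (s := (ballUnion {((x, ρ) : ℂ × ℝ), (y, ρ)})ᶜ)
    hi (Eventually.of_forall ee_nonneg)
  have e5 : 0 ≤ ∫ z in (ballUnion (dilate t {((x, ρ) : ℂ × ℝ), (y, ρ)}))ᶜ, ee α β z :=
    integral_nonneg fun z => ee_nonneg z
  rw [Finset.sum_pair hne] at e3
  rw [hy, abs_neg] at e2
  rw [hx] at e1
  simp only at e1 e2 e3
  have hρi : ρ⁻¹ ^ 2 ≤ 1 := by
    have : ρ⁻¹ ≤ 1 := inv_le_one_of_one_le₀ hρ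
    have : 0 ≤ ρ⁻¹ := by positivity
    nlinarith only [this, ‹ρ⁻¹ ≤ 1›]
  have habs : |2 * Real.pi * (n : ℝ)| = 2 * Real.pi * |(n : ℝ)| := by
    rw [abs_mul, abs_of_pos (by positivity)]
  have hm : 2 * Real.pi ≤ max (|2 * Real.pi * (n : ℝ)| - Real.pi) 0 := by
    refine le_max_of_le_left ?_
    rw [habs]; nlinarith only [hn, hpi]
  have e6 := mul_le_mul_of_nonneg_right hm (Real.log_pos h.one_lt).le
  have e7 : 16 * Real.pi * (ρ⁻¹ ^ 2 - (t * ρ)⁻¹ ^ 2) ≤ 16 * Real.pi * 1 := by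
    gcongr
    linarith only [sq_nonneg ((t * ρ)⁻¹), hρi]
  linarith only [e1, e2, e3, e4, e5, e6, e7]

theorem exists_isDipole {Λ V₀ ρ : ℝ} (hΛ : 0 < Λ) (hV₀ : 1 ≤ V₀) (hρ : 1 ≤ ρ) :
    ∀ᶠ p : ℝ in atTop, ∀ c α β S, QM Λ p c α β → c ≤ 1 / 40 → ∫ z, pot 1 α β z ^ 2 ≤ V₀ →
      IsCover α β S → S.card ≤ 2 → radSum S ≤ ρ → ∃ x y, IsDipole α β ρ p x y := by
  have hpi := Real.pi_pos
  have hC := one_le_cutC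
  set K := 10000 * cutC with hK
  have hK0 : 1 ≤ K := by rw [hK]; linarith
  have hKV : 0 < K * V₀ := by positivity
  set q := 2 * ρ * (K * V₀) with hq
  have hq0 : 0 < q := by positivity
  set Y := Λ + 4 * Real.pi * Real.log q + 32 * Real.pi with hY
  filter_upwards [eventually_mul_pow_log_le (480 * 100 * (7 + Λ)) 1,
    eventually_gt_atTop q, eventually_ge_atTop (400 * (K * ρ * V₀)),
    eventually_ge_atTop 1, Real.tendsto_log_atTop.eventually_gt_atTop (Y / (2 * Real.pi))]
    with p hp1 hp2 hp3 hp4 hp5 c α β S h hc hV hS hcard hr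
  rw [div_lt_iff₀ (by positivity)] at hp5
  have hp0 : 0 < p := by linarith
  have hE := h.energy_le' hΛ hp4
  have hL := Real.log_nonneg hp4
  rw [pow_one] at hp1
  have hE2 : 48000 * (∫ z, en α β z) ≤ p := by linarith only [hE, hp1]
  have g1 : 240 * (∫ z, en α β z) + 10000 * cutC * (p / (K * V₀)) * (∫ z, pot 1 α β z ^ 2) <
      2 * (-(1 / 2) * ∫ z, mom α β Complex.I z) := by
    rw [h.mom_eq, ← hK]
    have h2 : K * (p / (K * V₀)) * (∫ z, pot 1 α β z ^ 2) ≤ K * (p / (K * V₀)) * V₀ := by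
      gcongr
    have h3 : K * (p / (K * V₀)) * V₀ = p := by field_simp
    linarith only [h2, h3, hE2, hp0]
  have ht : 1 < p / q := by rwa [one_lt_div hq0]
  have htR : 2 * (p / q * ρ) ≤ p / (K * V₀) := by
    apply le_of_eq; rw [hq]; field_simp
  obtain ⟨x, y, hxy, hD⟩ := h.toTWSol.exists_pair hc g1 hS hcard hr hρ ht htR
  have hne : ((x, ρ) : ℂ × ℝ) ≠ (y, ρ) := fun e => hxy (Prod.mk.inj e).1
  have hx : ((x, ρ) : ℂ × ℝ) ∈ ({(x, ρ), (y, ρ)} : Finset (ℂ × ℝ)) := by simp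
  have hy : ((y, ρ) : ℂ × ℝ) ∈ ({(x, ρ), (y, ρ)} : Finset (ℂ × ℝ)) := by simp
  have hrad : radSum {((x, ρ) : ℂ × ℝ), (y, ρ)} = 2 * ρ := by
    rw [radSum, Finset.sum_pair hne]; ring
  have s1 := h.toTWSol.sum_deg hc hD.toIsCover hD.disj
  have s2 := h.toTWSol.abs_moment_sub_le hc hD.toIsCover hD.disj
  obtain ⟨n, hn⟩ := hD.exists_int_deg h.sα h.sβ hx
  rw [Finset.sum_pair hne] at s1 s2
  rw [h.mom_eq, hrad] at s2
  have hdy : deg α β (y, ρ) = -(2 * Real.pi * n) := by linarith only [s1, hn]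
  rw [hn, hdy] at s2
  simp only at s2
  have hV0 : 0 ≤ ∫ z, pot 1 α β z ^ 2 := integral_nonneg fun z => sq_nonneg _
  have s3 : 10000 * cutC * (2 * ρ) * (∫ z, pot 1 α β z ^ 2) ≤ p / 200 := by
    have : 10000 * cutC * (2 * ρ) * (∫ z, pot 1 α β z ^ 2) ≤ K * (2 * ρ) * V₀ := by
      rw [hK]; gcongr
    linarith only [this, hp3]
  have s4 := abs_le.1 s2
  have hn0 : n ≠ 0 := by
    rintro rfl
    simp only [Int.cast_zero] at s4
    linarith only [s4.2, s3, hE2, hp0]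
  have hn2 : |(n : ℝ)| < 2 := by
    by_contra! hlt
    have e1 := hD.le_integral_pair h.sα h.sβ h.integrable_ee hxy hn hdy hlt
    rw [Real.log_div hp0.ne' hq0.ne'] at e1
    have e8 := h.integral_ee_le
    linarith only [e1, e8, hp5, hY]
  have hn1 : |(n : ℝ)| = 1 := by
    have h1 : |n| < 2 := by exact_mod_cast hn2
    have h2 : |n| = 1 := by have := abs_pos.2 hn0; omega
    exact_mod_cast h2
  have d1 : |∫ z in closedBall x ρ, vor α β z| = 2 * Real.pi := by
    change |deg α β (x, ρ)| = _
    rw [hn, abs_mul, hn1, abs_of_pos (by positivity), mul_one]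
  have d2 : |∫ z in closedBall y ρ, vor α β z| = 2 * Real.pi := by
    change |deg α β (y, ρ)| = _
    rw [hdy, abs_neg, abs_mul, hn1, abs_of_pos (by positivity), mul_one]
  refine ⟨x, y, fun z h1 h2 => ?_, ?_, d1, d2⟩
  · by_contra! hlt
    obtain ⟨b, hb, hzb⟩ := hD.cov z hlt
    simp only [Finset.mem_insert, Finset.mem_singleton] at hb
    rcases hb with rfl | rfl
    · exact absurd hzb (not_le.2 h1)
    · exact absurd hzb (not_le.2 h2)
  · have h1 : (x.re - y.re) * (2 * Real.pi * n) ≤ dist x y * (2 * Real.pi) := by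
      refine (le_abs_self _).trans ?_
      rw [abs_mul, abs_mul, hn1, abs_of_pos (by positivity : 0 < 2 * Real.pi), mul_one]
      gcongr
      rw [dist_eq_norm, ← Complex.sub_re]
      exact Complex.abs_re_le_norm _
    have h2 : 199 / 100 * p ≤ dist x y * (2 * Real.pi) := by linarith only [s4.2, h1, s3, hE2, hp0]
    nlinarith only [Real.pi_lt_d4, dist_nonneg (x := x) (y := y), h2, hp0]

end GinzburgLandau

namespace GinzburgLandau
open scoped ContDiff Topology

variable {c : ℝ} {α β : ℂ → ℝ} {S : Finset (ℂ × ℝ)}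

namespace IsDipole

theorem le_integral_annulus {ρ p : ℝ} {x y : ℂ} (h : IsDipole α β ρ p x y) (hα : ContDiff ℝ ∞ α)
    (hβ : ContDiff ℝ ∞ β) {a b : ℝ} (ha1 : 1 ≤ a) (ha : ρ ≤ a) (hab : a < b)
    (hb : b + ρ ≤ dist x y) :
    Real.pi * Real.log (b / a) - 16 * Real.pi ≤ ∫ z in ball x b \ closedBall x a, ee α β z := by
  have hpi := Real.pi_pos
  have hy : ∀ z, dist z x < b → ρ < dist z y := fun z hz => by
    linarith [dist_triangle_left x y z]
  have hdeg : ∫ z in closedBall x a, vor α β z = ∫ z in closedBall x ρ, vor α β z := by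
    refine setIntegral_eq_of_subset_of_forall_sdiff_eq_zero measurableSet_closedBall
      (closedBall_subset_closedBall ha) fun z hz => vor_eq_zero hα hβ ?_
    have := h.quarter_le z (not_le.1 (mt mem_closedBall.2 hz.2)) (hy z ((mem_closedBall.1 hz.1).trans_lt hab))
    linarith
  have h1 := (GinzburgLandau.le_integral_annulus hα hβ x (by linarith) hab fun z h1 h2 =>
    h.quarter_le z (by rw [dist_eq_norm]; linarith) (hy z (by rwa [dist_eq_norm]))).2
  rw [hdeg, h.deg_left] at h1
  have hai : a⁻¹ ^ 2 ≤ 1 := by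
    have h2 : a⁻¹ ≤ 1 := inv_le_one_of_one_le₀ ha1
    have h3 : 0 ≤ a⁻¹ := by positivity
    nlinarith only [h2, h3]
  have h4 : 16 * Real.pi * (a⁻¹ ^ 2 - b⁻¹ ^ 2) ≤ 16 * Real.pi * 1 := by
    gcongr
    linarith only [sq_nonneg b⁻¹, hai]
  linarith only [h1, h4]

/-- The energy in a ball away from the vortices is bounded, since the annuli around them
already carry all the energy up to a constant. -/
theorem integral_ee_le {ρ p : ℝ} {x y : ℂ} (h : IsDipole α β ρ p x y) (hα : ContDiff ℝ ∞ α)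
    (hβ : ContDiff ℝ ∞ β) (hi : Integrable (ee α β)) {Λ : ℝ}
    (hE : ∫ z, ee α β z ≤ 2 * Real.pi * Real.log p + Λ) (hρ : 1 ≤ ρ) {r : ℝ} (hr : 80 * ρ ≤ r)
    (hrp : r ≤ 3 / 20 * p) {w : ℂ} (hw1 : r - ρ ≤ dist w x) (hw2 : dist w x ≤ r + ρ) :
    ∫ z in closedBall w (r / 40), ee α β z ≤ Λ + 48 * Real.pi
      + 2 * Real.pi * Real.log (800 / 63 * ρ) := by
  have hpi := Real.pi_pos
  have hfar := h.far
  have hp0 : 0 < p := by linarith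
  have hρ0 : 0 < ρ := by linarith
  have hr0 : 0 < r := by linarith
  set q := 63 / 400 * p with hq
  have hq0 : 0 < q := by positivity
  have e1 := h.le_integral_annulus hα hβ hρ le_rfl (b := r / 2) (by linarith) (by linarith)
  have e3 := h.symm.le_integral_annulus hα hβ hρ le_rfl (b := q) (by linarith)
    (by rw [dist_comm]; linarith)
  have e2 : Real.pi * Real.log (q / (2 * r)) - 16 * Real.pi ≤
      ∫ z in ball x q \ closedBall x (2 * r), ee α β z := by
    rcases lt_or_ge (2 * r) q with hlt | hge
    · exact h.le_integral_annulus hα hβ (by linarith) (by linarith) hlt (by linarith)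
    · have h1 : Real.log (q / (2 * r)) ≤ 0 :=
        Real.log_nonpos (by positivity) (div_le_one_of_le₀ hge (by positivity))
      have h2 : 0 ≤ ∫ z in ball x q \ closedBall x (2 * r), ee α β z :=
        integral_nonneg fun z => ee_nonneg z
      nlinarith only [h1, h2, hpi]
  rw [Real.log_div (by positivity) (by positivity)] at e1 e2 e3
  rw [Real.log_div hr0.ne' (by norm_num)] at e1
  rw [Real.log_mul (by norm_num) hr0.ne'] at e2
  have e4 : Real.log q = Real.log p + Real.log ρ + Real.log 2 - Real.log (800 / 63 * ρ) := by
    rw [← Real.log_mul hp0.ne' hρ0.ne', ← Real.log_mul (by positivity) (by norm_num),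
      ← Real.log_div (by positivity) (by positivity), hq]
    congr 1
    field_simp
    norm_num
  set A := ball x (r / 2) \ closedBall x ρ
  set B := ball x q \ closedBall x (2 * r)
  set D := ball y q \ closedBall y ρ
  set W := closedBall w (r / 40)
  have mB : MeasurableSet B := measurableSet_ball.diff measurableSet_closedBall
  have mD : MeasurableSet D := measurableSet_ball.diff measurableSet_closedBall
  have hW : ∀ z ∈ W, r / 2 < dist z x ∧ dist z x < 2 * r ∧ dist z x < q := fun z hz => by
    have h1 := mem_closedBall.1 hz
    have h2 := dist_triangle z w x
    have h3 := dist_triangle_left w x z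
    exact ⟨by linarith, by linarith, by linarith⟩
  have hxD : ∀ z ∈ D, q < dist z x := fun z hz => by
    have h1 := mem_ball.1 hz.1
    linarith [dist_triangle_left x y z]
  have d1 : Disjoint W A := Set.disjoint_left.2 fun z hz hz' => by
    linarith [(hW z hz).1, mem_ball.1 hz'.1]
  have d2 : Disjoint (W ∪ A) B := Set.disjoint_left.2 fun z hz hz' => by
    have h1 := not_le.1 (mt mem_closedBall.2 hz'.2)
    rcases hz with hz | hz
    · linarith [(hW z hz).2.1]
    · linarith [mem_ball.1 hz.1]
  have d3 : Disjoint ((W ∪ A) ∪ B) D := Set.disjoint_left.2 fun z hz hz' => by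
    have h1 := hxD z hz'
    rcases hz with (hz | hz) | hz
    · linarith [(hW z hz).2.2]
    · linarith [mem_ball.1 hz.1]
    · linarith [mem_ball.1 hz.1]
  have mA : MeasurableSet A := measurableSet_ball.diff measurableSet_closedBall
  have i1 := setIntegral_union d1 mA hi.integrableOn hi.integrableOn
  have i2 := setIntegral_union d2 mB hi.integrableOn hi.integrableOn
  have i3 := setIntegral_union d3 mD hi.integrableOn hi.integrableOn
  have i4 := setIntegral_le_integral (s := ((W ∪ A) ∪ B) ∪ D) hi (Eventually.of_forall ee_nonneg)
  rw [i3, i2, i1] at i4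
  rw [e4] at e2 e3
  linarith only [i4, e1, e2, e3, hE]

theorem quarter_le_of_dist {ρ p : ℝ} {x y : ℂ} (h : IsDipole α β ρ p x y) (hρ : 1 ≤ ρ) {r : ℝ}
    (hr : 80 * ρ ≤ r) (hrp : r ≤ 3 / 20 * p) {w : ℂ} (hw1 : r - ρ ≤ dist w x)
    (hw2 : dist w x ≤ r + ρ) {z : ℂ} (hz : dist z w ≤ r / 40) :
    1 / 4 ≤ α z ^ 2 + β z ^ 2 := by
  have h1 := dist_triangle z w x
  have h2 := dist_triangle_left w x z
  have h3 := dist_triangle_left x y z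
  have h4 := h.far
  exact h.quarter_le z (by linarith) (by linarith)

end IsDipole

end GinzburgLandau

namespace GinzburgLandau
open scoped ContDiff Topology

variable {c : ℝ} {α β : ℂ → ℝ} {S : Finset (ℂ × ℝ)}

/-- Decay of the density and of its derivatives away from the vortices. -/
theorem exists_decay {Λ : ℝ} (hΛ : 0 < Λ) : ∃ C R₀ : ℝ, 0 < C ∧ 0 < R₀ ∧ ∀ᶠ p : ℝ in atTop,
    ∀ c α β, QM Λ p c α β → ∀ z, α z ^ 2 + β z ^ 2 < 1 / 4 → ∀ w, R₀ ≤ dist w z →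
      dist w z ≤ 3 / 20 * p → 1 / 4 ≤ α w ^ 2 + β w ^ 2 ∧ gsq α β w ≤ C / dist w z ^ 2 ∧
        |pot 1 α β w| ≤ C / dist w z ^ 2 ∧
        ∀ e, IsDir e → |dd e (pot 1 α β) w| ≤ C / dist w z ^ 3 := by
  have hpi := Real.pi_pos
  obtain ⟨V₀, hV₀, hP⟩ := exists_potential_bound hΛ
  obtain ⟨ρ, hρ, hS⟩ := exists_two_balls hΛ hV₀
  have hlog : 0 ≤ Real.log (800 / 63 * ρ) := Real.log_nonneg (by linarith)
  set C₁ := Λ + 48 * Real.pi + 2 * Real.pi * Real.log (800 / 63 * ρ) with hC₁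
  have hC₁0 : 0 < C₁ := by positivity
  obtain ⟨R₁, C, hR₁, hC, hdecay⟩ :=
    exists_local_decay (32 * C₁ + Real.pi * V₀ ^ 2) (by positivity)
  refine ⟨2 * (C * 360 ^ 3 + V₀ ^ 2), 80 * ρ + 360 * R₁, by positivity, by positivity, ?_⟩
  filter_upwards [hP, hS, exists_isDipole hΛ hV₀ hρ, eventually_gt_atTop 0]
    with p hP hS hD hp0 c α β h z hz w hw1 hw2
  obtain ⟨hc, hV⟩ := hP c α β h
  obtain ⟨S, hS, hcard, hrad⟩ := hS c α β h hc hV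
  obtain ⟨x, y, hxy⟩ := hD c α β S h hc hV hS hcard hrad
  have hα := h.sα
  have hβ := h.sβ
  have h0 := h.pos
  obtain ⟨x, y, hxy, hzx⟩ : ∃ x y, IsDipole α β ρ p x y ∧ dist z x ≤ ρ := by
    by_contra! hh
    linarith [hxy.quarter_le z (hh x y hxy) (hh y x hxy.symm)]
  set r := dist w z with hr
  have hr80 : 80 * ρ ≤ r := by linarith
  have hr0 : 0 < r := by linarith
  have hwx1 : r - ρ ≤ dist w x := by
    have := dist_triangle_right w z x
    linarith
  have hwx2 : dist w x ≤ r + ρ := by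
    have := dist_triangle w z x
    linarith
  have hq : ∀ v, dist v w ≤ r / 40 → 1 / 4 ≤ α v ^ 2 + β v ^ 2 := fun v hv =>
    hxy.quarter_le_of_dist hρ hr80 hw2 hwx1 hwx2 hv
  have hE := hxy.integral_ee_le hα hβ h.integrable_ee h.integral_ee_le hρ hr80 hw2 hwx1 hwx2
  rw [← hC₁] at hE
  have hcp : c * p ≤ V₀ / 2 := by have := h.potential_eq; linarith
  have hcr : c * r ≤ V₀ := by nlinarith only [hcp, hw2, h0, hp0, hV₀]
  have hcr2 : c ^ 2 * r ^ 2 ≤ V₀ ^ 2 := by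
    rw [← mul_pow]; gcongr
  have hv := h.gauge (by linarith)
  have e9 : 9 * (r / 360) = r / 40 := by ring
  have hIv : ∫ v in closedBall w (9 * (r / 360)),
      ed (1 + c ^ 2 / 4) (gaugeRe c α β) (gaugeIm c α β) v ≤ 32 * C₁ + Real.pi * V₀ ^ 2 := by
    rw [e9]
    have h4 : ∫ v in closedBall w (r / 40),
        ed (1 + c ^ 2 / 4) (gaugeRe c α β) (gaugeIm c α β) v ≤
        ∫ v in closedBall w (r / 40), (32 * ee α β v + 3 * c ^ 2) := by
      refine setIntegral_mono_on
        (integrableOn_closedBall (contDiff_ed hv.sα hv.sβ).continuous _ _)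
        (integrableOn_closedBall (by fun_prop) _ _) measurableSet_closedBall fun v _ => ?_
      linarith [h.ed_gauge_le (by linarith) v, ed_le_ee (α := α) (β := β) v]
    rw [integral_add (integrableOn_closedBall (by fun_prop) _ _)
      (integrableOn_const measure_closedBall_lt_top.ne), integral_const_mul, setIntegral_const,
      smul_eq_mul, volume_real_closedBall w (by positivity)] at h4
    have h5 : Real.pi * (r / 40) ^ 2 * (3 * c ^ 2) ≤ Real.pi * V₀ ^ 2 := by
      have : Real.pi * (c ^ 2 * r ^ 2) ≤ Real.pi * V₀ ^ 2 := by gcongr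
      have h6 : 0 ≤ Real.pi * (c ^ 2 * r ^ 2) := by positivity
      linarith only [this, h6]
    linarith only [h4, h5, hE]
  obtain ⟨a1, a2, a3⟩ := hdecay _ _ _ hv w (r / 360) (by linarith) (fun v hv => by
    rw [gauge_normSq]
    exact hq v (by rw [← e9]; exact (mem_ball.1 hv).le)) hIv
  have b2 : C / (r / 360) ^ 2 ≤ C * 360 ^ 3 / r ^ 2 := by
    rw [div_pow, div_div_eq_mul_div]
    gcongr <;> norm_num
  have b3 : C / (r / 360) ^ 3 ≤ 2 * (C * 360 ^ 3 + V₀ ^ 2) / r ^ 3 := by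
    rw [div_pow, div_div_eq_mul_div]
    refine div_le_div_of_nonneg_right ?_ (by positivity)
    linarith only [sq_nonneg V₀, hC]
  have bc : c ^ 2 ≤ V₀ ^ 2 / r ^ 2 := by rwa [le_div_iff₀ (by positivity)]
  have bs : 2 * (C * 360 ^ 3 + V₀ ^ 2) / r ^ 2 = 2 * (C * 360 ^ 3 / r ^ 2) + 2 * (V₀ ^ 2 / r ^ 2) := by
    ring
  have hp1 := hv.pot_nonneg w
  refine ⟨hq w (by rw [dist_self]; positivity), ?_, ?_, fun e he => ?_⟩
  · rw [bs]
    linarith only [h.gsq_le_gauge (by linarith) w, a1, b2, bc]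
  · rw [pot_gauge] at a2 hp1
    have : 0 ≤ C * 360 ^ 3 / r ^ 2 := by positivity
    have : 0 ≤ V₀ ^ 2 / r ^ 2 := by positivity
    rw [bs, abs_le]
    constructor <;> linarith [sq_nonneg c]
  · have := a3 e he
    rw [show pot (1 + c ^ 2 / 4) (gaugeRe c α β) (gaugeIm c α β) = fun z => pot 1 α β z + c ^ 2 / 4
      from funext fun z => pot_gauge z] at this
    simp (disch := fun_prop) only [dd_add, dd_const, add_zero] at this
    exact this.trans b3

end GinzburgLandau

namespace GinzburgLandau
open scoped ContDiff Topology

section Bridge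

variable {u : ℂ → ℂ}

theorem fderiv_re_apply (hu : ContDiff ℝ ∞ u) (e z : ℂ) :
    dd e (fun w => (u w).re) z = (fderiv ℝ u z e).re := by
  have h := Complex.reCLM.hasFDerivAt.comp z ((hu.differentiable (by simp)) z).hasFDerivAt
  exact congrArg (fun L : ℂ →L[ℝ] ℝ => L e) h.fderiv

theorem fderiv_im_apply (hu : ContDiff ℝ ∞ u) (e z : ℂ) :
    dd e (fun w => (u w).im) z = (fderiv ℝ u z e).im := by
  have h := Complex.imCLM.hasFDerivAt.comp z ((hu.differentiable (by simp)) z).hasFDerivAt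
  exact congrArg (fun L : ℂ →L[ℝ] ℝ => L e) h.fderiv

theorem contDiff_re_comp (hu : ContDiff ℝ ∞ u) : ContDiff ℝ ∞ fun z => (u z).re :=
  Complex.reCLM.contDiff.comp hu

theorem contDiff_im_comp (hu : ContDiff ℝ ∞ u) : ContDiff ℝ ∞ fun z => (u z).im :=
  Complex.imCLM.contDiff.comp hu

theorem sq_norm_eq (z : ℂ) : ‖u z‖ ^ 2 = (u z).re ^ 2 + (u z).im ^ 2 := by
  rw [Complex.sq_norm, Complex.normSq_apply]; ring

theorem gradSq_eq (hu : ContDiff ℝ ∞ u) (z : ℂ) :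
    gradSq u z = gsq (fun z => (u z).re) (fun z => (u z).im) z := by
  unfold gradSq gsq pd1 pd2
  simp only [fderiv_re_apply hu, fderiv_im_apply hu]
  rw [Complex.sq_norm, Complex.sq_norm, Complex.normSq_apply, Complex.normSq_apply]; ring

theorem energyDensity_eq (hu : ContDiff ℝ ∞ u) :
    energyDensity u = en (fun z => (u z).re) (fun z => (u z).im) := by
  funext z
  rw [energyDensity, gradSq_eq hu, sq_norm_eq, en, pot]

theorem momDensity_eq (hu : ContDiff ℝ ∞ u) (z : ℂ) :
    momDensity u z = -mom (fun z => (u z).re) (fun z => (u z).im) Complex.I z := by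
  simp only [momDensity, pd2, mom, fderiv_re_apply hu, fderiv_im_apply hu]
  simp
  ring

theorem lap_re (hu : ContDiff ℝ ∞ u) (z : ℂ) :
    (lap u z).re = Lap (fun z => (u z).re) z := by
  have h1 (e : ℂ) : dd e (fun w => (u w).re) = fun w => (dd e u w).re :=
    funext fun w => fderiv_re_apply hu e w
  have h2 (e : ℂ) : ContDiff ℝ ∞ (dd e u) := contDiff_dd hu
  rw [Lap, h1, h1, fderiv_re_apply (h2 1), fderiv_re_apply (h2 Complex.I), lap, Complex.add_re]
  rfl

theorem lap_im (hu : ContDiff ℝ ∞ u) (z : ℂ) :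
    (lap u z).im = Lap (fun z => (u z).im) z := by
  have h1 (e : ℂ) : dd e (fun w => (u w).im) = fun w => (dd e u w).im :=
    funext fun w => fderiv_im_apply hu e w
  have h2 (e : ℂ) : ContDiff ℝ ∞ (dd e u) := contDiff_dd hu
  rw [Lap, h1, h1, fderiv_im_apply (h2 1), fderiv_im_apply (h2 Complex.I), lap, Complex.add_im]
  rfl

theorem integrable_energyDensity (hu : memE u) :
    Integrable (en (fun z => (u z).re) (fun z => (u z).im)) := by
  have hα := contDiff_re_comp hu.1
  have hβ := contDiff_im_comp hu.1
  refine ⟨(contDiff_en hα hβ).continuous.aestronglyMeasurable, ?_⟩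
  rw [hasFiniteIntegral_iff_ofReal (Eventually.of_forall fun z => en_nonneg z),
    ← energyDensity_eq hu.1]
  exact hu.2

theorem Efun_eq (hu : memE u) : Efun u = ∫ z, en (fun z => (u z).re) (fun z => (u z).im) z := by
  rw [integral_eq_lintegral_of_nonneg_ae (Eventually.of_forall fun z => en_nonneg z)
    (integrable_energyDensity hu).1, ← energyDensity_eq hu.1]
  rfl

theorem QuasiMin.qm {Λ p c : ℝ} (h : QuasiMin Λ u p c) {z : ℂ} (hz : u z = 0) :
    QM Λ p c (fun z => (u z).re) (fun z => (u z).im) := by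
  obtain ⟨hu, -, hc, htw, hm, hp, hE⟩ := h
  have hα := contDiff_re_comp hu.1
  have hβ := contDiff_im_comp hu.1
  have hmom : mom (fun z => (u z).re) (fun z => (u z).im) Complex.I =
      fun z => -momDensity u z := funext fun z => by rw [momDensity_eq hu.1, neg_neg]
  refine ⟨⟨hα, hβ, hc, fun z => ?_, fun z => ?_, ?_, ?_⟩, ?_, ?_, ⟨z, ?_⟩⟩
  · have h1 := congrArg Complex.re (htw z)
    simp only [Complex.sub_re, lap_re hu.1, Complex.re_ofReal_mul, sq_norm_eq] at h1
    simp at h1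
    rw [fderiv_im_apply hu.1, pot]
    rw [pd2] at h1
    linarith
  · have h1 := congrArg Complex.im (htw z)
    simp only [Complex.sub_im, lap_im hu.1, Complex.im_ofReal_mul, sq_norm_eq] at h1
    simp at h1
    rw [fderiv_re_apply hu.1, pot]
    rw [pd2] at h1
    linarith
  · refine ((integrable_energyDensity hu).const_mul 4).mono'
      (contDiff_ed hα hβ).continuous.aestronglyMeasurable (Eventually.of_forall fun z => ?_)
    rw [Real.norm_of_nonneg (ed_nonneg z)]
    exact ed_le_en z
  · rw [hmom]; exact hm.neg
  · rw [hmom, integral_neg, ← hp, P2]; ring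
  · rw [← Efun_eq hu]; exact hE
  · simp only [hz]; norm_num

theorem abs_norm_sub_one_le (z : ℂ) :
    |‖u z‖ - 1| ≤ |pot 1 (fun z => (u z).re) (fun z => (u z).im) z| := by
  rw [pot, ← sq_norm_eq, abs_sub_comm 1,
    show ‖u z‖ ^ 2 - 1 = (‖u z‖ - 1) * (‖u z‖ + 1) by ring, abs_mul]
  refine le_mul_of_one_le_right (abs_nonneg _) ?_
  rw [abs_of_nonneg (by positivity)]
  linarith [norm_nonneg (u z)]

theorem norm_fderiv_norm_le (hu : ContDiff ℝ ∞ u) {z : ℂ}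
    (hz : 1 / 4 ≤ (u z).re ^ 2 + (u z).im ^ 2) {B : ℝ}
    (hB : ∀ e, IsDir e → |dd e (pot 1 (fun z => (u z).re) (fun z => (u z).im)) z| ≤ B) :
    ‖fderiv ℝ (fun w => ‖u w‖) z‖ ≤ 2 * B := by
  have hα := contDiff_re_comp hu
  have hβ := contDiff_im_comp hu
  set P := pot 1 (fun z => (u z).re) (fun z => (u z).im) with hP
  have hPd : HasFDerivAt P (fderiv ℝ P z) z :=
    ((contDiff_pot hα hβ).differentiable (by simp) z).hasFDerivAt
  have he : (fun w => ‖u w‖) = fun w => √(1 - P w) := funext fun w => by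
    rw [hP, pot, ← sq_norm_eq, sub_sub_cancel, Real.sqrt_sq (norm_nonneg _)]
  have hz' : 1 / 4 ≤ 1 - P z := by rw [hP, pot]; linarith
  have hd := (hPd.const_sub 1).sqrt (by linarith)
  rw [he, hd.fderiv, norm_smul, norm_neg]
  have h1 := norm_fderiv_le_of_dd_le (hB 1 (Or.inl rfl)) (hB Complex.I (Or.inr rfl))
  have h2 : 1 / 2 ≤ √(1 - P z) := Real.le_sqrt_of_sq_le (by linarith)
  have h3 : ‖1 / (2 * √(1 - P z))‖ ≤ 1 := by
    rw [Real.norm_of_nonneg (by positivity), div_le_one (by positivity)]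
    linarith
  calc ‖1 / (2 * √(1 - P z))‖ * ‖fderiv ℝ P z‖ ≤ 1 * (2 * B) := by gcongr
    _ = 2 * B := one_mul _

theorem norm_fderiv_le (hu : ContDiff ℝ ∞ u) (z : ℂ) {B : ℝ} (hB : 0 ≤ B)
    (h : gsq (fun z => (u z).re) (fun z => (u z).im) z ≤ B ^ 2) : ‖fderiv ℝ u z‖ ≤ 2 * B := by
  rw [← gradSq_eq hu, gradSq, pd1, pd2] at h
  have h1 : ‖fderiv ℝ u z 1‖ ≤ B :=
    abs_le_of_sq_le_sq' (by linarith [sq_nonneg ‖fderiv ℝ u z Complex.I‖]) hB |>.2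
  have h2 : ‖fderiv ℝ u z Complex.I‖ ≤ B :=
    abs_le_of_sq_le_sq' (by linarith [sq_nonneg ‖fderiv ℝ u z 1‖]) hB |>.2
  refine ContinuousLinearMap.opNorm_le_bound _ (by positivity) fun w => ?_
  have hw : w = w.re • (1 : ℂ) + w.im • Complex.I := by
    simp
  have h3 : fderiv ℝ u z w = w.re • fderiv ℝ u z 1 + w.im • fderiv ℝ u z Complex.I := by
    rw [← map_smul, ← map_smul, ← map_add, ← hw]
  rw [h3]
  refine (norm_add_le _ _).trans ?_
  rw [norm_smul, norm_smul]
  have a1 := mul_le_mul (Complex.abs_re_le_norm w) h1 (norm_nonneg _) (norm_nonneg w)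
  have a2 := mul_le_mul (Complex.abs_im_le_norm w) h2 (norm_nonneg _) (norm_nonneg w)
  rw [Real.norm_eq_abs, Real.norm_eq_abs]
  linarith

end Bridge

end GinzburgLandau

/-- decay slightly away from the vortices. -/
theorem decay_near_vortices (Λ₀ : ℝ) (hΛ₀ : 0 < Λ₀) :
    ∃ C R₀ p₀ : ℝ, 0 < C ∧ 0 < R₀ ∧ 0 < p₀ ∧
      ∀ (u : ℂ → ℂ) (p c : ℝ), QuasiMin Λ₀ u p c → p₀ ≤ p →
        ∀ z : ℂ, u z = 0 →
          ∀ y : ℂ, 2 * R₀ ≤ ‖y‖ → ‖y‖ ≤ (3 / 20) * p →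
            |‖u (z + y)‖ - 1| ≤ C / ‖y‖ ^ 2 ∧
            ‖fderiv ℝ (fun w => ‖u w‖) (z + y)‖ ≤ C / ‖y‖ ^ 3 ∧
            ‖fderiv ℝ u (z + y)‖ ≤ C / ‖y‖ := by
  obtain ⟨C, R₀, hC, hR₀, hev⟩ := GinzburgLandau.exists_decay hΛ₀
  obtain ⟨p₁, hp₁⟩ := eventually_atTop.1 hev
  refine ⟨2 * (C + 1), R₀, max p₁ 1, by positivity, hR₀, by positivity,
    fun u p c h hp z hz y hy1 hy2 => ?_⟩
  have hu := h.1.1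
  have hy0 : 0 < ‖y‖ := by linarith
  have hd : dist (z + y) z = ‖y‖ := by rw [dist_eq_norm, add_sub_cancel_left]
  obtain ⟨b1, b2, b3, b4⟩ := hp₁ p ((le_max_left _ _).trans hp) c _ _
    (GinzburgLandau.QuasiMin.qm h hz) z (by simp only [hz]; norm_num) (z + y)
    (by rw [hd]; linarith) (by rw [hd]; exact hy2)
  rw [hd] at b2 b3 b4
  refine ⟨(GinzburgLandau.abs_norm_sub_one_le _).trans (b3.trans ?_),
    (GinzburgLandau.norm_fderiv_norm_le hu b1 b4).trans ?_,
    (GinzburgLandau.norm_fderiv_le hu _ (B := (C + 1) / ‖y‖) (by positivity)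
      (b2.trans ?_)).trans ?_⟩
  · gcongr; linarith
  · rw [← mul_div_assoc]; gcongr; linarith
  · rw [div_pow]; gcongr; nlinarith
  · rw [mul_div_assoc]
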